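/- Suppose x, y, z, t₁, t₂ ∈ G(𝒜) satisfy all of: t₁^{p₁} = e and t₁ ≠ e; t₂^{p₂} = e and t₂ ≠ e; v(t₁,t₂) = v(t₂,t₁) = e; u_b(x,t₁) = u_b(x,t₂) = e with x^{p₁} ≠ e and x^{p₂} ≠ e; u_c(y,t₁) = u_c(y,t₂) = e with y^{p₁} ≠ e and y^{p₂} ≠ e; u_d(z,t₁) = u_d(z,t₂) = e with z^{p₁} ≠ e and z^{p₂} ≠ e. Then there exists g ∈ G(𝒜) such that x = g b g⁻¹, y = g c g⁻¹, z = g d g⁻¹, t₁ = g f₁ g⁻¹, and t₂ = g f₂ g⁻¹. In particular, the orbit of the tuple (b,c,d,f₁,f₂) under the automorphism group of G(𝒜) is defined by this finitary quantifier-free condition. -/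

import Mathlib

/-!
Common setup: an `L`-structure `𝒜` for a language whose symbols are enumerated
(`m`-th symbol, `m ≥ 1`, each a function or relation symbol of arity ≥ 1), and the
presented group `G(𝒜)` of Harrison-Trainor and Ho.
-/

/-- A first-order language with symbols enumerated by `ℕ` (the `m`-th symbol, for `m ≥ 1`,
is a function symbol if `isFunc m`, and a relation symbol otherwise, of arity `arity m ≥ 1`),
together with an interpretation on a domain `A`: `funcInterp m` interprets the `m`-th symbol
when it is a function symbol, and `relInterp m` when it is a relation symbol. -/
structure IndexedStructure where
  A : Type
  arity : ℕ → ℕ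
  arity_pos : ∀ m, 1 ≤ m → 1 ≤ arity m
  isFunc : ℕ → Prop
  funcInterp : ∀ m, (Fin (arity m) → A) → A
  relInterp : ∀ m, (Fin (arity m) → A) → Prop

/-- The generating set of `G(𝒜)`: one generator for each element of the domain `A`,
plus five further generators `b`, `c`, `d`, `f₁`, `f₂`. -/
inductive GenSym (A : Type) : Type
  | elt : A → GenSym A
  | b : GenSym A
  | c : GenSym A
  | d : GenSym A
  | f1 : GenSym A
  | f2 : GenSym A

/-- `chainProd lo x y = x y^{(lo+1)²} x y^{(lo+2)²} ⋯ x y^{(lo+1000)²}`.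
So `u_A = chainProd 0`, `u_b = chainProd 1000`, `u_c = chainProd 2000`,
`u_d = chainProd 3000`, and `v = chainProd 4000`. -/
def chainProd {G : Type*} [Group G] (lo : ℕ) (x y : G) : G :=
  ((List.range 1000).map fun k => x * y ^ ((lo + k + 1) ^ 2)).prod

/-- `wProd m xs y = x₁⋯xₙ y^{100m+1} x₁⋯xₙ y^{100m+2} ⋯ x₁⋯xₙ y^{100m+100}`,
i.e. the word `w_m(x₁,…,xₙ,y)`. -/
def wProd {G : Type*} [Group G] (m : ℕ) {n : ℕ} (xs : Fin n → G) (y : G) : G :=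
  ((List.range 100).map fun k => (List.ofFn xs).prod * y ^ (100 * m + k + 1)).prod

/-- The set of relators of the presentation of `G(𝒜)`. -/
def grpRels (S : IndexedStructure) (p₁ p₂ : ℕ) : Set (FreeGroup (GenSym S.A)) :=
  {FreeGroup.of GenSym.f1 ^ p₁, FreeGroup.of GenSym.f2 ^ p₂,
    chainProd 4000 (FreeGroup.of GenSym.f1) (FreeGroup.of GenSym.f2),
    chainProd 4000 (FreeGroup.of GenSym.f2) (FreeGroup.of GenSym.f1),
    chainProd 1000 (FreeGroup.of GenSym.b) (FreeGroup.of GenSym.f1),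
    chainProd 1000 (FreeGroup.of GenSym.b) (FreeGroup.of GenSym.f2),
    chainProd 2000 (FreeGroup.of GenSym.c) (FreeGroup.of GenSym.f1),
    chainProd 2000 (FreeGroup.of GenSym.c) (FreeGroup.of GenSym.f2),
    chainProd 3000 (FreeGroup.of GenSym.d) (FreeGroup.of GenSym.f1),
    chainProd 3000 (FreeGroup.of GenSym.d) (FreeGroup.of GenSym.f2)}
  ∪ {r | ∃ a : S.A,
      r = chainProd 0 (FreeGroup.of (GenSym.elt a)) (FreeGroup.of GenSym.c) ∨
      r = chainProd 0 (FreeGroup.of (GenSym.elt a)) (FreeGroup.of GenSym.d)}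
  ∪ {r | ∃ m, 1 ≤ m ∧ S.isFunc m ∧ ∃ as : Fin (S.arity m) → S.A,
      r = wProd m (fun i => FreeGroup.of (GenSym.elt (as i))) (FreeGroup.of GenSym.b) *
        (FreeGroup.of (GenSym.elt (S.funcInterp m as)))⁻¹}
  ∪ {r | ∃ m, 1 ≤ m ∧ ¬ S.isFunc m ∧ ∃ as : Fin (S.arity m) → S.A,
      S.relInterp m as ∧
      r = wProd m (fun i => FreeGroup.of (GenSym.elt (as i))) (FreeGroup.of GenSym.b)}

/-- The group `G(𝒜)`, presented on the generators `GenSym A` with relators `grpRels`. -/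
abbrev GA (S : IndexedStructure) (p₁ p₂ : ℕ) : Type :=
  PresentedGroup (grpRels S p₁ p₂)

/-- The image in `G(𝒜)` of a generator. -/
def gen (S : IndexedStructure) (p₁ p₂ : ℕ) (g : GenSym S.A) : GA S p₁ p₂ :=
  PresentedGroup.of g


theorem take_pre {α : Type*} (n : ℕ) (l : List α) : l.take n <+: l := ⟨l.drop n, List.take_append_drop n l⟩

theorem dropLast_pre {α : Type*} (l : List α) : l.dropLast <+: l := by
  rw [List.dropLast_eq_take]; exact take_pre _ _

theorem chain_inf {α : Type*} {R : α → α → Prop} {l l' : List α} (h : List.IsChain R l) (h' : l' <:+: l) :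
    List.IsChain R l' := by
  obtain ⟨u, v, rfl⟩ := h'
  exact h.left_of_append.right_of_append

/-- Abstract data for the windmill argument. -/
structure WD (G : Type*) [Group G] where
  C : Set G
  len : G → ℕ
  d : G → G → G → ℕ
  P : G → G → G → Prop
  S : Set G
  C_conj : ∀ g c, c ∈ C → g * c * g⁻¹ ∈ C
  len_conj : ∀ g c, len (g * c * g⁻¹) = len c
  len_ge : ∀ c ∈ C, 24 ≤ len c
  d_self : ∀ c x, d c x x = 0
  d_symm : ∀ c x y, d c x y = d c y x
  d_tri : ∀ c x y z, c ∈ C → d c x z ≤ d c x y + d c y z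
  d_conj : ∀ g c x y, c ∈ C → d (g * c * g⁻¹) (g * x) (g * y) = d c x y
  rot : ∀ c ∈ C, ∀ (k : ℤ), k ≠ 0 → ∀ x, len c ≤ d c x (c ^ k * x)
  P_conj : ∀ g c e x, c ∈ C → e ∈ C → P c e x → P (g * c * g⁻¹) (g * e * g⁻¹) (g * x)
  P_or : ∀ c ∈ C, ∀ e ∈ C, c ≠ e → ∀ x, P c e x ∨ P e c x
  P_d : ∀ c ∈ C, ∀ e ∈ C, c ≠ e → ∀ x y, P c e x → P c e y → 24 * d c x y < len c
  S_top : Subgroup.closure S = ⊤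
  S_d : ∀ c ∈ C, ∀ x, ∀ s ∈ S, d c x (x * s) ≤ 1

namespace WD

variable {G : Type*} [Group G] (D : WD G)

structure IsWindmill (K : Subgroup G) (W : Set G) : Prop where
  one_mem : (1 : G) ∈ W
  smul_mem : ∀ k ∈ K, ∀ x ∈ W, k * x ∈ W
  small : ∀ c ∈ D.C, c ∉ K → ∀ x ∈ W, ∀ y ∈ W, 24 * D.d c x y ≤ 3 * D.len c
  green : ∀ n ∈ K, n ≠ 1 → ∃ c ∈ D.C, 20 * D.len c ≤ 24 * D.d c 1 n

inductive Reach (K : Subgroup G) (B : Set G) : G → G → Prop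
  | base (c : G) (k : ℤ) (g : G) : c ∈ B → k ≠ 0 → g ∈ K → Reach K B c (c ^ k * g)
  | step (c : G) (k : ℤ) (c' g : G) : c ∈ B → k ≠ 0 → c' ≠ c → Reach K B c' g →
      Reach K B c (c ^ k * g)

theorem Reach.mem {K : Subgroup G} {B : Set G} {c g : G} (h : Reach K B c g) : c ∈ B := by
  cases h <;> assumption

theorem Reach.conj {K : Subgroup G} {B : Set G} (hB : ∀ k ∈ K, ∀ c ∈ B, k * c * k⁻¹ ∈ B)
    {c g : G} (h : Reach K B c g) (κ : G) (hκ : κ ∈ K) :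
    Reach K B (κ * c * κ⁻¹) (κ * g) := by
  induction h with
  | base c k g hc hk hg =>
    have := Reach.base (K := K) (κ * c * κ⁻¹) k (κ * g) (hB κ hκ c hc) hk (K.mul_mem hκ hg)
    convert this using 1
    rw [conj_zpow]; group
  | step c k c' g hc hk hne _ ih =>
    have := Reach.step (K := K) (κ * c * κ⁻¹) k _ _ (hB κ hκ c hc) hk (by simpa using hne) ih
    convert this using 1
    rw [conj_zpow]; group

theorem Reach.pow_mul {K : Subgroup G} {B : Set G} {b g : G} (hb : b ∈ B) (k : ℤ)
    (h : g ∈ K ∨ ∃ c, Reach K B c g) : b ^ k * g ∈ K ∨ ∃ c, Reach K B c (b ^ k * g) := by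
  by_cases hk : k = 0
  · simpa [hk] using h
  rcases h with h | ⟨c, h⟩
  · exact Or.inr ⟨b, .base b k g hb hk h⟩
  · by_cases hcb : c = b
    · subst hcb
      cases h with
      | base _ k' g' hc hk' hg =>
        rw [← mul_assoc, ← zpow_add]
        by_cases h0 : k + k' = 0
        · left; simpa [h0] using hg
        · exact Or.inr ⟨_, .base _ _ _ hb h0 hg⟩
      | step _ k' c' g' hc hk' hne hg =>
        rw [← mul_assoc, ← zpow_add]
        by_cases h0 : k + k' = 0
        · right; exact ⟨c', by simpa [h0] using hg⟩
        · exact Or.inr ⟨_, .step _ _ _ _ hb h0 hne hg⟩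
    · exact Or.inr ⟨b, .step b k c g hb hk hcb h⟩

theorem reach_of_mem {K : Subgroup G} {B : Set G} (hB : ∀ k ∈ K, ∀ c ∈ B, k * c * k⁻¹ ∈ B)
    (g : G) (hg : g ∈ Subgroup.closure ((K : Set G) ∪ B)) : g ∈ K ∨ ∃ c, Reach K B c g := by
  have hK : ∀ κ ∈ K, ∀ g, (g ∈ K ∨ ∃ c, Reach K B c g) →
      (κ * g ∈ K ∨ ∃ c, Reach K B c (κ * g)) := by
    rintro κ hκ g (h | ⟨c, h⟩)
    · exact Or.inl (K.mul_mem hκ h)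
    · exact Or.inr ⟨_, h.conj hB κ hκ⟩
  induction hg using Subgroup.closure_induction_left with
  | one => exact Or.inl K.one_mem
  | mul_left x hx y hy ih =>
    rcases hx with hx | hx
    · exact hK x hx y ih
    · simpa using Reach.pow_mul hx 1 ih
  | inv_mul_cancel x hx y hy ih =>
    rcases hx with hx | hx
    · exact hK _ (K.inv_mem hx) y ih
    · simpa using Reach.pow_mul hx (-1) ih

variable {D}

section ext

variable {K : Subgroup G} {W : Set G} {B : Set G}

theorem exists_P (hBC : B ⊆ D.C)
    (hB : ∀ c ∈ B, ∃ x ∈ W, ∃ y ∈ W, D.len c ≤ 24 * D.d c x y)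
    {c : G} (hc : c ∈ B) {e : G} (he : e ∈ D.C) (hne : e ≠ c) : ∃ w ∈ W, D.P e c w := by
  obtain ⟨x, hx, y, hy, h⟩ := hB c hc
  rcases D.P_or e he c (hBC hc) hne x with h1 | h1
  · exact ⟨x, hx, h1⟩
  rcases D.P_or e he c (hBC hc) hne y with h2 | h2
  · exact ⟨y, hy, h2⟩
  have := D.P_d c (hBC hc) e he hne.symm x y h1 h2
  omega

theorem reach_far (hW : D.IsWindmill K W) (hBC : B ⊆ D.C) (hBK : ∀ c ∈ B, c ∉ K)
    (hB : ∀ c ∈ B, ∃ x ∈ W, ∃ y ∈ W, D.len c ≤ 24 * D.d c x y)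
    {c g : G} (h : Reach K B c g) :
    ∀ x ∈ W, ∀ y ∈ W, 20 * D.len c ≤ 24 * D.d c x (g * y) := by
  induction h with
  | base c k g hc hk hg =>
    intro x hx y hy
    have h1 := D.rot c (hBC hc) k hk (g * y)
    have h2 := hW.small c (hBC hc) (hBK c hc) (g * y) (hW.smul_mem g hg y hy) x hx
    have h3 := D.d_tri c (g * y) x (c ^ k * (g * y)) (hBC hc)
    rw [mul_assoc]
    omega
  | step c k c' g hc hk hne hr ih =>
    intro x hx y hy
    have hc' := hr.mem
    obtain ⟨w, hw, hPw⟩ := exists_P hBC hB hc' (hBC hc) hne.symm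
    obtain ⟨w2, hw2, hPw2⟩ := exists_P hBC hB hc (hBC hc') hne
    have hP : D.P c c' (g * y) := by
      rcases D.P_or c (hBC hc) c' (hBC hc') hne.symm (g * y) with h | h
      · exact h
      · have h1 := D.P_d c' (hBC hc') c (hBC hc) hne _ _ hPw2 h
        have h2 := ih w2 hw2 y hy
        have := D.len_ge c' (hBC hc')
        omega
    have h0 := D.P_d c (hBC hc) c' (hBC hc') hne.symm _ _ hP hPw
    have h1 := D.rot c (hBC hc) k hk (g * y)
    have h2 := hW.small c (hBC hc) (hBK c hc) w hw x hx
    have h3 := D.d_tri c (g * y) w (c ^ k * (g * y)) (hBC hc)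
    have h4 := D.d_tri c w x (c ^ k * (g * y)) (hBC hc)
    rw [mul_assoc]
    omega

theorem reach_mid (hW : D.IsWindmill K W) (hBC : B ⊆ D.C) (hBK : ∀ c ∈ B, c ∉ K)
    (hB : ∀ c ∈ B, ∃ x ∈ W, ∃ y ∈ W, D.len c ≤ 24 * D.d c x y)
    (K' : Subgroup G) (hBK' : B ⊆ K')
    {c g : G} (h : Reach K B c g) :
    ∀ e ∈ D.C, e ∉ K' → ∀ x, ∀ y ∈ W, D.P e c x → (∃ w ∈ W, 24 * D.d c x w < D.len c) →
      ∃ h ∈ K', ∃ w ∈ W, ∃ w' ∈ W, 24 * D.d e x (h * w) < D.len e ∧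
        24 * D.d e (h * w') (g * y) < D.len e := by
  induction h with
  | base c k g hc hk hg =>
    intro e he heK x y hy hP _
    have hec : e ≠ c := fun h => heK (h ▸ hBK' hc)
    have hck : c ^ k ∈ K' := K'.zpow_mem (hBK' hc) k
    obtain ⟨w1, hw1, hPw1⟩ := exists_P hBC hB hc
      (D.C_conj (c ^ k)⁻¹ e he) (by
        intro h
        apply hec
        have : e = c ^ k * ((c ^ k)⁻¹ * e * ((c ^ k)⁻¹)⁻¹) * (c ^ k)⁻¹ := by group
        rw [this, h]; group)
    have hP1 := D.P_conj (c ^ k) _ _ _ (D.C_conj (c ^ k)⁻¹ e he) (hBC hc) hPw1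
    have e1 : c ^ k * ((c ^ k)⁻¹ * e * ((c ^ k)⁻¹)⁻¹) * (c ^ k)⁻¹ = e := by group
    have e2 : c ^ k * c * (c ^ k)⁻¹ = c := by group
    rw [e1, e2] at hP1
    refine ⟨c ^ k, hck, w1, hw1, g * y, hW.smul_mem g hg y hy,
      D.P_d e he c (hBC hc) hec _ _ hP hP1, ?_⟩
    rw [mul_assoc, D.d_self]
    have := D.len_ge e he
    omega
  | step c k c' g hc hk hne hr ih =>
    rintro e he heK x y hy hP ⟨w, hw, hxw⟩
    have hc' := hr.mem
    have hec : e ≠ c := fun h => heK (h ▸ hBK' hc)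
    have hck : c ^ k ∈ K' := K'.zpow_mem (hBK' hc) k
    set e' := (c ^ k)⁻¹ * e * ((c ^ k)⁻¹)⁻¹ with he'
    have he'C : e' ∈ D.C := D.C_conj _ e he
    have e1 : c ^ k * e' * (c ^ k)⁻¹ = e := by rw [he']; group
    have e2 : c ^ k * c * (c ^ k)⁻¹ = c := by group
    set c'' := c ^ k * c' * (c ^ k)⁻¹ with hc''
    have hc''C : c'' ∈ D.C := D.C_conj _ c' (hBC hc')
    have e3 : (c ^ k)⁻¹ * c'' * ((c ^ k)⁻¹)⁻¹ = c' := by rw [hc'']; group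
    have he'K : e' ∉ K' := by
      intro h
      apply heK
      rw [← e1]
      exact K'.mul_mem (K'.mul_mem hck h) (K'.inv_mem hck)
    have hc''K : c'' ∈ K' := K'.mul_mem (K'.mul_mem hck (hBK' hc')) (K'.inv_mem hck)
    have hec'' : e ≠ c'' := fun h => heK (h ▸ hc''K)
    have he'c : e' ≠ c := fun h => he'K (h ▸ hBK' hc)
    have he'c' : e' ≠ c' := fun h => he'K (h ▸ hBK' hc')
    have hc''c : c'' ≠ c := by
      intro h
      apply hne
      rw [← e3, h]; group
    obtain ⟨w1, hw1, hPw1⟩ := exists_P hBC hB hc he'C he'c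
    have hP1 := D.P_conj (c ^ k) _ _ _ he'C (hBC hc) hPw1
    rw [e1, e2] at hP1
    have hx1 := D.P_d e he c (hBC hc) hec _ _ hP hP1
    rcases D.P_or e he c'' hc''C hec'' (c ^ k * g * y) with hz | hz
    · obtain ⟨w', hw', hPw'⟩ := exists_P hBC hB hc' he'C he'c'
      have hP' := D.P_conj (c ^ k) _ _ _ he'C (hBC hc') hPw'
      rw [e1, ← hc''] at hP'
      exact ⟨c ^ k, hck, w1, hw1, w', hw', hx1, D.P_d e he c'' hc''C hec'' _ _ hP' hz⟩
    · have hPx : D.P c'' c x := by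
        rcases D.P_or c'' hc''C c (hBC hc) hc''c x with h | h
        · exact h
        · exfalso
          obtain ⟨w2, hw2, hPw2⟩ := exists_P hBC hB hc' (hBC hc) hne.symm
          have hP2 := D.P_conj (c ^ k) _ _ _ (hBC hc) (hBC hc') hPw2
          rw [e2, ← hc''] at hP2
          have h1 := D.P_d c (hBC hc) c'' hc''C hc''c.symm _ _ h hP2
          have h2 := D.rot c (hBC hc) k hk w2
          have h3 := D.d_tri c w2 w (c ^ k * w2) (hBC hc)
          have h4 := D.d_tri c w x (c ^ k * w2) (hBC hc)
          have h5 := hW.small c (hBC hc) (hBK c hc) w2 hw2 w hw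
          have h6 := D.len_ge c (hBC hc)
          rw [D.d_symm c w x] at h4
          omega
      obtain ⟨w3, hw3, hPw3⟩ := exists_P hBC hB hc (hBC hc') hne
      have hP3 := D.P_conj (c ^ k) _ _ _ (hBC hc') (hBC hc) hPw3
      rw [e2, ← hc''] at hP3
      have hx3 := D.P_d c'' hc''C c (hBC hc) hc''c _ _ hPx hP3
      have ex : c ^ k * ((c ^ k)⁻¹ * x) = x := by group
      have hlen : D.len c'' = D.len c' := D.len_conj _ _
      have hx3' : D.d c'' x (c ^ k * w3) = D.d c' ((c ^ k)⁻¹ * x) w3 := by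
        conv_lhs => rw [← ex]
        exact D.d_conj _ _ _ _ (hBC hc')
      have hPe : D.P e c'' x := by
        rcases D.P_or e he c'' hc''C hec'' x with h | h
        · exact h
        · exfalso
          have h1 := D.P_d c'' hc''C e he hec''.symm _ _ h hz
          have h2 := reach_far hW hBC hBK hB hr w3 hw3 y hy
          have h3 : D.d c'' (c ^ k * w3) (c ^ k * g * y) = D.d c' w3 (g * y) := by
            rw [mul_assoc]; exact D.d_conj _ _ _ _ (hBC hc')
          have h4 := D.d_tri c'' (c ^ k * w3) x (c ^ k * g * y) hc''C
          have h6 := D.len_ge c' (hBC hc')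
          rw [D.d_symm c'' _ x] at h4
          omega
      have hPe' := D.P_conj (c ^ k)⁻¹ _ _ _ he hc''C hPe
      rw [← he', e3] at hPe'
      obtain ⟨h, hh, w4, hw4, w5, hw5, h1, h2⟩ := ih e' he'C he'K ((c ^ k)⁻¹ * x) y hy hPe'
        ⟨w3, hw3, by omega⟩
      refine ⟨c ^ k * h, K'.mul_mem hck hh, w4, hw4, w5, hw5, ?_, ?_⟩
      · have : D.d e x (c ^ k * h * w4) = D.d e' ((c ^ k)⁻¹ * x) (h * w4) := by
          rw [← D.d_conj (c ^ k) e' _ _ he'C, e1, ex, mul_assoc]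
        rw [this, ← e1, D.len_conj]; exact h1
      · have : D.d e (c ^ k * h * w5) (c ^ k * g * y) = D.d e' (h * w5) (g * y) := by
          rw [← D.d_conj (c ^ k) e' _ _ he'C, e1, mul_assoc, mul_assoc]
        rw [this, ← e1, D.len_conj]; exact h2

theorem ext_windmill (hW : D.IsWindmill K W) (hBdef : B = {c | c ∈ D.C ∧ c ∉ K ∧
      ∃ x ∈ W, ∃ y ∈ W, D.len c ≤ 24 * D.d c x y})
    (K' : Subgroup G) (hK' : K' = Subgroup.closure ((K : Set G) ∪ B)) :
    D.IsWindmill K' {z | ∃ g ∈ K', ∃ w ∈ W, z = g * w} := by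
  have hBC : B ⊆ D.C := by rw [hBdef]; exact fun c h => h.1
  have hBK : ∀ c ∈ B, c ∉ K := by rw [hBdef]; exact fun c h => h.2.1
  have hB : ∀ c ∈ B, ∃ x ∈ W, ∃ y ∈ W, D.len c ≤ 24 * D.d c x y := by
    rw [hBdef]; exact fun c h => h.2.2
  have hBK' : B ⊆ K' := by
    rw [hK']; exact fun c h => Subgroup.subset_closure (Or.inr h)
  have hKK' : K ≤ K' := by
    rw [hK']; exact fun c h => Subgroup.subset_closure (Or.inl h)
  have hBconj : ∀ k ∈ K, ∀ c ∈ B, k * c * k⁻¹ ∈ B := by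
    intro k hk c hc
    have hcK := hBK c hc
    have hcC := hBC hc
    obtain ⟨x, hx, y, hy, h⟩ := hB c hc
    rw [hBdef]
    refine ⟨D.C_conj _ _ hcC, ?_, k * x, hW.smul_mem k hk x hx, k * y, hW.smul_mem k hk y hy, ?_⟩
    · intro h
      apply hcK
      have : c = k⁻¹ * (k * c * k⁻¹) * k := by group
      rw [this]
      exact K.mul_mem (K.mul_mem (K.inv_mem hk) h) hk
    · rw [D.len_conj, D.d_conj _ _ _ _ hcC]; exact h
  have hreach : ∀ g ∈ K', g ∈ K ∨ ∃ c, Reach K B c g := by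
    rw [hK']; exact fun g hg => reach_of_mem hBconj g hg
  have hmain : ∀ e ∈ D.C, e ∉ K' → ∀ x ∈ W, ∀ g ∈ K', ∀ y ∈ W,
      24 * D.d e x (g * y) ≤ 3 * D.len e := by
    intro e he heK x hx g hg y hy
    -- distance inside a translate
    have hin : ∀ h ∈ K', ∀ w ∈ W, ∀ w' ∈ W, 24 * D.d e (h * w) (h * w') < D.len e := by
      intro h hh w hw w' hw'
      by_contra hcon
      have hcon : D.len e ≤ 24 * D.d e (h * w) (h * w') := not_lt.mp hcon
      have he1 : h * (h⁻¹ * e * h) * h⁻¹ = e := by group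
      have he'C : h⁻¹ * e * h ∈ D.C := by simpa using D.C_conj h⁻¹ e he
      have he'K : h⁻¹ * e * h ∉ K' := by
        intro hh2
        apply heK
        rw [← he1]
        exact K'.mul_mem (K'.mul_mem hh hh2) (K'.inv_mem hh)
      have : h⁻¹ * e * h ∈ B := by
        rw [hBdef]
        refine ⟨he'C, fun h' => he'K (hKK' h'), w, hw, w', hw', ?_⟩
        rw [← D.d_conj h _ _ _ he'C, he1, ← D.len_conj h, he1]
        exact hcon
      exact he'K (hBK' this)
    have key : ∃ h ∈ K', ∃ w ∈ W, ∃ w' ∈ W, 24 * D.d e x (h * w) < D.len e ∧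
        24 * D.d e (h * w') (g * y) < D.len e := by
      have hl := D.len_ge e he
      rcases hreach g hg with hgK | ⟨c, hr⟩
      · refine ⟨1, K'.one_mem, x, hx, g * y, hW.smul_mem g hgK y hy, ?_, ?_⟩ <;>
          rw [one_mul, D.d_self] <;> omega
      · have hc := hr.mem
        have hec : e ≠ c := fun h => heK (h ▸ hBK' hc)
        have hfar := reach_far hW hBC hBK hB hr x hx y hy
        rcases D.P_or e he c (hBC hc) hec (g * y) with hz | hz
        · obtain ⟨w', hw', hPw'⟩ := exists_P hBC hB hc he hec
          refine ⟨1, K'.one_mem, x, hx, w', hw', ?_, ?_⟩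
          · rw [one_mul, D.d_self]; omega
          · rw [one_mul]; exact D.P_d e he c (hBC hc) hec _ _ hPw' hz
        · rcases D.P_or e he c (hBC hc) hec x with hx' | hx'
          · refine reach_mid hW hBC hBK hB K' hBK' hr e he heK x y hy hx' ⟨x, hx, ?_⟩
            rw [D.d_self]
            have := D.len_ge c (hBC hc)
            omega
          · have h1 := D.P_d c (hBC hc) e he hec.symm _ _ hx' hz
            have := D.len_ge c (hBC hc)
            omega
    obtain ⟨h, hh, w, hw, w', hw', h1, h2⟩ := key
    have h3 := hin h hh w hw w' hw'
    have h4 := D.d_tri e x (h * w) (g * y) he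
    have h5 := D.d_tri e (h * w) (h * w') (g * y) he
    omega
  refine ⟨⟨1, K'.one_mem, 1, hW.one_mem, by simp⟩, ?_, ?_, ?_⟩
  · rintro k hk _ ⟨g, hg, w, hw, rfl⟩
    exact ⟨k * g, K'.mul_mem hk hg, w, hw, by rw [mul_assoc]⟩
  · rintro e he heK _ ⟨g, hg, w, hw, rfl⟩ _ ⟨g', hg', w', hw', rfl⟩
    have he'K : g⁻¹ * e * g⁻¹⁻¹ ∉ K' := by
      intro hh2
      apply heK
      have : e = g * (g⁻¹ * e * g⁻¹⁻¹) * g⁻¹ := by group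
      rw [this]
      exact K'.mul_mem (K'.mul_mem hg hh2) (K'.inv_mem hg)
    have := hmain _ (D.C_conj g⁻¹ e he) he'K w hw (g⁻¹ * g') (K'.mul_mem (K'.inv_mem hg) hg') w' hw'
    rw [D.len_conj] at this
    have h2 := D.d_conj g⁻¹ e (g * w) (g' * w') he
    rw [← mul_assoc, ← mul_assoc, inv_mul_cancel, one_mul] at h2
    rw [← h2]; exact this
  · intro n hn hn1
    rcases hreach n hn with h | ⟨c, hr⟩
    · exact hW.green n h hn1
    · have := reach_far hW hBC hBK hB hr 1 hW.one_mem 1 hW.one_mem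
      rw [mul_one] at this
      exact ⟨c, hBC hr.mem, this⟩

end ext

variable (D)

theorem exists_maximal : ∃ K : Subgroup G, ∃ W : Set G, D.IsWindmill K W ∧
    ∀ K' W', D.IsWindmill K' W' → K ≤ K' → W ⊆ W' → K' ≤ K ∧ W' ⊆ W := by
  have := zorn_le_nonempty₀ {p : Subgroup G × Set G | D.IsWindmill p.1 p.2} ?_ (⊥, {1}) ?_
  · obtain ⟨⟨K, W⟩, _, hm⟩ := this
    refine ⟨K, W, hm.1, fun K' W' h hK hW => ?_⟩
    have := hm.2 (y := (K', W')) h ⟨hK, hW⟩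
    exact ⟨this.1, this.2⟩
  · intro c hc hchain y hy
    have hdir : DirectedOn (· ≤ ·) (Prod.fst '' c) := by
      rintro _ ⟨p, hp, rfl⟩ _ ⟨q, hq, rfl⟩
      rcases hchain.total hp hq with h | h
      · exact ⟨q.1, ⟨q, hq, rfl⟩, h.1, le_rfl⟩
      · exact ⟨p.1, ⟨p, hp, rfl⟩, le_rfl, h.1⟩
    have hne : (Prod.fst '' c).Nonempty := ⟨y.1, y, hy, rfl⟩
    have hmem : ∀ x, x ∈ sSup (Prod.fst '' c) ↔ ∃ p ∈ c, x ∈ p.1 := by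
      intro x
      rw [Subgroup.mem_sSup_of_directedOn hne hdir]
      simp
    refine ⟨(sSup (Prod.fst '' c), ⋃ p ∈ c, p.2), ⟨?_, ?_, ?_, ?_⟩, ?_⟩
    · simp only [Set.mem_iUnion]
      exact ⟨y, hy, (hc hy).one_mem⟩
    · intro k hk x hx
      simp only [Set.mem_iUnion] at hx ⊢
      obtain ⟨p, hp, hkp⟩ := (hmem k).1 hk
      obtain ⟨q, hq, hxq⟩ := hx
      rcases hchain.total hp hq with h | h
      · exact ⟨q, hq, (hc hq).smul_mem k (h.1 hkp) x hxq⟩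
      · exact ⟨p, hp, (hc hp).smul_mem k hkp x (h.2 hxq)⟩
    · intro e he heK x hx y hy
      simp only [Set.mem_iUnion] at hx hy
      obtain ⟨p, hp, hxp⟩ := hx
      obtain ⟨q, hq, hyq⟩ := hy
      rcases hchain.total hp hq with h | h
      · exact (hc hq).small e he (fun h' => heK ((hmem e).2 ⟨q, hq, h'⟩)) x (h.2 hxp) y hyq
      · exact (hc hp).small e he (fun h' => heK ((hmem e).2 ⟨p, hp, h'⟩)) x hxp y (h.2 hyq)
    · intro n hn hn1
      obtain ⟨p, hp, hnp⟩ := (hmem n).1 hn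
      exact (hc hp).green n hnp hn1
    · intro z hz
      exact ⟨le_sSup ⟨z, hz, rfl⟩, fun x hx => by
        simp only [Set.mem_iUnion]; exact ⟨z, hz, hx⟩⟩
  · refine ⟨rfl, ?_, ?_, ?_⟩
    · rintro k hk x hx
      simp only [Subgroup.mem_bot] at hk
      simp [hk, hx] at *
    · rintro c _ _ _ rfl _ rfl
      rw [D.d_self]; omega
    · intro n hn hn1
      exact absurd (by simpa using hn) hn1

theorem windmill_green (n : G) (hn : n ∈ Subgroup.closure D.C) (hn1 : n ≠ 1) :
    ∃ c ∈ D.C, 20 * D.len c ≤ 24 * D.d c 1 n := by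
  obtain ⟨K, W, hW, hmax⟩ := D.exists_maximal
  have hsmall : ∀ c ∈ D.C, c ∉ K → ∀ x ∈ W, ∀ y ∈ W, 24 * D.d c x y < D.len c := by
    intro c hc hcK x hx y hy
    by_contra hcon
    have hcon : D.len c ≤ 24 * D.d c x y := not_lt.mp hcon
    have := ext_windmill hW rfl _ rfl
    have h2 := (hmax _ _ this (fun c h => Subgroup.subset_closure (Or.inl h))
      (fun x hx => ⟨1, Subgroup.one_mem _, x, hx, by simp⟩)).1
    exact hcK (h2 (Subgroup.subset_closure (Or.inr ⟨hc, hcK, x, hx, y, hy, hcon⟩)))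
  set W' : Set G := {z | ∃ w ∈ W, z = w ∨ ∃ s ∈ D.S, z = w * s ∨ w = z * s} with hW'
  have hWW' : W ⊆ W' := fun w hw => ⟨w, hw, Or.inl rfl⟩
  have hnear : ∀ c ∈ D.C, ∀ z ∈ W', ∃ w ∈ W, D.d c z w ≤ 1 := by
    rintro c hc z ⟨w, hw, rfl | ⟨s, hs, rfl | rfl⟩⟩
    · exact ⟨z, hw, by rw [D.d_self]; omega⟩
    · exact ⟨w, hw, by rw [D.d_symm]; exact D.S_d c hc w s hs⟩
    · exact ⟨_, hw, D.S_d c hc z s hs⟩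
  have hwm : D.IsWindmill K W' := by
    refine ⟨hWW' hW.one_mem, ?_, ?_, hW.green⟩
    · rintro k hk z ⟨w, hw, h⟩
      refine ⟨k * w, hW.smul_mem k hk w hw, ?_⟩
      rcases h with rfl | ⟨s, hs, rfl | rfl⟩
      · exact Or.inl rfl
      · exact Or.inr ⟨s, hs, Or.inl (by rw [mul_assoc])⟩
      · exact Or.inr ⟨s, hs, Or.inr (by rw [mul_assoc])⟩
    · intro c hc hcK x hx y hy
      obtain ⟨w, hw, h1⟩ := hnear c hc x hx
      obtain ⟨w', hw', h2⟩ := hnear c hc y hy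
      have h3 := hsmall c hc hcK w hw w' hw'
      have h4 := D.d_tri c x w y hc
      have h5 := D.d_tri c w w' y hc
      rw [D.d_symm c w' y] at h5
      have := D.len_ge c hc
      omega
  have hsub := (hmax K W' hwm le_rfl hWW').2
  have hall : ∀ g : G, ∀ w ∈ W, w * g ∈ W := by
    intro g
    have hg : g ∈ Subgroup.closure D.S := by rw [D.S_top]; trivial
    induction hg using Subgroup.closure_induction with
    | mem s hs => exact fun w hw => hsub ⟨w, hw, Or.inr ⟨s, hs, Or.inl rfl⟩⟩
    | one => intro w hw; simpa using hw
    | mul x y _ _ hx hy => intro w hw; rw [← mul_assoc]; exact hy _ (hx _ hw)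
    | inv x hx ih =>
      -- handled below through right closure
      clear ih
      have : ∀ x ∈ Subgroup.closure D.S, ∀ w ∈ W, w * x ∈ W ∧ w * x⁻¹ ∈ W := by
        intro x hx
        induction hx using Subgroup.closure_induction with
        | mem s hs =>
          exact fun w hw => ⟨hsub ⟨w, hw, Or.inr ⟨s, hs, Or.inl rfl⟩⟩,
            hsub ⟨w, hw, Or.inr ⟨s, hs, Or.inr (by group)⟩⟩⟩
        | one => intro w hw; simpa using hw
        | mul x y _ _ hx hy =>
          intro w hw
          refine ⟨?_, ?_⟩
          · rw [← mul_assoc]; exact (hy _ (hx _ hw).1).1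
          · rw [mul_inv_rev, ← mul_assoc]; exact (hx _ (hy _ hw).2).2
        | inv x _ ih => intro w hw; rw [inv_inv]; exact (ih w hw).symm
      exact fun w hw => (this x hx w hw).2
  have hCK : D.C ⊆ K := by
    intro c hc
    by_contra hcK
    have h1 := hsmall c hc hcK 1 hW.one_mem (c * 1) (by
      have := hall c 1 hW.one_mem
      simpa using this)
    have h2 := D.rot c hc 1 one_ne_zero 1
    rw [zpow_one] at h2
    have := D.len_ge c hc
    omega
  exact hW.green n ((Subgroup.closure_le K).2 hCK hn) hn1

end WD

open FreeGroup

section words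
variable {α : Type*}

theorem isRed_append {u v : List (α × Bool)} (hu : IsReduced u) (hv : IsReduced v)
    (h : ∀ a ∈ u.getLast?, ∀ b ∈ v.head?, a.1 = b.1 → a.2 = b.2) : IsReduced (u ++ v) :=
  List.isChain_append.2 ⟨hu, hv, h⟩

theorem isRed_invRev {u : List (α × Bool)} (hu : IsReduced u) : IsReduced (invRev u) := by
  classical
  have := isReduced_toWord (x := (FreeGroup.mk u)⁻¹)
  rwa [toWord_inv, toWord_mk, hu.reduce_eq] at this

def lcp {β : Type*} [DecidableEq β] : List β → List β → ℕ
  | a :: u, b :: v => if a = b then lcp u v + 1 else 0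
  | _, _ => 0

theorem le_lcp_iff {β : Type*} [DecidableEq β] (u v : List β) (n : ℕ) :
    n ≤ lcp u v ↔ n ≤ u.length ∧ n ≤ v.length ∧ u.take n = v.take n := by
  induction u generalizing v n with
  | nil => simp [lcp]; intro h; simp [h]
  | cons a u ih =>
    cases v with
    | nil => simp [lcp]; intro h; simp [h]
    | cons b v =>
      cases n with
      | zero => simp
      | succ n =>
        by_cases hab : a = b
        · simp [lcp, hab, ih]
        · simp [lcp, hab]

variable [DecidableEq α]

theorem norm_mk_of_red {u : List (α × Bool)} (hu : IsReduced u) :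
    (FreeGroup.mk u).norm = u.length := by
  rw [FreeGroup.norm, toWord_mk, hu.reduce_eq]

theorem norm_inv_mul_aux (u v : List (α × Bool)) (hu : IsReduced u) (hv : IsReduced v) :
    ((FreeGroup.mk u)⁻¹ * FreeGroup.mk v).norm + 2 * lcp u v = u.length + v.length := by
  induction u generalizing v with
  | nil =>
    have : (FreeGroup.mk ([] : List (α × Bool))) = 1 := rfl
    rw [this, inv_one, one_mul, norm_mk_of_red hv]; simp [lcp]
  | cons a u ih =>
    cases v with
    | nil =>
      have : (FreeGroup.mk ([] : List (α × Bool))) = 1 := rfl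
      rw [this, mul_one, norm_inv_eq, norm_mk_of_red hu]; simp [lcp]
    | cons b v =>
      by_cases hab : a = b
      · subst hab
        have h1 := ih v (chain_inf hu (List.suffix_cons a u).isInfix)
          (chain_inf hv (List.suffix_cons a v).isInfix)
        have e : (FreeGroup.mk (a :: u))⁻¹ * FreeGroup.mk (a :: v)
            = (FreeGroup.mk u)⁻¹ * FreeGroup.mk v := by
          have h (w) : FreeGroup.mk (a :: w) = FreeGroup.mk [a] * FreeGroup.mk w := by
            rw [mul_mk]; rfl
          rw [h u, h v]; group
        rw [e]
        simp only [lcp, if_true, List.length_cons]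
        omega
      · rw [inv_mk, mul_mk, norm_mk_of_red]
        · simp [lcp, hab]
        · refine isRed_append (isRed_invRev hu) hv ?_
          intro x hx y hy h
          rw [invRev_cons] at hx
          simp [invRev] at hx hy
          subst hx hy
          simp only at h ⊢
          by_contra hne
          apply hab
          ext
          · exact h
          · revert hne; cases a.2 <;> cases b.2 <;> simp

theorem fnorm_inv_mul (x y : FreeGroup α) :
    (x⁻¹ * y).norm + 2 * lcp x.toWord y.toWord = x.norm + y.norm := by
  have := norm_inv_mul_aux x.toWord y.toWord isReduced_toWord isReduced_toWord
  rwa [mk_toWord, mk_toWord] at this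

/-- tree distance -/
def td (x y : FreeGroup α) : ℕ := (x⁻¹ * y).norm

/-- Gromov product -/
def gp (p x y : FreeGroup α) : ℕ := lcp (p⁻¹ * x).toWord (p⁻¹ * y).toWord

theorem td_gp (p x y : FreeGroup α) : td x y + 2 * gp p x y = td p x + td p y := by
  have := fnorm_inv_mul (p⁻¹ * x) (p⁻¹ * y)
  have e : (p⁻¹ * x)⁻¹ * (p⁻¹ * y) = x⁻¹ * y := by group
  rw [e] at this
  exact this

theorem td_symm (x y : FreeGroup α) : td x y = td y x := by
  rw [td, td, ← norm_inv_eq]; congr 1; group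

theorem td_self (x : FreeGroup α) : td x x = 0 := by simp [td]

theorem td_eq_zero {x y : FreeGroup α} (h : td x y = 0) : x = y := by
  rw [td, FreeGroup.norm_eq_zero] at h
  exact (inv_mul_eq_one.1 h)

theorem td_tri (x y z : FreeGroup α) : td x z ≤ td x y + td y z := by
  have := norm_mul_le (x⁻¹ * y) (y⁻¹ * z)
  have e : x⁻¹ * y * (y⁻¹ * z) = x⁻¹ * z := by group
  rw [e] at this; exact this

theorem td_mul (g x y : FreeGroup α) : td (g * x) (g * y) = td x y := by
  rw [td, td]; congr 1; group

theorem gp_ultra (p x y z : FreeGroup α) : min (gp p x y) (gp p y z) ≤ gp p x z := by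
  have h1 := (le_lcp_iff (p⁻¹ * x).toWord (p⁻¹ * y).toWord _).1
    (min_le_left (gp p x y) (gp p y z))
  have h2 := (le_lcp_iff (p⁻¹ * y).toWord (p⁻¹ * z).toWord _).1
    (min_le_right (gp p x y) (gp p y z))
  exact (le_lcp_iff _ _ _).2 ⟨h1.1, h2.2.1, h1.2.2.trans h2.2.2⟩

theorem gp_symm (p x y : FreeGroup α) : gp p x y = gp p y x := by
  have h1 := td_gp p x y
  have h2 := td_gp p y x
  rw [td_symm] at h1; omega

theorem gp_le (p x y : FreeGroup α) : gp p x y ≤ td p x :=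
  ((le_lcp_iff (p⁻¹ * x).toWord (p⁻¹ * y).toWord _).1 le_rfl).1

/-- A set is convex if closed under geodesic points. -/
def TConv (A : Set (FreeGroup α)) : Prop :=
  ∀ x ∈ A, ∀ y ∈ A, ∀ p, td x p + td p y = td x y → p ∈ A

def IsGate (A : Set (FreeGroup α)) (x p : FreeGroup α) : Prop :=
  p ∈ A ∧ ∀ q ∈ A, td x q = td x p + td p q

theorem exists_gate {A : Set (FreeGroup α)} (hA : TConv A) (hne : A.Nonempty) (x : FreeGroup α) :
    ∃ p, IsGate A x p := by
  obtain ⟨p, hp, hmin⟩ := exists_minimalFor_of_wellFoundedLT (· ∈ A) (fun p => td x p) hne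
  refine ⟨p, hp, fun q hq => ?_⟩
  have h0 := td_gp p x q
  rcases Nat.eq_zero_or_pos (gp p x q) with h | h
  · rw [td_symm p x] at h0; omega
  · exfalso
    obtain ⟨h1, h2, h3⟩ := (le_lcp_iff (p⁻¹ * x).toWord (p⁻¹ * q).toWord 1).1 h
    -- the first point on the way
    set r := p * FreeGroup.mk ((p⁻¹ * q).toWord.take 1) with hr
    have hpr : td p r = 1 := by
      rw [td, hr, inv_mul_cancel_left, norm_mk_of_red (chain_inf isReduced_toWord
        (take_pre _ _).isInfix)]
      simp; exact h2
    have hrq : ∀ y, (p⁻¹ * y).toWord.take 1 = (p⁻¹ * q).toWord.take 1 →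
        td r y + 1 ≤ td p y := by
      intro y hy
      have : r⁻¹ * y = FreeGroup.mk ((p⁻¹ * y).toWord.drop 1) := by
        have e : p⁻¹ * y = FreeGroup.mk ((p⁻¹ * y).toWord.take 1) *
          FreeGroup.mk ((p⁻¹ * y).toWord.drop 1) := by
          rw [mul_mk, List.take_append_drop, mk_toWord]
        rw [hr, mul_inv_rev, mul_assoc, inv_mul_eq_iff_eq_mul, ← hy, ← e]
      have h5 : td r y ≤ (p⁻¹ * y).toWord.length - 1 := by
        rw [td, this]
        exact norm_mk_le.trans (by simp)
      have h6 : 1 ≤ (p⁻¹ * y).toWord.length := by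
        have := congrArg List.length hy
        simp at this
        omega
      have h7 : td p y = (p⁻¹ * y).toWord.length := rfl
      omega
    have hrA : r ∈ A := by
      refine hA p hp q hq r ?_
      have h4 := hrq q rfl
      have h5 := td_tri p r q
      omega
    have h4 := hrq x h3
    have h5 := hmin hrA
    simp only at h5
    rw [td_symm p x, td_symm r x] at h4
    have := h5 (by omega)
    omega

theorem gate_unique {A : Set (FreeGroup α)} {x p q : FreeGroup α} (hp : IsGate A x p)
    (hq : IsGate A x q) : p = q := by
  have h1 := hp.2 q hq.1
  have h2 := hq.2 p hp.1
  exact td_eq_zero (by omega)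

theorem gate_key {A : Set (FreeGroup α)} {x y p q : FreeGroup α} (hp : IsGate A x p)
    (hq : IsGate A y q) (hne : p ≠ q) : td x y = td x p + td p q + td q y := by
  have h1 := hp.2 q hq.1
  have h2 := hq.2 p hp.1
  have h3 := td_gp p x q
  have h4 := td_gp p y q
  have h5 := td_gp p x y
  have h6 := gp_ultra p x y q
  have h7 : td p q ≠ 0 := fun h => hne (td_eq_zero h)
  rw [td_symm q p] at h2
  rw [td_symm p x] at h3 h5
  rw [td_symm p y] at h4 h5
  rw [td_symm q y]
  rcases min_le_iff.1 h6 with h | h <;> omega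

theorem gate_lip {A : Set (FreeGroup α)} {x y p q : FreeGroup α} (hp : IsGate A x p)
    (hq : IsGate A y q) : td p q ≤ td x y := by
  by_cases h : p = q
  · rw [h, td_self]; omega
  · have := gate_key hp hq h; omega

theorem gate_smul {A : Set (FreeGroup α)} {x p : FreeGroup α} (g : FreeGroup α)
    (hp : IsGate A x p) : IsGate {z | g⁻¹ * z ∈ A} (g * x) (g * p) := by
  refine ⟨by simpa using hp.1, fun q hq => ?_⟩
  have := hp.2 _ hq
  rw [← td_mul g x, ← td_mul g p, ← td_mul g x] at this
  simpa using this

/-- A point on a geodesic is a prefix. -/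
theorem prefix_of_geod {x p y : FreeGroup α} (h : td x p + td p y = td x y) :
    (x⁻¹ * p).toWord = (x⁻¹ * y).toWord.take (td x p) := by
  have h1 := td_gp x p y
  have h2 : td x p ≤ gp x p y := by omega
  have h3 := ((le_lcp_iff (x⁻¹ * p).toWord (x⁻¹ * y).toWord _).1 h2).2.2
  rw [← h3, List.take_of_length_le]
  exact le_rfl

end words

open FreeGroup

set_option linter.unusedSectionVars false
set_option linter.unusedVariables false

section axis
variable {α : Type*} [DecidableEq α]

theorem toWord_mk_red {u : List (α × Bool)} (hu : IsReduced u) :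
    (FreeGroup.mk u).toWord = u := by rw [toWord_mk, hu.reduce_eq]

theorem mk_cons (a : α × Bool) (w : List (α × Bool)) :
    FreeGroup.mk (a :: w) = FreeGroup.mk [a] * FreeGroup.mk w := by rw [mul_mk]; rfl

theorem mk_append (u w : List (α × Bool)) :
    FreeGroup.mk (u ++ w) = FreeGroup.mk u * FreeGroup.mk w := by rw [mul_mk]

theorem mk_nil : FreeGroup.mk ([] : List (α × Bool)) = 1 := rfl

theorem conv_step {R : Set (List (α × Bool))}
    (hcyc : ∀ w ∈ R, IsCyclicallyReduced w) {w u : List (α × Bool)} (hw : w ∈ R) (hw0 : w ≠ [])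
    (hu : IsReduced u)
    (hcu : ((FreeGroup.mk u)⁻¹ * FreeGroup.mk w * FreeGroup.mk u).toWord ∈ R) :
    u = [] ∨ u.head? = w.head? ∨ u.head? = (invRev w).head? := by
  by_contra hcon
  push Not at hcon
  obtain ⟨h0, h1, h2⟩ := hcon
  obtain ⟨a, u', rfl⟩ := List.exists_cons_of_ne_nil h0
  have hwr := (hcyc w hw).1
  have hred1 : IsReduced (w ++ (a :: u')) := by
    refine isRed_append hwr hu ?_
    intro x hx y hy h
    simp at hy
    subst hy
    by_contra hne
    apply h2
    simp only [invRev, List.head?_reverse, List.getLast?_map, List.head?_cons]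
    simp only [Option.mem_def] at hx
    rw [hx]
    simp only [Option.map_some, Option.some.injEq]
    ext
    · exact h.symm
    · revert hne; cases a.2 <;> cases x.2 <;> simp
  have hred : IsReduced (invRev (a :: u') ++ (w ++ (a :: u'))) := by
    refine isRed_append (isRed_invRev hu) hred1 ?_
    intro x hx y hy h
    rw [invRev_cons] at hx
    simp [invRev] at hx
    rw [List.head?_append_of_ne_nil _ hw0] at hy
    subst hx
    simp only at h ⊢
    by_contra hne
    apply h1
    simp only [Option.mem_def] at hy
    rw [hy]
    simp only [List.head?_cons, Option.some.injEq]
    ext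
    · exact h
    · revert hne; cases a.2 <;> cases y.2 <;> simp
  have e : (FreeGroup.mk (a :: u'))⁻¹ * FreeGroup.mk w * FreeGroup.mk (a :: u') =
      FreeGroup.mk (invRev (a :: u') ++ (w ++ (a :: u'))) := by
    rw [inv_mk, mul_mk, mul_mk, List.append_assoc]
  rw [e, toWord_mk_red hred] at hcu
  have hc := (hcyc _ hcu).2
  obtain ⟨v, z, hv⟩ : ∃ v z, a :: u' = v ++ [z] :=
    ⟨(a :: u').dropLast, (a :: u').getLast (by simp), (List.dropLast_append_getLast _).symm⟩
  rw [hv] at hc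
  have := hc z (by simp) (z.1, !z.2) (by simp [invRev]) rfl
  simp at this

theorem conv_pos {R : Set (List (α × Bool))} (hrot : ∀ u v, u ++ v ∈ R → v ++ u ∈ R)
    (hcyc : ∀ w ∈ R, IsCyclicallyReduced w) (u : List (α × Bool)) :
    ∀ w : List (α × Bool), w ∈ R → w ≠ [] → IsReduced u →
    ((FreeGroup.mk u)⁻¹ * FreeGroup.mk w * FreeGroup.mk u).toWord ∈ R →
    (u = [] ∨ u.head? = w.head?) →
    (∀ n, ((FreeGroup.mk (u.take n))⁻¹ * FreeGroup.mk w * FreeGroup.mk (u.take n)).toWord ∈ R) ∧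
    ((FreeGroup.mk u)⁻¹ * FreeGroup.mk w * FreeGroup.mk u).toWord.length = w.length ∧
    (∀ n, n ≤ u.length → n ≤ w.length → u.take n = w.take n) := by
  induction u with
  | nil =>
    intro w hw hw0 _ _ _
    have : (FreeGroup.mk w).toWord = w := toWord_mk_red (hcyc w hw).1
    refine ⟨fun n => ?_, ?_, fun n h1 _ => ?_⟩
    · simp only [List.take_nil, mk_nil]; simpa [this] using hw
    · simp only [mk_nil]; simp only [inv_one, one_mul, mul_one, this]
    · simp at h1; simp [h1]
  | cons a u ih =>
    intro w hw hw0 hu hcu hh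
    obtain ⟨b, w', rfl⟩ := List.exists_cons_of_ne_nil hw0
    simp at hh
    subst hh
    have hw' : w' ++ [a] ∈ R := hrot [a] w' hw
    have e : ∀ t, (FreeGroup.mk (a :: t))⁻¹ * FreeGroup.mk (a :: w') * FreeGroup.mk (a :: t)
        = (FreeGroup.mk t)⁻¹ * FreeGroup.mk (w' ++ [a]) * FreeGroup.mk t := by
      intro t
      rw [mk_cons a t, mk_cons a w', mk_append]; group
    rw [e] at hcu ⊢
    have hu' : IsReduced u := chain_inf hu (List.suffix_cons a u).isInfix
    have hh' : u = [] ∨ u.head? = (w' ++ [a]).head? := by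
      rcases conv_step hcyc hw' (by simp) hu' hcu with h | h | h
      · exact Or.inl h
      · exact Or.inr h
      · exfalso
        simp [invRev] at h
        cases u with
        | nil => simp at h
        | cons b u =>
          simp at h
          subst h
          have := (List.isChain_cons_cons.1 hu).1
          simp at this
    obtain ⟨i1, i2, i3⟩ := ih _ hw' (by simp) hu' hcu hh'
    refine ⟨fun n => ?_, ?_, fun n h1 h2 => ?_⟩
    · cases n with
      | zero =>
        simp only [List.take_zero, mk_nil]
        simpa [toWord_mk_red (hcyc _ hw).1] using hw
      | succ n => rw [List.take_succ_cons, e]; exact i1 n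
    · rw [i2]; simp
    · cases n with
      | zero => rfl
      | succ n =>
        simp at h1 h2
        rw [List.take_succ_cons, List.take_succ_cons, i3 n h1 (by simp; omega),
          List.take_append_of_le_length h2]

structure SmallC (R : Set (List (α × Bool))) : Prop where
  rot : ∀ u v, u ++ v ∈ R → v ++ u ∈ R
  cyc : ∀ w ∈ R, IsCyclicallyReduced w
  len : ∀ w ∈ R, 24 ≤ w.length
  sc : ∀ w ∈ R, ∀ w1 ∈ R, ∀ n, n ≤ w.length → n ≤ w1.length → w.take n = w1.take n →
    w.length ≤ 24 * n → w = w1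
  sci : ∀ w ∈ R, ∀ w1 ∈ R, ∀ n, n ≤ w.length → n ≤ w1.length → w.take n = (invRev w1).take n →
    w.length ≤ 24 * n → False
  sci' : ∀ w ∈ R, ∀ w1 ∈ R, ∀ n, n ≤ w.length → n ≤ w1.length → w.take n = (invRev w1).take n →
    w1.length ≤ 24 * n → False

def Ax (R : Set (List (α × Bool))) (c : FreeGroup α) : Set (FreeGroup α) :=
  {x | (x⁻¹ * c * x).toWord ∈ R}

theorem invRev_cyc {w : List (α × Bool)} (h : IsCyclicallyReduced w) :
    IsCyclicallyReduced (invRev w) := by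
  refine ⟨isRed_invRev h.1, ?_⟩
  intro a ha b hb
  simp only [invRev, List.head?_reverse, List.getLast?_map, List.getLast?_reverse,
    List.head?_map, Option.mem_def, Option.map_eq_some_iff] at ha hb
  obtain ⟨x, hx, rfl⟩ := ha
  obtain ⟨y, hy, rfl⟩ := hb
  intro h2
  have := h.2 y hy x hx h2.symm
  simp [this]

theorem take_conj (x y : FreeGroup α) (p : FreeGroup α) (h : td x p + td p y = td x y) :
    p = x * FreeGroup.mk ((x⁻¹ * y).toWord.take (td x p)) := by
  rw [← prefix_of_geod h, mk_toWord]; group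

variable {R : Set (List (α × Bool))}

theorem axis (hR : SmallC R) {c x y : FreeGroup α} (hx : x ∈ Ax R c) (hy : y ∈ Ax R c) :
    (∀ p, td x p + td p y = td x y → p ∈ Ax R c) ∧
    (y⁻¹ * c * y).toWord.length = (x⁻¹ * c * x).toWord.length ∧
    ((∀ n, n ≤ (x⁻¹ * y).toWord.length → n ≤ (x⁻¹ * c * x).toWord.length →
        (x⁻¹ * y).toWord.take n = (x⁻¹ * c * x).toWord.take n) ∨
     (∀ n, n ≤ (x⁻¹ * y).toWord.length → n ≤ (x⁻¹ * c * x).toWord.length →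
        (x⁻¹ * y).toWord.take n = (invRev (x⁻¹ * c * x).toWord).take n)) := by
  have hw0 : (x⁻¹ * c * x).toWord ≠ [] := by
    intro h
    have := hR.len _ hx
    rw [h] at this; simp at this
  have ec : ∀ z : FreeGroup α, (FreeGroup.mk z.toWord)⁻¹ *
      FreeGroup.mk (x⁻¹ * c * x).toWord * FreeGroup.mk z.toWord = (x * z)⁻¹ * c * (x * z) := by
    intro z; rw [mk_toWord, mk_toWord]; group
  have hcu := hy
  have hxy : y = x * (x⁻¹ * y) := by group
  have ey := ec (x⁻¹ * y)
  rw [← hxy] at ey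
  simp only [Ax, Set.mem_ofPred_eq] at hcu
  rw [← ey] at hcu
  rcases conv_step hR.cyc hx hw0 isReduced_toWord hcu with h | h | h
  · obtain ⟨i1, i2, i3⟩ := conv_pos hR.rot hR.cyc _ _ hx hw0 isReduced_toWord hcu (Or.inl h)
    refine ⟨fun p hp => ?_, by rw [← ey]; exact i2, Or.inl i3⟩
    have := i1 (td x p)
    rw [take_conj x y p hp]
    rw [mk_toWord] at this
    simp only [Ax, Set.mem_ofPred_eq]
    convert this using 2; group
  · obtain ⟨i1, i2, i3⟩ := conv_pos hR.rot hR.cyc _ _ hx hw0 isReduced_toWord hcu (Or.inr h)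
    refine ⟨fun p hp => ?_, by rw [← ey]; exact i2, Or.inl i3⟩
    have := i1 (td x p)
    rw [take_conj x y p hp]
    rw [mk_toWord] at this
    simp only [Ax, Set.mem_ofPred_eq]
    convert this using 2; group
  · have einv : ∀ z : FreeGroup α, (z⁻¹ * FreeGroup.mk (invRev (x⁻¹ * c * x).toWord) * z) =
        ((x * z)⁻¹ * c * (x * z))⁻¹ := by
      intro z; rw [← inv_mk, mk_toWord]; group
    obtain ⟨i1, i2, i3⟩ := conv_pos (R := {w | invRev w ∈ R})
      (fun u v h => by
        simp only [Set.mem_ofPred_eq, invRev_append] at h ⊢; exact hR.rot _ _ h)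
      (fun w hw => by
        have := invRev_cyc (hR.cyc _ hw); rwa [invRev_invRev] at this) (x⁻¹ * y).toWord
        (invRev (x⁻¹ * c * x).toWord) (by rw [Set.mem_ofPred_eq, invRev_invRev]; exact hx)
        (by intro h; exact hw0 (by simpa [invRev] using h)) isReduced_toWord
        (by
          rw [mk_toWord, einv, ← hxy, toWord_inv, Set.mem_ofPred_eq, invRev_invRev]
          exact hy) (Or.inr h)
    refine ⟨fun p hp => ?_, ?_, Or.inr (fun n h1 h2 => i3 n h1 (by simpa using h2))⟩
    · have := i1 (td x p)
      rw [einv, ← take_conj x y p hp, toWord_inv, Set.mem_ofPred_eq, invRev_invRev] at this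
      exact this
    · rw [mk_toWord, einv, ← hxy, toWord_inv, invRev_length, invRev_length] at i2
      exact i2

theorem ax_conv (hR : SmallC R) (c : FreeGroup α) : TConv (Ax R c) :=
  fun _ hx _ hy p h => (axis hR hx hy).1 p h

theorem ax_conj (g c x : FreeGroup α) : g * x ∈ Ax R (g * c * g⁻¹) ↔ x ∈ Ax R c := by
  simp only [Ax, Set.mem_ofPred_eq]
  rw [show (g * x)⁻¹ * (g * c * g⁻¹) * (g * x) = x⁻¹ * c * x by group]

theorem ax_conj' (g c x : FreeGroup α) : x ∈ Ax R (g * c * g⁻¹) ↔ g⁻¹ * x ∈ Ax R c := by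
  rw [← ax_conj g c]; simp

open Classical in
noncomputable def gate (R : Set (List (α × Bool))) (c x : FreeGroup α) : FreeGroup α :=
  if h : ∃ p, IsGate (Ax R c) x p then h.choose else 1

theorem gate_spec (hR : SmallC R) {c : FreeGroup α} (hc : (Ax R c).Nonempty) (x : FreeGroup α) :
    IsGate (Ax R c) x (gate R c x) := by
  have h := exists_gate (ax_conv hR c) hc x
  rw [gate, dif_pos h]
  exact h.choose_spec

theorem gate_conj (hR : SmallC R) {c : FreeGroup α} (hc : (Ax R c).Nonempty) (g x : FreeGroup α) :
    gate R (g * c * g⁻¹) (g * x) = g * gate R c x := by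
  have h1 := gate_smul g (gate_spec hR hc x)
  have e : {z | g⁻¹ * z ∈ Ax R c} = Ax R (g * c * g⁻¹) := by
    ext z; rw [ax_conj']; rfl
  rw [e] at h1
  exact gate_unique (gate_spec hR ⟨_, h1.1⟩ _) h1

noncomputable def trlen (R : Set (List (α × Bool))) (c : FreeGroup α) : ℕ :=
  sInf {n | ∃ x ∈ Ax R c, n = (x⁻¹ * c * x).toWord.length}

theorem trlen_eq (hR : SmallC R) {c x : FreeGroup α} (hx : x ∈ Ax R c) :
    trlen R c = (x⁻¹ * c * x).toWord.length := by
  have : {n | ∃ x ∈ Ax R c, n = (x⁻¹ * c * x).toWord.length} =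
      {(x⁻¹ * c * x).toWord.length} := by
    ext n
    simp only [Set.mem_ofPred_eq, Set.mem_singleton_iff]
    constructor
    · rintro ⟨y, hy, rfl⟩
      exact (axis hR hx hy).2.1
    · rintro rfl; exact ⟨x, hx, rfl⟩
  rw [trlen, this]; simp

theorem trlen_conj (g c : FreeGroup α) : trlen R (g * c * g⁻¹) = trlen R c := by
  rw [trlen, trlen]
  congr 1
  ext n
  simp only [Set.mem_ofPred_eq]
  constructor
  · rintro ⟨x, hx, rfl⟩
    refine ⟨g⁻¹ * x, (ax_conj' g c x).1 hx, ?_⟩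
    congr 2; group
  · rintro ⟨x, hx, rfl⟩
    refine ⟨g * x, (ax_conj g c x).2 hx, ?_⟩
    congr 2; group

theorem norm_pow_cyc {w : List (α × Bool)} (hw : IsCyclicallyReduced w) (k : ℕ) :
    ((FreeGroup.mk w) ^ k).toWord = (List.replicate k w).flatten := by
  rw [toWord_pow, toWord_mk_red hw.1, (hw.flatten_replicate k).1.reduce_eq]

theorem norm_zpow_ge {c : FreeGroup α} (hc : IsCyclicallyReduced c.toWord) (k : ℤ) (hk : k ≠ 0) :
    c.toWord.length ≤ (c ^ k).norm := by
  have h : (c ^ k).norm = (c ^ k.natAbs).norm := by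
    rcases Int.natAbs_eq k with h | h
    · conv_lhs => rw [h, zpow_natCast]
    · conv_lhs => rw [h, zpow_neg, FreeGroup.norm_inv_eq, zpow_natCast]
  rw [h]
  have h2 := norm_pow_cyc hc k.natAbs
  rw [mk_toWord] at h2
  rw [FreeGroup.norm, h2]
  simp only [List.length_flatten, List.map_replicate, List.sum_replicate, smul_eq_mul]
  exact Nat.le_mul_of_pos_left _ (by omega)

theorem overlap_lt (hR : SmallC R) {c e p q : FreeGroup α} (hne : c ≠ e) (hpq : p ≠ q)
    (hpc : p ∈ Ax R c) (hpe : p ∈ Ax R e) (hqc : q ∈ Ax R c) (hqe : q ∈ Ax R e) :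
    24 * td p q < trlen R c := by
  by_contra hcon
  rw [trlen_eq hR hpc] at hcon
  have hcon := not_lt.1 hcon
  obtain ⟨-, -, h1⟩ := axis hR hpc hqc
  obtain ⟨-, -, h2⟩ := axis hR hpe hqe
  have hw := hpc
  have hw1 := hpe
  simp only [Ax, Set.mem_ofPred_eq] at hw hw1
  have htd : td p q = (p⁻¹ * q).toWord.length := rfl
  rw [htd] at hcon
  have hwne : (p⁻¹ * c * p).toWord ≠ (p⁻¹ * e * p).toWord := by
    intro h
    apply hne
    have := toWord_injective h
    simpa using this
  generalize (p⁻¹ * c * p).toWord = w at *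
  generalize (p⁻¹ * e * p).toWord = w1 at *
  generalize (p⁻¹ * q).toWord = u at *
  set n := min u.length (min w.length w1.length) with hn
  have hnu : n ≤ u.length := min_le_left _ _
  have hnw : n ≤ w.length := (min_le_right _ _).trans (min_le_left _ _)
  have hnw1 : n ≤ w1.length := (min_le_right _ _).trans (min_le_right _ _)
  have hor : w.length ≤ 24 * n ∨ w1.length ≤ 24 * n := by
    rcases min_choice u.length (min w.length w1.length) with h | h
    · left; omega
    · rcases min_choice w.length w1.length with h' | h' <;> omega
  have hsc : ∀ w w1 : List (α × Bool), w ∈ R → w1 ∈ R → n ≤ w.length → n ≤ w1.length →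
      (w.length ≤ 24 * n ∨ w1.length ≤ 24 * n) → w.take n = w1.take n → w = w1 := by
    intro w w1 hw hw1 h1 h2 hor h
    rcases hor with h' | h'
    · exact hR.sc w hw w1 hw1 n h1 h2 h h'
    · exact (hR.sc w1 hw1 w hw n h2 h1 h.symm h').symm
  have hsi : ∀ w w1 : List (α × Bool), w ∈ R → w1 ∈ R → n ≤ w.length → n ≤ w1.length →
      (w.length ≤ 24 * n ∨ w1.length ≤ 24 * n) → w.take n = (invRev w1).take n → False := by
    intro w w1 hw hw1 h1 h2 hor h
    rcases hor with h' | h'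
    · exact hR.sci w hw w1 hw1 n h1 h2 h h'
    · exact hR.sci' w hw w1 hw1 n h1 h2 h h'
  rcases h1 with h1 | h1 <;> rcases h2 with h2 | h2 <;> have h1 := h1 n hnu hnw <;>
    have h2 := h2 n hnu hnw1
  · exact hwne (hsc _ _ hw hw1 hnw hnw1 hor (h1.symm.trans h2))
  · exact hsi _ _ hw hw1 hnw hnw1 hor (h1.symm.trans h2)
  · exact hsi _ _ hw1 hw hnw1 hnw hor.symm (h2.symm.trans h1)
  · have h := h1.symm.trans h2
    -- pass to suffixes
    have key : ∀ w : List (α × Bool), n ≤ w.length →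
        w = w.take (w.length - n) ++ invRev ((invRev w).take n) := by
      intro w hw
      have : (invRev w).take n = invRev (w.drop (w.length - n)) := by
        conv_lhs => rw [← List.take_append_drop (w.length - n) w, invRev_append]
        rw [List.take_append_of_le_length (by simp; omega), List.take_of_length_le (by simp; omega)]
      rw [this, invRev_invRev, List.take_append_drop]
    have k1 := key w hnw
    have k2 := key w1 hnw1
    rw [← h] at k2
    set s := invRev ((invRev w).take n) with hs
    have hsl : s.length = n := by simp [hs]; omega
    have h3 := hsc (s ++ w.take (w.length - n)) (s ++ w1.take (w1.length - n))
      (hR.rot _ _ (k1 ▸ hw)) (hR.rot _ _ (k2 ▸ hw1)) (by simp; omega) (by simp; omega)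
      (by simp; omega) (by
        rw [List.take_append_of_le_length (by omega), List.take_append_of_le_length (by omega)])
    have h4 := List.append_cancel_left h3
    apply hwne
    rw [k1, k2, h4]

/-- The windmill data attached to a small cancellation set. -/
noncomputable def scWD (hR : SmallC R) : WD (FreeGroup α) where
  C := {c | (Ax R c).Nonempty}
  len := trlen R
  d c x y := td (gate R c x) (gate R c y)
  P c e x := ∃ q ∈ Ax R e, gate R c x = gate R c q
  S := Set.range FreeGroup.of
  C_conj := by
    rintro g c ⟨x, hx⟩
    exact ⟨g * x, (ax_conj g c x).2 hx⟩
  len_conj := trlen_conj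
  len_ge := by
    rintro c ⟨x, hx⟩
    rw [trlen_eq hR hx]
    exact hR.len _ hx
  d_self c x := td_self _
  d_symm c x y := td_symm _ _
  d_tri c x y z _ := td_tri _ _ _
  d_conj := by
    intro g c x y hc
    rw [gate_conj hR hc, gate_conj hR hc, td_mul]
  rot := by
    intro c hc k hk x
    have h1 := gate_conj hR hc (c ^ k) x
    rw [show c ^ k * c * (c ^ k)⁻¹ = c by group] at h1
    rw [h1]
    have hp := (gate_spec hR hc x).1
    set p := gate R c x
    rw [trlen_eq hR hp, td]
    have e : p⁻¹ * (c ^ k * p) = (p⁻¹ * c * p) ^ k := by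
      have := conj_zpow (i := k) (a := p⁻¹) (b := c)
      rw [inv_inv] at this
      rw [this]; group
    rw [e]
    exact norm_zpow_ge (hR.cyc _ hp) k hk
  P_conj := by
    rintro g c e x hc he ⟨q, hq, h⟩
    refine ⟨g * q, (ax_conj g e q).2 hq, ?_⟩
    rw [gate_conj hR hc, gate_conj hR hc, h]
  P_or := by
    intro c hc e he hne x
    by_cases h : ∃ q ∈ Ax R e, gate R c x = gate R c q
    · exact Or.inl h
    · right
      push Not at h
      refine ⟨gate R c x, (gate_spec hR hc x).1, ?_⟩
      have hkey : ∀ q ∈ Ax R e, td x q = td x (gate R c x) + td (gate R c x) q := by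
        intro q hq
        have h1 := gate_key (gate_spec hR hc x) (gate_spec hR hc q) (h q hq)
        have h2 := (gate_spec hR hc q).2 _ (gate_spec hR hc x).1
        rw [td_symm q, td_symm q, td_symm _ (gate R c x)] at h2
        omega
      have hg := gate_spec hR he x
      refine gate_unique ⟨hg.1, fun q hq => ?_⟩ (gate_spec hR he (gate R c x))
      have h1 := hg.2 q hq
      have h2 := hkey q hq
      have h3 := hkey _ hg.1
      omega
  P_d := by
    rintro c hc e he hne x y ⟨q1, hq1, h1⟩ ⟨q2, hq2, h2⟩
    rw [h1, h2]
    by_cases h : gate R c q1 = gate R c q2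
    · rw [h, td_self]
      obtain ⟨z, hz⟩ := hc
      rw [trlen_eq hR hz]
      have := hR.len _ hz
      omega
    · have hk := gate_key (gate_spec hR hc q1) (gate_spec hR hc q2) h
      have t1 := td_tri q1 (gate R c q1) q2
      have t2 := td_tri (gate R c q1) (gate R c q2) q2
      have t3 := td_tri q1 (gate R c q2) q2
      have t4 := td_tri q1 (gate R c q1) (gate R c q2)
      refine overlap_lt hR hne h (gate_spec hR hc q1).1 ?_ (gate_spec hR hc q2).1 ?_
      · exact ax_conv hR e q1 hq1 q2 hq2 _ (by omega)
      · exact ax_conv hR e q1 hq1 q2 hq2 _ (by omega)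
  S_top := FreeGroup.closure_range_of α
  S_d := by
    rintro c hc x _ ⟨a, rfl⟩
    refine (gate_lip (gate_spec hR hc x) (gate_spec hR hc _)).trans ?_
    rw [td, inv_mul_cancel_left, FreeGroup.norm_of]

theorem infix_of_geod {n p q : FreeGroup α} (h : n.norm = td 1 p + td p q + td q n) :
    (p⁻¹ * q).toWord <:+: n.toWord := by
  have e : n = FreeGroup.mk (p.toWord ++ (p⁻¹ * q).toWord ++ (q⁻¹ * n).toWord) := by
    rw [mk_append, mk_append, mk_toWord, mk_toWord, mk_toWord]; group
  have h2 : List.Sublist n.toWord (p.toWord ++ (p⁻¹ * q).toWord ++ (q⁻¹ * n).toWord) := by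
    conv_lhs => rw [e]
    exact (Red.sublist (reduce.red))
  have h3 := h2.eq_of_length (by
    have : td 1 p = p.toWord.length := by simp [td, FreeGroup.norm]
    rw [this] at h
    simp only [List.length_append]
    exact h)
  rw [h3]
  exact ⟨_, _, rfl⟩

/-- Greendlinger lemma, word form. -/
theorem greendlinger (hR : SmallC R) {n : FreeGroup α}
    (hn : n ∈ Subgroup.normalClosure (FreeGroup.mk '' R)) (hn1 : n ≠ 1) :
    ∃ w, (w ∈ R ∨ invRev w ∈ R) ∧ ∃ k, k ≤ w.length ∧ 5 * w.length ≤ 6 * k ∧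
      w.take k <:+: n.toWord := by
  have hcl : n ∈ Subgroup.closure (scWD hR).C := by
    have : Subgroup.normalClosure (FreeGroup.mk '' R) ≤ Subgroup.closure (scWD hR).C := by
      rw [Subgroup.normalClosure]
      apply Subgroup.closure_mono
      intro c hc
      obtain ⟨_, ⟨w, hw, rfl⟩, hcw⟩ := Group.mem_conjugatesOfSet_iff.1 hc
      obtain ⟨g, rfl⟩ := isConj_iff.1 hcw
      refine ⟨g, ?_⟩
      rw [Ax, Set.mem_ofPred_eq, show g⁻¹ * (g * FreeGroup.mk w * g⁻¹) * g = FreeGroup.mk w by group,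
        toWord_mk_red (hR.cyc w hw).1]
      exact hw
    exact this hn
  obtain ⟨c, hc, h⟩ := (scWD hR).windmill_green n hcl hn1
  change 20 * trlen R c ≤ 24 * td (gate R c 1) (gate R c n) at h
  have hc : (Ax R c).Nonempty := hc
  have hp := gate_spec hR hc 1
  have hq := gate_spec hR hc n
  set p := gate R c 1
  set q := gate R c n
  rw [trlen_eq hR hp.1] at h
  have hlen := hR.len _ hp.1
  have hpq : p ≠ q := by
    intro h'
    rw [h', td_self] at h
    rw [← h'] at h
    omega
  have hk := gate_key hp hq hpq
  have hinf := infix_of_geod (n := n) (p := p) (q := q) (by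
    rw [← hk]; simp [td])
  have hpw := hp.1
  simp only [Ax, Set.mem_ofPred_eq] at hpw
  have htd : td p q = (p⁻¹ * q).toWord.length := rfl
  rw [htd] at h
  obtain ⟨-, -, h1⟩ := axis hR hp.1 hq.1
  generalize (p⁻¹ * c * p).toWord = w at *
  generalize (p⁻¹ * q).toWord = u at *
  have hmin : 5 * w.length ≤ 6 * min u.length w.length := by
    rcases min_choice u.length w.length with h' | h' <;> omega
  rcases h1 with h1 | h1
  · refine ⟨w, Or.inl hpw, min u.length w.length, min_le_right _ _, hmin, ?_⟩
    rw [← h1 _ (min_le_left _ _) (min_le_right _ _)]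
    exact (take_pre _ _).isInfix.trans hinf
  · refine ⟨invRev w, Or.inr (by rwa [invRev_invRev]), min u.length w.length,
      by simp, by simpa using hmin, ?_⟩
    rw [← h1 _ (min_le_left _ _) (min_le_right _ _)]
    exact (take_pre _ _).isInfix.trans hinf

end axis

set_option linter.unusedSectionVars false
set_option linter.unusedVariables false

section blocks
variable {β : Type*}

def bk (Y : β) (b : List β × ℕ) : List β := b.1 ++ List.replicate b.2 Y

def bw (Y : β) (Bs : List (List β × ℕ)) : List β := (Bs.map (bk Y)).flatten

@[simp] theorem bw_nil (Y : β) : bw Y [] = [] := rfl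
@[simp] theorem bw_cons (Y : β) (b) (Bs : List (List β × ℕ)) :
    bw Y (b :: Bs) = bk Y b ++ bw Y Bs := rfl
@[simp] theorem bw_append (Y : β) (B1 B2 : List (List β × ℕ)) :
    bw Y (B1 ++ B2) = bw Y B1 ++ bw Y B2 := by simp [bw]

def GoodB (Y : β) (Bs : List (List β × ℕ)) : Prop :=
  ∀ b ∈ Bs, b.1 ≠ [] ∧ Y ∉ b.1 ∧ 1 ≤ b.2

theorem bw_split (Y : β) (Bs : List (List β × ℕ)) : ∀ u v, bw Y Bs = u ++ v → v ≠ [] →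
    ∃ B1 b B2 t' t, Bs = B1 ++ b :: B2 ∧ bk Y b = t' ++ t ∧ t ≠ [] ∧ u = bw Y B1 ++ t' ∧
      v = t ++ bw Y B2 := by
  induction Bs with
  | nil => intro u v h hv; simp at h; exact absurd h.2 hv
  | cons b Bs ih =>
    intro u v h hv
    rw [bw_cons, List.append_eq_append_iff] at h
    rcases h with ⟨x, h1, h2⟩ | ⟨x, h1, h2⟩
    · obtain ⟨B1, b', B2, t', t, e1, e2, e3, e4, e5⟩ := ih x v h2 hv
      refine ⟨b :: B1, b', B2, t', t, by simp [e1], e2, e3, ?_, e5⟩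
      rw [h1, e4]; simp
    · by_cases hx : x = []
      · subst hx
        simp at h1 h2
        obtain ⟨B1, b', B2, t', t, e1, e2, e3, e4, e5⟩ := ih [] v (by simp [h2]) hv
        refine ⟨b :: B1, b', B2, t', t, by simp [e1], e2, e3, ?_, e5⟩
        have : bw Y B1 ++ t' = [] := e4.symm
        rw [bw_cons, List.append_assoc, this, h1]; simp
      · exact ⟨[], b, Bs, u, x, rfl, h1, hx, by simp, h2⟩

theorem suffix_shape {Y : β} {b : List β × ℕ} {t' t : List β} (h : bk Y b = t' ++ t)
    (ht : t ≠ []) (hY : Y ∉ b.1) (hb : 1 ≤ b.2) (hb0 : b.1 ≠ []) :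
    (∃ s k, t = s ++ List.replicate k Y ∧ Y ∉ s ∧ 1 ≤ k ∧ k ≤ b.2 ∧ (s ≠ [] → k = b.2)) ∧
      (∀ z ∈ t'.head?, z ≠ Y) := by
  unfold bk at h
  rw [List.append_eq_append_iff] at h
  rcases h with ⟨x, h1, h2⟩ | ⟨x, h1, h2⟩
  · constructor
    · have hl := congrArg List.length h2
      simp at hl
      have : t = List.replicate t.length Y := by
        rw [List.eq_replicate_iff]
        refine ⟨rfl, fun z hz => ?_⟩
        have : z ∈ List.replicate b.2 Y := by rw [h2]; simp [hz]
        exact (List.mem_replicate.1 this).2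
      refine ⟨[], t.length, by simpa using this, by simp, ?_, by omega, by simp⟩
      exact List.length_pos_iff.2 ht
    · intro z hz
      rw [h1, List.head?_append_of_ne_nil _ hb0] at hz
      rintro rfl
      exact hY (List.mem_of_mem_head? hz)
  · constructor
    · refine ⟨x, b.2, h2, fun hx => hY (by rw [h1]; simp [hx]), hb, le_rfl, fun _ => rfl⟩
    · intro z hz
      rintro rfl
      exact hY (by rw [h1]; exact List.mem_append_left _ (List.mem_of_mem_head? hz))

theorem parse_one {Y : β} : ∀ (s s1 : List β) (k k1 : ℕ) (r r1 : List β), Y ∉ s → Y ∉ s1 →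
    1 ≤ k → 1 ≤ k1 → r ≠ [] → (∀ z ∈ r.head?, z ≠ Y) → (∀ z ∈ r1.head?, z ≠ Y) →
    s ++ List.replicate k Y ++ r <+: s1 ++ List.replicate k1 Y ++ r1 →
    s = s1 ∧ k = k1 ∧ r <+: r1 := by
  intro s
  induction s with
  | nil =>
    intro s1 k k1 r r1 _ hs1 hk hk1 hr hrY hr1Y h
    have hs1' : s1 = [] := by
      obtain ⟨k, rfl⟩ : ∃ j, k = j + 1 := ⟨k - 1, by omega⟩
      cases s1 with
      | nil => rfl
      | cons a s1 =>
        simp [List.replicate_succ, List.cons_prefix_cons] at h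
        exact absurd h.1 (by simp at hs1; exact hs1.1)
    subst hs1'
    simp only [List.nil_append] at h
    refine ⟨rfl, ?_⟩
    clear hk hk1 hs1
    induction k generalizing k1 with
    | zero =>
      cases k1 with
      | zero => simpa using h
      | succ k1 =>
        exfalso
        obtain ⟨z, r, rfl⟩ := List.exists_cons_of_ne_nil hr
        simp [List.replicate_succ, List.cons_prefix_cons] at h
        exact hrY z (by simp) h.1
    | succ k ih =>
      cases k1 with
      | zero =>
        exfalso
        simp [List.replicate_succ] at h
        cases r1 with
        | nil => simp at h
        | cons z r1 =>
          rw [List.cons_prefix_cons] at h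
          exact hr1Y z (by simp) h.1.symm
      | succ k1 =>
        simp only [List.replicate_succ, List.cons_append, List.cons_prefix_cons, true_and] at h
        have := ih k1 h
        exact ⟨by omega, this.2⟩
  | cons a s ih =>
    intro s1 k k1 r r1 hs hs1 hk hk1 hr hrY hr1Y h
    cases s1 with
    | nil =>
      obtain ⟨k1, rfl⟩ : ∃ j, k1 = j + 1 := ⟨k1 - 1, by omega⟩
      simp [List.replicate_succ, List.cons_prefix_cons] at h hs
      exact absurd h.1.symm hs.1
    | cons a1 s1 =>
      simp only [List.cons_append, List.cons_prefix_cons] at h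
      have := ih s1 k k1 r r1 (by simp at hs; exact hs.2) (by simp at hs1; exact hs1.2) hk hk1 hr
        hrY hr1Y h.2
      exact ⟨by rw [h.1, this.1], this.2⟩

theorem head_bw {Y : β} {Bs : List (List β × ℕ)} (hG : GoodB Y Bs) {r : List β}
    (hr : ∀ z ∈ r.head?, z ≠ Y) : ∀ z ∈ (bw Y Bs ++ r).head?, z ≠ Y := by
  cases Bs with
  | nil => simpa using hr
  | cons b Bs =>
    have hb := hG b (by simp)
    intro z hz
    rw [bw_cons, bk, List.append_assoc, List.append_assoc, List.head?_append_of_ne_nil _ hb.1] at hz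
    rintro rfl
    exact hb.2.1 (List.mem_of_mem_head? hz)

theorem parse_blocks {Y : β} : ∀ (Ps B1 : List (List β × ℕ)) (z : β) (t1 : List β),
    GoodB Y Ps → GoodB Y B1 → z ≠ Y → (∀ z ∈ t1.head?, z ≠ Y) → Ps.length ≤ B1.length →
    bw Y Ps ++ [z] <+: bw Y B1 ++ t1 → Ps <+: B1 := by
  intro Ps
  induction Ps with
  | nil => intros; simp
  | cons b Ps ih =>
    intro B1 z t1 hG hG1 hz ht1 hl h
    cases B1 with
    | nil => simp at hl
    | cons b' B1 =>
      have hGP : GoodB Y Ps := fun x hx => hG x (by simp [hx])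
      have hGB : GoodB Y B1 := fun x hx => hG1 x (by simp [hx])
      simp only [bw_cons, bk, List.append_assoc] at h
      have hb := hG b (by simp)
      have hb' := hG1 b' (by simp)
      have := parse_one b.1 b'.1 b.2 b'.2 (bw Y Ps ++ [z]) (bw Y B1 ++ t1) hb.2.1 hb'.2.1 hb.2.2
        hb'.2.2 (by simp) (head_bw hGP (by simpa using hz)) (head_bw hGB ht1)
        (by simpa only [List.append_assoc] using h)
      have h2 := ih B1 z t1 hGP hGB hz ht1 (by simpa using hl) this.2.2
      rw [List.cons_prefix_cons]
      exact ⟨Prod.ext this.1 this.2.1, h2⟩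

structure Cut (Y : β) (Bs : List (List β × ℕ)) (w : List β) (b0 : List β × ℕ)
    (B : List (List β × ℕ)) (t t' : List β) : Prop where
  rot : (b0 :: B) ~r Bs
  split : bk Y b0 = t' ++ t
  ne : t ≠ []
  eq : w = t ++ bw Y B ++ t'


theorem rot_cons_eq {l l' : List β} {a : β} (h : (a :: l) ~r (a :: l')) (hn : (a :: l').Nodup) :
    l = l' := by
  obtain ⟨n, hn', h⟩ := List.isRotated_iff_mod.1 h.symm
  rw [List.rotate_eq_drop_append_take hn'] at h
  have hs := List.take_append_drop n (a :: l')
  generalize List.drop n (a :: l') = v at *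
  generalize List.take n (a :: l') = u at *
  cases u with
  | nil => simp at h hs; rw [h] at hs; simpa using hs
  | cons x u =>
    cases v with
    | nil => simp at h hs; rw [← h.2, hs.2]
    | cons y v =>
      exfalso
      rw [List.cons_append, List.cons.injEq] at h hs
      rw [← hs.2, List.nodup_cons] at hn
      exact hn.1 (by simp [h.1])

theorem exists_cut {Y : β} {Bs : List (List β × ℕ)} {w : List β} (h : w ~r bw Y Bs) (hw : w ≠ []) :
    ∃ b0 B t t', Cut Y Bs w b0 B t t' := by
  obtain ⟨n, hn', h⟩ := List.isRotated_iff_mod.1 h.symm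
  rw [List.rotate_eq_drop_append_take hn'] at h
  have hs := List.take_append_drop n (bw Y Bs)
  generalize List.drop n (bw Y Bs) = v at *
  generalize List.take n (bw Y Bs) = u at *
  have key : ∃ u v, bw Y Bs = u ++ v ∧ v ≠ [] ∧ w = v ++ u := by
    by_cases hv : v = []
    · subst hv
      refine ⟨[], u, by simpa using hs.symm, ?_, by simpa using h.symm⟩
      rintro rfl; exact hw (by simpa using h.symm)
    · exact ⟨u, v, hs.symm, hv, h.symm⟩
  obtain ⟨u, v, h1, h2, h3⟩ := key
  obtain ⟨B1, b, B2, t', t, e1, e2, e3, e4, e5⟩ := bw_split Y Bs u v h1 h2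
  refine ⟨b, B2 ++ B1, t, t', ?_, e2, e3, ?_⟩
  · rw [e1]; exact (List.isRotated_append (l := B1) (l' := b :: B2)).symm
  · rw [h3, e4, e5]; simp

theorem isChain_bw {Y : β} {r : β → β → Prop} (hY : r Y Y) : ∀ {Bs : List (List β × ℕ)},
    (∀ b ∈ Bs, b.1 ≠ [] ∧ (b.1 ++ [Y]).IsChain r ∧ (∀ z ∈ b.1.head?, r Y z) ∧ 1 ≤ b.2) →
    (Y :: bw Y Bs).IsChain r ∧ ∀ z ∈ (Y :: bw Y Bs).getLast?, z = Y := by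
  intro Bs
  induction Bs using List.reverseRecOn with
  | nil => intro _; simp
  | append_singleton Bs b ih =>
    intro h
    have ih := ih (fun x hx => h x (by simp [hx]))
    have hb := h b (by simp)
    have rep : ∀ n, (List.replicate n Y).IsChain r ∧ ∀ z ∈ (List.replicate n Y).head?, z = Y := by
      intro n
      refine ⟨List.isChain_replicate_of_rel _ hY, ?_⟩
      intro z hz
      exact List.eq_of_mem_replicate (List.mem_of_mem_head? hz)
    have e : Y :: bw Y (Bs ++ [b]) = (Y :: bw Y Bs) ++ (b.1 ++ List.replicate b.2 Y) := by
      simp [bk]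
    obtain ⟨c1, c2, c3⟩ := List.isChain_append.1 hb.2.1
    rw [e]
    constructor
    · rw [List.isChain_append]
      refine ⟨ih.1, ?_, ?_⟩
      · rw [List.isChain_append]
        refine ⟨c1, (rep _).1, ?_⟩
        intro x hx y hy
        rw [(rep _).2 y hy]
        exact c3 x hx Y (by simp)
      · intro x hx y hy
        rw [ih.2 x hx]
        rw [List.head?_append_of_ne_nil _ hb.1] at hy
        exact hb.2.2.1 y hy
    · intro z hz
      rw [← List.append_assoc, List.getLast?_append_of_ne_nil] at hz
      · exact List.eq_of_mem_replicate (List.mem_of_getLast? hz)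
      · simp; have := hb.2.2.2; omega

theorem rot_sq_chain {r : β → β → Prop} {w W : List β} (h : w ~r W) (hc : (W ++ W ++ W).IsChain r) :
    (w ++ w).IsChain r := by
  obtain ⟨n, hn', h⟩ := List.isRotated_iff_mod.1 h.symm
  rw [List.rotate_eq_drop_append_take hn'] at h
  have hs := List.take_append_drop n W
  generalize List.drop n W = v at *
  generalize List.take n W = u at *
  refine chain_inf hc ⟨u, v, ?_⟩
  rw [← h, ← hs]; simp

end blocks

set_option linter.unusedSectionVars false
set_option linter.unusedVariables false

section shapes
open FreeGroup

def isElt {A : Type} : GenSym A → Prop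
  | .elt _ => True
  | _ => False

@[simp] theorem isElt_elt {A : Type} (a : A) : isElt (GenSym.elt a) := trivial
@[simp] theorem not_isElt_b {A : Type} : ¬ isElt (GenSym.b : GenSym A) := fun h => h
@[simp] theorem not_isElt_c {A : Type} : ¬ isElt (GenSym.c : GenSym A) := fun h => h
@[simp] theorem not_isElt_d {A : Type} : ¬ isElt (GenSym.d : GenSym A) := fun h => h
@[simp] theorem not_isElt_f1 {A : Type} : ¬ isElt (GenSym.f1 : GenSym A) := fun h => h
@[simp] theorem not_isElt_f2 {A : Type} : ¬ isElt (GenSym.f2 : GenSym A) := fun h => h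

/-- the blocks of the relator `chainProd lo x y` -/
def chainBs {A : Type} (lo : ℕ) (x : GenSym A) : List (List (GenSym A × Bool) × ℕ) :=
  (List.range 1000).map (fun k => ([(x, true)], (lo + k + 1) ^ 2))

def stdBs {A : Type} (X : List (GenSym A × Bool)) (m N : ℕ) : List (List (GenSym A × Bool) × ℕ) :=
  (List.range N).map (fun k => (X, 100 * m + k + 2))

def argW (S : IndexedStructure) (m : ℕ) (as : Fin (S.arity m) → S.A) :
    List (GenSym S.A × Bool) := List.ofFn (fun i => (GenSym.elt (as i), true))

/-- the admissible chains -/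
inductive Ok {A : Type} : ℕ → GenSym A → GenSym A → Prop
  | v1 : Ok 4000 .f1 .f2
  | v2 : Ok 4000 .f2 .f1
  | b1 : Ok 1000 .b .f1
  | b2 : Ok 1000 .b .f2
  | c1 : Ok 2000 .c .f1
  | c2 : Ok 2000 .c .f2
  | d1 : Ok 3000 .d .f1
  | d2 : Ok 3000 .d .f2
  | ac (a : A) : Ok 0 (.elt a) .c
  | ad (a : A) : Ok 0 (.elt a) .d

/-- first block and number of further blocks for the relator of the `m`-th symbol -/
inductive RelOk (S : IndexedStructure) (m : ℕ) (as : Fin (S.arity m) → S.A) :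
    List (GenSym S.A × Bool) → ℕ → ℕ → Prop
  | rel : ¬ S.isFunc m → S.relInterp m as → RelOk S m as (argW S m as) (100 * m + 1) 99
  | neg : S.isFunc m → (∀ T, argW S m as ≠ (.elt (S.funcInterp m as), true) :: T) →
      RelOk S m as ((.elt (S.funcInterp m as), false) :: argW S m as) (100 * m + 1) 99
  | canc (z : GenSym S.A × Bool) (T : List (GenSym S.A × Bool)) : S.isFunc m →
      argW S m as = (.elt (S.funcInterp m as), true) :: z :: T →
      RelOk S m as (z :: T) (100 * m + 1) 99
  | merge : S.isFunc m → argW S m as = [(.elt (S.funcInterp m as), true)] →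
      RelOk S m as (argW S m as) (200 * m + 101) 98

inductive Sh (S : IndexedStructure) : GenSym S.A → List (List (GenSym S.A × Bool) × ℕ) → Prop
  | chain (lo : ℕ) (x y : GenSym S.A) : Ok lo x y → Sh S y (chainBs lo x)
  | rel (m : ℕ) (as : Fin (S.arity m) → S.A) (Z0 : List (GenSym S.A × Bool)) (e0 N : ℕ) :
      1 ≤ m → RelOk S m as Z0 e0 N → Sh S .b ((Z0, e0) :: stdBs (argW S m as) m N)

variable {S : IndexedStructure}

theorem Ok.props {A : Type} {lo : ℕ} {x y : GenSym A} (h : Ok lo x y) :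
    x ≠ y ∧ ¬ isElt y ∧ y ≠ .b ∧ (lo = 0 ∨ lo = 1000 ∨ lo = 2000 ∨ lo = 3000 ∨ lo = 4000) := by
  cases h <;> simp

theorem argW_len (m : ℕ) (as : Fin (S.arity m) → S.A) : (argW S m as).length = S.arity m := by
  simp [argW]

theorem argW_mem {m : ℕ} {as : Fin (S.arity m) → S.A} {z} (h : z ∈ argW S m as) :
    isElt z.1 ∧ z.2 = true := by
  simp [argW] at h
  obtain ⟨i, rfl⟩ := h
  simp

theorem argW_inj {m : ℕ} {as as' : Fin (S.arity m) → S.A} (h : argW S m as = argW S m as') :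
    as = as' := by
  unfold argW at h
  have := List.ofFn_injective h
  funext i
  have := congrFun this i
  simpa using this

theorem RelOk.unique {m : ℕ} {as : Fin (S.arity m) → S.A} {Z e N Z' e' N'}
    (h : RelOk S m as Z e N) (h' : RelOk S m as Z' e' N') : Z = Z' ∧ e = e' ∧ N = N' := by
  cases h <;> cases h' <;> simp_all

theorem RelOk.props {m : ℕ} {as : Fin (S.arity m) → S.A} {Z e N} (hm : 1 ≤ m)
    (h : RelOk S m as Z e N) : Z ≠ [] ∧ (∀ z ∈ Z, isElt z.1) ∧ (∀ z ∈ Z.tail, z.2 = true) ∧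
      e % 100 = 1 ∧ (Z.length ≤ S.arity m + 1) ∧ S.arity m ≤ Z.length + 1 ∧ 
      ((e = 100 * m + 1 ∧ N = 99) ∨ (e = 200 * m + 101 ∧ N = 98 ∧ S.arity m = 1 ∧ Z = argW S m as)) ∧
      List.IsChain (fun a b : GenSym S.A × Bool => a.1 = b.1 → a.2 = b.2) Z := by
  have hX0 : argW S m as ≠ [] := by
    have := S.arity_pos m hm
    rw [← List.length_pos_iff, argW_len]; omega
  have hX : ∀ z ∈ argW S m as, isElt z.1 ∧ z.2 = true := fun z => argW_mem
  have hl := argW_len (S := S) m as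
  have hc : ∀ L : List (GenSym S.A × Bool), (∀ z ∈ L, z.2 = true) →
      List.IsChain (fun a b : GenSym S.A × Bool => a.1 = b.1 → a.2 = b.2) L := by
    intro L hL
    apply List.Pairwise.isChain
    rw [List.pairwise_iff_forall_sublist]
    intro a b hab _
    rw [hL a (hab.subset (by simp)), hL b (hab.subset (by simp))]
  cases h with
  | rel h1 h2 =>
    refine ⟨hX0, fun z hz => (hX z hz).1, fun z hz => (hX z (List.mem_of_mem_tail hz)).2, by omega,
      by omega, by omega, by omega, hc _ fun z hz => (hX z hz).2⟩
  | neg h1 h2 =>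
    refine ⟨by simp, ?_, fun z hz => (hX z hz).2, by omega, by simp; omega, by simp; omega,
      by simp, ?_⟩
    · intro z hz
      rcases List.mem_cons.1 hz with rfl | hz
      · simp
      · exact (hX z hz).1
    · rw [List.isChain_cons]
      refine ⟨?_, hc _ fun z hz => (hX z hz).2⟩
      intro z hz he
      exfalso
      obtain ⟨T, hT⟩ : ∃ T, argW S m as = z :: T := by
        cases hh : argW S m as with
        | nil => simp [hh] at hz
        | cons a T => simp [hh] at hz; subst hz; exact ⟨T, rfl⟩
      apply h2 T
      rw [hT]
      congr 1
      have := (hX z (by simp [hT])).2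
      exact Prod.ext he.symm this
  | canc z T h1 h2 =>
    rw [h2] at hX hl
    simp at hl
    refine ⟨by simp, fun z hz => (hX z (by simp at hz ⊢; tauto)).1, 
      fun z hz => (hX z (by simp at hz ⊢; tauto)).2, by omega, by simp; omega, by simp; omega,
      by simp, hc _ fun z hz => (hX z (by simp at hz ⊢; tauto)).2⟩
  | merge h1 h2 =>
    have h3 := h2 ▸ hl
    simp at h3
    refine ⟨hX0, fun z hz => (hX z hz).1, fun z hz => (hX z (List.mem_of_mem_tail hz)).2, by omega,
      by omega, by omega, Or.inr ⟨rfl, rfl, by omega, rfl⟩, hc _ fun z hz => (hX z hz).2⟩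

theorem Sh.notElt {y Bs} (h : Sh S y Bs) : ¬ isElt y := by
  cases h with
  | chain lo x y h => exact h.props.2.1
  | rel => simp

theorem mem_chainBs {A : Type} {lo : ℕ} {x : GenSym A} {b} (h : b ∈ chainBs lo x) :
    ∃ k < 1000, b = ([(x, true)], (lo + k + 1) ^ 2) := by
  simp [chainBs] at h
  obtain ⟨k, h1, h2⟩ := h
  exact ⟨k, h1, h2.symm⟩

theorem mem_stdBs {A : Type} {X : List (GenSym A × Bool)} {m N : ℕ} {b} (h : b ∈ stdBs X m N) :
    ∃ k < N, b = (X, 100 * m + k + 2) := by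
  simp [stdBs] at h
  obtain ⟨k, h1, h2⟩ := h
  exact ⟨k, h1, h2.symm⟩

/-- facts on the blocks -/
theorem Sh.blk {y Bs} (h : Sh S y Bs) : ∀ b ∈ Bs, b.1 ≠ [] ∧ (y, true) ∉ b.1 ∧ 1 ≤ b.2 ∧
    List.IsChain (fun a b : GenSym S.A × Bool => a.1 = b.1 → a.2 = b.2) b.1 ∧
    (∀ z ∈ b.1, z.1 ≠ y) ∧ (∀ z ∈ b.1, z.2 = false → isElt z.1) ∧ 
    (∀ z ∈ b.1.tail, isElt z.1 ∧ z.2 = true) ∧ (∀ z ∈ b.1, isElt z.1 ∨ z.2 = true ∧ b.1 = [z]) := by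
  cases h with
  | chain lo x y h =>
    intro b hb
    obtain ⟨k, hk, rfl⟩ := mem_chainBs hb
    have := h.props
    simp [this.1, Ne.symm this.1]
    exact Nat.one_le_pow _ _ (by omega)
  | rel m as Z0 e0 N hm h =>
    intro b hb
    have hp := h.props hm
    have hX0 : argW S m as ≠ [] := by
      have := S.arity_pos m hm
      rw [← List.length_pos_iff, argW_len]; omega
    have ne : ∀ z : GenSym S.A × Bool, isElt z.1 → z.1 ≠ GenSym.b := by
      intro z hz h0; rw [h0] at hz; exact not_isElt_b hz
    rcases List.mem_cons.1 hb with rfl | hb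
    · refine ⟨hp.1, fun h => ne _ (hp.2.1 _ h) rfl, ?_, hp.2.2.2.2.2.2.2, fun z hz => ne _ (hp.2.1 _ hz),
        fun z hz _ => hp.2.1 _ hz, fun z hz => ⟨hp.2.1 _ (List.mem_of_mem_tail hz), hp.2.2.1 z hz⟩,
        fun z hz => Or.inl (hp.2.1 _ hz)⟩
      have := hp.2.2.2.1
      simp only; omega
    · obtain ⟨k, hk, rfl⟩ := mem_stdBs hb
      have hX : ∀ z ∈ argW S m as, isElt z.1 ∧ z.2 = true := fun z => argW_mem
      refine ⟨hX0, fun h => ne _ (hX _ h).1 rfl, by simp, ?_, fun z hz => ne _ (hX _ hz).1,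
        fun z hz _ => (hX _ hz).1, fun z hz => hX _ (List.mem_of_mem_tail hz),
        fun z hz => Or.inl (hX _ hz).1⟩
      apply List.Pairwise.isChain
      rw [List.pairwise_iff_forall_sublist]
      intro a b hab _
      rw [(hX a (hab.subset (by simp))).2, (hX b (hab.subset (by simp))).2]

theorem Sh.good {y Bs} (h : Sh S y Bs) : GoodB (y, true) Bs :=
  fun b hb => ⟨(h.blk b hb).1, (h.blk b hb).2.1, (h.blk b hb).2.2.1⟩

theorem Sh.nodup {y Bs} (h : Sh S y Bs) : (Bs.map Prod.snd).Nodup := by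
  cases h with
  | chain lo x y h =>
    rw [chainBs, List.map_map]
    refine List.Nodup.map_on ?_ List.nodup_range
    intro a _ b _ hab
    simp at hab
    omega
  | rel m as Z0 e0 N hm h =>
    have hp := (h.props hm).2.2.2
    have hN : N ≤ 99 := by omega
    rw [List.map_cons, List.nodup_cons, stdBs, List.map_map]
    constructor
    · simp; intro k hk; omega
    · refine List.Nodup.map_on ?_ List.nodup_range
      intro a _ b _ hab
      simp at hab
      omega

def Gd {A : Type} (y : GenSym A) (e : ℕ) : Prop := 2 ≤ e ∧ (y = .b → e % 100 ≠ 1)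

theorem Sh.uniq {y Bs Bs1} (h : Sh S y Bs) (h1 : Sh S y Bs1) {b} (hb : b ∈ Bs) (hb1 : b ∈ Bs1)
    (hg : Gd y b.2) : Bs = Bs1 := by
  cases h with
  | chain lo x _ h =>
    have hp := h.props
    cases h1 with
    | chain lo1 x1 _ h1 =>
      have hp1 := h1.props
      obtain ⟨k, hk, rfl⟩ := mem_chainBs hb
      obtain ⟨k1, hk1, hh⟩ := mem_chainBs hb1
      simp only [Prod.mk.injEq, List.cons.injEq, and_true] at hh
      have he := Nat.pow_left_injective (n := 2) (by norm_num) hh.2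
      have : lo = lo1 := by omega
      rw [this, hh.1]
    | rel m as Z0 e0 N hm h1 => exact absurd rfl hp.2.2.1
  | rel m as Z0 e0 N hm h =>
    cases h1 with
    | chain lo1 x1 _ h1 => exact absurd rfl h1.props.2.2.1
    | rel m1 as1 Z1 e1 N1 hm1 h1 =>
      have hp := h.props hm
      have hp1 := h1.props hm1
      have g := hg.2 rfl
      have hb' : b ∈ stdBs (argW S m as) m N := by
        rcases List.mem_cons.1 hb with rfl | hb
        · exact absurd hp.2.2.2.1 g
        · exact hb
      have hb1' : b ∈ stdBs (argW S m1 as1) m1 N1 := by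
        rcases List.mem_cons.1 hb1 with rfl | hb
        · exact absurd hp1.2.2.2.1 g
        · exact hb
      obtain ⟨k, hk, rfl⟩ := mem_stdBs hb'
      obtain ⟨k1, hk1, hh⟩ := mem_stdBs hb1'
      simp only [Prod.mk.injEq] at hh
      have : m = m1 := by omega
      subst this
      have := argW_inj hh.1
      subst this
      obtain ⟨rfl, rfl, rfl⟩ := h.unique h1
      rfl

theorem bk_len {β : Type*} (Y : β) (b : List β × ℕ) : (bk Y b).length = b.1.length + b.2 := by
  simp [bk]

theorem bw_len {β : Type*} (Y : β) (Bs : List (List β × ℕ)) :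
    (bw Y Bs).length = (Bs.map (fun b => b.1.length + b.2)).sum := by
  simp [bw, List.length_flatten, bk_len, Function.comp_def]

theorem chain_len {A : Type} (lo : ℕ) (x y : GenSym A) (h : Ok lo x y) :
    24 * (3 * ((lo + 1000) ^ 2 + 1) + 1) ≤ (bw (y, true) (chainBs lo x)).length := by
  rw [bw_len, chainBs, List.map_map]
  have : ((fun b : List (GenSym A × Bool) × ℕ => b.1.length + b.2) ∘
    fun k => ([(x, true)], (lo + k + 1) ^ 2)) = fun k => 1 + (lo + k + 1) ^ 2 := by
      funext k; simp
  rw [this]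
  obtain h | h | h | h | h := h.props.2.2.2 <;> subst h <;> decide +kernel

theorem sum_lin (c N : ℕ) : ((List.range N).map (fun k => c + k)).sum * 2 + N = 2 * N * c + N * N := by
  induction N with
  | zero => simp
  | succ n ih => rw [List.range_succ, List.map_append, List.sum_append]; simp; nlinarith

theorem rel_len {m : ℕ} (X Z0 : List (GenSym S.A × Bool)) (e0 N : ℕ) (Y) :
    (bw Y ((Z0, e0) :: stdBs X m N)).length * 2 + N =
      2 * (Z0.length + e0) + 2 * N * (X.length + 100 * m + 2) + N * N := by
  rw [bw_len, stdBs, List.map_cons, List.map_map]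
  have : ((fun b : List (GenSym S.A × Bool) × ℕ => b.1.length + b.2) ∘
    fun k => (X, 100 * m + k + 2)) = fun k => (X.length + 100 * m + 2) + k := by
      funext k; simp; omega
  rw [this, List.sum_cons]
  have := sum_lin (X.length + 100 * m + 2) N
  simp only
  omega

theorem Sh.len3 {y Bs} (h : Sh S y Bs) : 98 ≤ Bs.length := by
  cases h with
  | chain => simp [chainBs]
  | rel m as Z0 e0 N hm h => have := h.props hm; simp [stdBs]; omega

theorem Sh.len {y Bs b0 b1 b2 r} (h : Sh S y Bs) (hr : (b0 :: b1 :: b2 :: r) ~r Bs) :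
    24 * (b0.1.length + b0.2 + (b1.1.length + b1.2) + 1) ≤ (bw (y, true) Bs).length ∧
    ((Gd y b1.2) ∨ (Gd y b2.2 ∧ 24 * (b0.1.length + b0.2 + (b1.1.length + b1.2) + 
      (b2.1.length + b2.2) + 1) ≤ (bw (y, true) Bs).length)) := by
  have hnd : ((b0 :: b1 :: b2 :: r).map Prod.snd).Nodup := 
    ((hr.perm.map Prod.snd).nodup_iff).2 h.nodup
  simp only [List.map_cons, List.nodup_cons, List.mem_cons, not_or] at hnd
  have m0 := hr.mem_iff.1 (show b0 ∈ b0 :: b1 :: b2 :: r by simp)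
  have m1 := hr.mem_iff.1 (show b1 ∈ b0 :: b1 :: b2 :: r by simp)
  have m2 := hr.mem_iff.1 (show b2 ∈ b0 :: b1 :: b2 :: r by simp)
  have hN := h.nodup
  cases h with
  | chain lo x _ h =>
    have hl := chain_len lo x y h
    have hp := h.props.2.2.1
    obtain ⟨k0, hk0, rfl⟩ := mem_chainBs m0
    obtain ⟨k1, hk1, rfl⟩ := mem_chainBs m1
    obtain ⟨k2, hk2, rfl⟩ := mem_chainBs m2
    have q0 : (lo + k0 + 1) ^ 2 ≤ (lo + 1000) ^ 2 := Nat.pow_le_pow_left (by omega) 2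
    have q1 : (lo + k1 + 1) ^ 2 ≤ (lo + 1000) ^ 2 := Nat.pow_le_pow_left (by omega) 2
    have q2 : (lo + k2 + 1) ^ 2 ≤ (lo + 1000) ^ 2 := Nat.pow_le_pow_left (by omega) 2
    have z1 : 1 ≤ (lo + k1 + 1) ^ 2 := Nat.one_le_pow _ _ (by omega)
    have z2 : 1 ≤ (lo + k2 + 1) ^ 2 := Nat.one_le_pow _ _ (by omega)
    have hd := hnd.2.1.1
    simp only [List.length_singleton] at *
    refine ⟨by omega, ?_⟩
    by_cases g : 2 ≤ (lo + k1 + 1) ^ 2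
    · exact Or.inl ⟨g, fun h => absurd h hp⟩
    · exact Or.inr ⟨⟨by omega, fun h => absurd h hp⟩, by omega⟩
  | rel m as Z0 e0 N hm h =>
    have hp := h.props hm
    have hX := argW_len m as
    have hl := rel_len (m := m) (argW S m as) Z0 e0 N (GenSym.b, true)
    have har := S.arity_pos m hm
    have hlen : ∀ b ∈ (Z0, e0) :: stdBs (argW S m as) m N, b = (Z0, e0) ∨
        ∃ k < N, b = (argW S m as, 100 * m + k + 2) := by
      intro b hb
      rcases List.mem_cons.1 hb with rfl | hb
      · exact Or.inl rfl
      · exact Or.inr (mem_stdBs hb)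
    have v0 := hlen _ m0
    have v1 := hlen _ m1
    have v2 := hlen _ m2
    rcases hp.2.2.2.2.2.2.1 with ⟨he, hNN⟩ | ⟨he, hNN, ha, hZ⟩
    · have bd : ∀ b : List (GenSym S.A × Bool) × ℕ, (b = (Z0, e0) ∨
        ∃ k < N, b = (argW S m as, 100 * m + k + 2)) → b.1.length + b.2 ≤ S.arity m + 100 * m + 100 := by
        rintro b (rfl | ⟨k, hk, rfl⟩)
        · simp only; have := hp.2.2.2.2.1; omega
        · simp only; omega
      have d0 := bd _ v0
      have d1 := bd _ v1
      have d2 := bd _ v2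
      have g1 := hp.2.2.2.2.2.1
      subst hNN
      refine ⟨by omega, ?_⟩
      rcases v1 with rfl | ⟨k, hk, rfl⟩
      · right
        rcases v2 with rfl | ⟨k, hk, rfl⟩
        · simp at hnd
        · exact ⟨⟨by simp, fun _ => by simp only; omega⟩, by omega⟩
      · exact Or.inl ⟨by simp, fun _ => by simp only; omega⟩
    · rw [hZ] at hl
      subst hNN
      rw [hX, ha] at hl
      have c1 : Gd (GenSym.b : GenSym S.A) b1.2 ∨ b1 = (Z0, e0) := by
        rcases v1 with rfl | ⟨k, hk, rfl⟩
        · exact Or.inr rfl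
        · exact Or.inl ⟨by simp, fun _ => by simp only; omega⟩
      rw [hZ] at v0 v1 v2 c1 hr hN ⊢
      have bd : ∀ b : List (GenSym S.A × Bool) × ℕ, (b = (argW S m as, e0) ∨
        ∃ k < 98, b = (argW S m as, 100 * m + k + 2)) → b.1.length + b.2 ≤ 200 * m + 102 ∧
        (b.2 ≠ e0 → b.1.length + b.2 ≤ 100 * m + 100) := by
        rintro b (rfl | ⟨k, hk, rfl⟩)
        · simp only; omega
        · simp only; omega
      have d0 := bd _ v0
      have d1 := bd _ v1
      have d2 := bd _ v2
      refine ⟨by omega, ?_⟩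
      rcases c1 with c1 | c1
      · exact Or.inl c1
      · right
        have hr1 : (b1 :: (b2 :: r ++ [b0])) ~r (b1 :: stdBs (argW S m as) m 98) := by
          rw [← c1] at hr
          refine List.IsRotated.trans ?_ hr
          exact (List.isRotated_append (l := [b0]) (l' := b1 :: b2 :: r)).symm
        have heq := rot_cons_eq hr1 (by rw [← c1] at hN; exact List.Nodup.of_map _ hN)
        have hb2 : b2 = (argW S m as, 100 * m + 2) := by
          have := congrArg List.head? heq
          rw [stdBs, List.range_succ_eq_map, List.map_cons, List.cons_append, List.head?_cons,
            List.head?_cons] at this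
          exact Option.some.inj this
        have hb0 : b0 = (argW S m as, 100 * m + 99) := by
          have := congrArg List.getLast? heq
          rw [stdBs, List.range_succ, List.map_append, List.map_singleton,
            List.getLast?_concat, List.getLast?_concat] at this
          exact Option.some.inj this
        refine ⟨?_, ?_⟩
        · rw [hb2]; exact ⟨by simp, fun _ => by simp only; omega⟩
        · rw [hb2, hb0, c1]; simp only; omega

end shapes

set_option linter.unusedSectionVars false
set_option linter.unusedVariables false

section rels
open FreeGroup
variable {S : IndexedStructure}

def NP (S : IndexedStructure) : Set (List (GenSym S.A × Bool)) :=
  {w | ∃ y Bs, Sh S y Bs ∧ w ~r bw (y, true) Bs}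

def RR (S : IndexedStructure) (p1 p2 : ℕ) : Set (List (GenSym S.A × Bool)) :=
  NP S ∪ {List.replicate p1 (.f1, true), List.replicate p2 (.f2, true)}

/-- a word of the shape `y, Bs`, cut open -/
structure Win (S : IndexedStructure) (y : GenSym S.A) (Bs) (w : List (GenSym S.A × Bool))
    (b0 b1 b2 : List (GenSym S.A × Bool) × ℕ) (r : List (List (GenSym S.A × Bool) × ℕ))
    (t t' : List (GenSym S.A × Bool)) : Prop where
  sh : Sh S y Bs
  rot : (b0 :: b1 :: b2 :: r) ~r Bs
  split : bk (y, true) b0 = t' ++ t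
  ne : t ≠ []
  rne : r ≠ []
  eq : w = t ++ (bw (y, true) (b1 :: b2 :: r) ++ t')

theorem exists_win {y : GenSym S.A} {Bs w} (h : Sh S y Bs) (hw : w ~r bw (y, true) Bs) :
    ∃ b0 b1 b2 r t t', Win S y Bs w b0 b1 b2 r t t' := by
  have hl := h.len3
  have hne : bw (y, true) Bs ≠ [] := by
    cases Bs with
    | nil => simp at hl
    | cons b Bs =>
      have := (h.blk b (by simp)).1
      simp [bk, this]
  obtain ⟨b0, B, t, t', hc⟩ := exists_cut hw (fun h0 => hne (by rw [h0] at hw; simpa using hw))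
  have := hc.rot.perm.length_eq
  match B, hc with
  | [], hc => simp at this; omega
  | [_], hc => simp at this; omega
  | [_, _], hc => simp at this; omega
  | b1 :: b2 :: b3 :: r, hc =>
    exact ⟨b0, b1, b2, b3 :: r, t, t', h, hc.rot, hc.split, hc.ne, by simp, by rw [hc.eq]; simp⟩

namespace Win
variable {y : GenSym S.A} {Bs : List (List (GenSym S.A × Bool) × ℕ)} {w : List (GenSym S.A × Bool)}
  {b0 b1 b2 : List (GenSym S.A × Bool) × ℕ} {r : List (List (GenSym S.A × Bool) × ℕ)}
  {t t' : List (GenSym S.A × Bool)}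

theorem mem (h : Win S y Bs w b0 b1 b2 r t t') {b} (hb : b ∈ b0 :: b1 :: b2 :: r) : b ∈ Bs :=
  h.rot.mem_iff.1 hb

theorem length (h : Win S y Bs w b0 b1 b2 r t t') : w.length = (bw (y, true) Bs).length := by
  rw [bw_len, ← ((h.rot.perm.map (fun b => b.1.length + b.2)).sum_eq), ← bw_len (y, true), h.eq]
  have := congrArg List.length h.split
  simp at this ⊢
  omega

theorem tlen (h : Win S y Bs w b0 b1 b2 r t t') : t.length ≤ b0.1.length + b0.2 := by
  have := congrArg List.length h.split
  rw [bk_len] at this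
  simp at this
  omega

theorem bound (h : Win S y Bs w b0 b1 b2 r t t') :
    24 * (t.length + (bk (y, true) b1).length + 1) ≤ w.length := by
  have := (h.sh.len h.rot).1
  have := h.tlen
  rw [h.length, bk_len]
  omega

theorem shape (h : Win S y Bs w b0 b1 b2 r t t') :
    (∃ s k, t = s ++ List.replicate k (y, true) ∧ (y, true) ∉ s ∧ 1 ≤ k ∧ k ≤ b0.2 ∧
      (s ≠ [] → k = b0.2)) ∧ (∀ z ∈ t'.head?, z ≠ (y, true)) := by
  have hb := h.sh.blk b0 (h.mem (by simp))
  exact suffix_shape h.split h.ne hb.2.1 hb.2.2.1 hb.1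

/-- a common initial window determines the word -/
theorem core (h : Win S y Bs w b0 b1 b2 r t t') {Bs1 w1 c0 c1 c2 r1 u u'}
    (h1 : Win S y Bs1 w1 c0 c1 c2 r1 u u') {n : ℕ} (hn : w.length ≤ 24 * n)
    (he : w.take n = w1.take n) : w = w1 := by
  obtain ⟨⟨s, k, rfl, hs, hk1, hk2, -⟩, ht'⟩ := h.shape
  obtain ⟨⟨s1, k1, rfl, hs1, hk3, hk4, -⟩, hu'⟩ := h1.shape
  have hG : GoodB (y, true) (b1 :: b2 :: r) := fun b hb => h.sh.good b (h.mem (by simp at hb ⊢; tauto))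
  have hG1 : GoodB (y, true) (c1 :: c2 :: r1) :=
    fun b hb => h1.sh.good b (h1.mem (by simp at hb ⊢; tauto))
  have main : ∀ Ps q Q, b1 :: b2 :: r = Ps ++ q :: Q → Ps.length ≤ 2 →
      24 * ((s ++ List.replicate k (y, true)).length + (bw (y, true) Ps).length + 1) ≤ w.length →
      s = s1 ∧ k = k1 ∧ Ps <+: c1 :: c2 :: r1 := by
    intro Ps q Q hP hP2 hlen
    have hq := hG q (by rw [hP]; simp)
    obtain ⟨z, Z, hz⟩ := List.exists_cons_of_ne_nil hq.1
    have hzY : z ≠ (y, true) := by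
      rintro rfl; exact hq.2.1 (by simp [hz])
    have hGP : GoodB (y, true) Ps := fun b hb => hG b (by rw [hP]; simp [hb])
    have hpre : s ++ List.replicate k (y, true) ++ (bw (y, true) Ps ++ [z]) <+: w := by
      rw [h.eq, hP, bw_append, bw_cons, bk, hz]
      refine ⟨Z ++ List.replicate q.2 (y, true) ++ bw (y, true) Q ++ t', by simp⟩
    have hpre1 : s ++ List.replicate k (y, true) ++ (bw (y, true) Ps ++ [z]) <+: w1 := by
      rw [List.prefix_iff_eq_take] at hpre
      rw [List.prefix_iff_eq_take]
      have hle : (s ++ List.replicate k (y, true) ++ (bw (y, true) Ps ++ [z])).length ≤ n := by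
        rw [List.length_append, List.length_append (bs := [z]), List.length_singleton]; omega
      have := congrArg (List.take (s ++ List.replicate k (y, true) ++ (bw (y, true) Ps ++ [z])).length) he
      rw [List.take_take, List.take_take, min_eq_left hle] at this
      rw [← this]; exact hpre
    rw [h1.eq] at hpre1
    have p1 := parse_one s s1 k k1 _ _ hs hs1 hk1 hk3 (by simp) (head_bw hGP (by simpa using hzY))
      (head_bw hG1 hu') hpre1
    exact ⟨p1.1, p1.2.1, parse_blocks Ps _ z u' hGP hG1 hzY hu' (by simp; omega) p1.2.2⟩
  have hlen := h.sh.len h.rot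
  have htl := h.tlen
  rw [← h.length] at hlen
  have fin : b1 = c1 → s = s1 → k = k1 → Bs = Bs1 → w = w1 := by
    rintro rfl rfl rfl rfl
    have r1' : (b1 :: (b2 :: r ++ [b0])) ~r Bs :=
      (List.isRotated_append (l := [b0]) (l' := b1 :: b2 :: r)).symm.trans h.rot
    have r2' : (b1 :: (c2 :: r1 ++ [c0])) ~r Bs :=
      (List.isRotated_append (l := [c0]) (l' := b1 :: c2 :: r1)).symm.trans h1.rot
    have := rot_cons_eq (r1'.trans r2'.symm)
      (List.Nodup.of_map _ (((r2'.perm.map Prod.snd).nodup_iff).2 h.sh.nodup))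
    simp only [List.cons_append, List.cons.injEq] at this
    have h3 := List.append_inj' this.2 rfl
    have hc : b0 = c0 := by simpa using h3.2
    subst hc
    have hsp := h.split.symm.trans h1.split
    have h4 := List.append_cancel_right hsp
    rw [h.eq, h1.eq, h4, h3.1, this.1]
  rcases hlen.2 with hg | ⟨hg, hl2⟩
  · have m1 := main [b1] b2 r rfl (by simp) (by simp only [bw_cons, bw_nil, List.append_nil, bk_len]; omega)
    have e1 : b1 = c1 := by simpa [List.cons_prefix_cons] using m1.2.2
    exact fin e1 m1.1 m1.2.1 (h.sh.uniq h1.sh (h.mem (by simp)) (h1.mem (by simp [e1])) hg)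
  · obtain ⟨q, Q, hq⟩ := List.exists_cons_of_ne_nil h.rne
    have m1 := main [b1, b2] q Q (by rw [hq]; rfl) (by simp)
      (by simp only [bw_cons, bw_nil, List.append_nil, bk_len, List.length_append] at htl ⊢; omega)
    have e1 : b1 = c1 ∧ b2 = c2 := by simpa [List.cons_prefix_cons] using m1.2.2
    exact fin e1.1 m1.1 m1.2.1 (h.sh.uniq h1.sh (h.mem (by simp)) (h1.mem (by simp [e1])) hg)

/-- a window contains two adjacent run letters -/
theorem yy (h : Win S y Bs w b0 b1 b2 r t t') {n : ℕ} (hn : w.length ≤ 24 * n) :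
    [(y, true), (y, true)] <:+: w.take n := by
  have hlen := h.sh.len h.rot
  have htl := h.tlen
  have aux : ∀ (pre suf : List (GenSym S.A × Bool)) (b : List (GenSym S.A × Bool) × ℕ), 2 ≤ b.2 →
      w = pre ++ bk (y, true) b ++ suf → 24 * (pre.length + (bk (y, true) b).length) ≤ w.length →
      [(y, true), (y, true)] <:+: w.take n := by
    intro pre suf b h2 he hl
    have : pre ++ bk (y, true) b <+: w.take n := by
      rw [List.prefix_take_iff]
      exact ⟨⟨suf, he.symm⟩, by simp only [List.length_append]; omega⟩
    refine List.IsInfix.trans ?_ this.isInfix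
    refine ⟨pre ++ b.1, List.replicate (b.2 - 2) (y, true), ?_⟩
    obtain ⟨j, hj⟩ : ∃ j, b.2 = 2 + j := ⟨b.2 - 2, by omega⟩
    simp [bk, hj, List.replicate_add, List.append_assoc, List.replicate_succ]
  rw [← h.length] at hlen
  rcases hlen.2 with hg | ⟨hg, hl2⟩
  · exact aux t _ b1 hg.1 (by rw [h.eq, bw_cons]; simp only [List.append_assoc]; rfl)
      (by rw [bk_len]; omega)
  · exact aux (t ++ bk (y, true) b1) _ b2 hg.1
      (by rw [h.eq, bw_cons, bw_cons]; simp only [List.append_assoc]; rfl)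
      (by rw [List.length_append, bk_len, bk_len]; omega)

theorem chain2 (h : Win S y Bs w b0 b1 b2 r t t') {R : GenSym S.A × Bool → GenSym S.A × Bool → Prop}
    (hY : R (y, true) (y, true))
    (hb : ∀ b ∈ Bs, (b.1 ++ [(y, true)]).IsChain R ∧ ∀ z ∈ b.1.head?, R (y, true) z) :
    (w ++ w).IsChain R := by
  have : w ~r bw (y, true) (b0 :: b1 :: b2 :: r) := by
    rw [h.eq, bw_cons (b := b0), h.split]
    have := List.isRotated_append (l := t ++ bw (y, true) (b1 :: b2 :: r)) (l' := t')
    simpa using this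
  refine rot_sq_chain this ?_
  rw [← bw_append, ← bw_append]
  refine List.IsChain.of_cons (isChain_bw hY (Y := (y, true)) ?_).1
  intro b hb'
  have hb' : b ∈ Bs := h.mem (by simp only [List.mem_append] at hb'; tauto)
  have := h.sh.blk b hb'
  exact ⟨this.1, (hb b hb').1, (hb b hb').2, this.2.2.1⟩

theorem red (h : Win S y Bs w b0 b1 b2 r t t') : IsReduced (w ++ w) := by
  refine h.chain2 (fun _ => rfl) ?_
  intro b hb
  have := h.sh.blk b hb
  refine ⟨?_, fun z hz he => absurd he.symm (this.2.2.2.2.1 z (List.mem_of_mem_head? hz))⟩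
  rw [List.isChain_append]
  refine ⟨this.2.2.2.1, by simp, ?_⟩
  intro x hx z hz he
  simp at hz
  subst hz
  exact absurd he (this.2.2.2.2.1 x (List.mem_of_getLast? hx))

theorem noYY (h : Win S y Bs w b0 b1 b2 r t t') {y1 : GenSym S.A} (hy : y1 ≠ y) (he : ¬ isElt y1) :
    ¬ [(y1, true), (y1, true)] <:+: w := by
  intro hc
  have : (w ++ w).IsChain (fun a b => ¬ (a = (y1, true) ∧ b = (y1, true))) := by
    refine h.chain2 (by simp [Ne.symm hy]) ?_
    intro b hb
    have := h.sh.blk b hb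
    refine ⟨?_, fun z hz => by simp [Ne.symm hy]⟩
    rw [List.isChain_append]
    refine ⟨?_, by simp, ?_⟩
    · rcases hl : b.1 with _ | ⟨z, Z⟩
      · simp
      · apply List.Pairwise.isChain
        rw [List.pairwise_cons]
        have hZ : ∀ a ∈ Z, a ≠ (y1, true) := by
          rintro a ha rfl
          exact he (this.2.2.2.2.2.2.1 (y1, true) (by rw [hl]; exact ha)).1
        refine ⟨fun a ha h => hZ a ha h.2, ?_⟩
        rw [List.pairwise_iff_forall_sublist]
        intro a b hab h
        exact hZ a (hab.subset (by simp)) h.1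
    · intro x hx z hz
      simp at hz
      subst hz
      simp [Ne.symm hy]
  have h3 := chain_inf this (hc.trans (List.prefix_append w w).isInfix)
  simp at h3

theorem letters (h : Win S y Bs w b0 b1 b2 r t t') :
    ∀ z ∈ w, z.2 = true ∨ isElt z.1 := by
  intro z hz
  have h1 : z ∈ bw (y, true) (b0 :: b1 :: b2 :: r) := by
    rw [h.eq] at hz
    rw [bw_cons, h.split]
    simp only [List.mem_append] at hz ⊢; tauto
  simp only [bw, List.mem_flatten, List.mem_map] at h1
  obtain ⟨l, ⟨b, hb, rfl⟩, hz⟩ := h1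
  have := h.sh.blk b (h.mem hb)
  simp only [bk, List.mem_append, List.mem_replicate] at hz
  rcases hz with hz | ⟨_, rfl⟩
  · by_cases h2 : z.2 = true
    · exact Or.inl h2
    · exact Or.inr (this.2.2.2.2.2.1 z hz (by simpa using h2))
  · exact Or.inl rfl

theorem run (h : Win S y Bs w b0 b1 b2 r t t') {n z} (hp : List.replicate n z <+: w) :
    n ≤ t.length + (bk (y, true) b1).length := by
  by_contra hc
  push Not at hc
  have hpre : t ++ bk (y, true) b1 <+: w := by
    rw [h.eq, bw_cons]; exact ⟨bw (y, true) (b2 :: r) ++ t', by simp⟩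
  have h2 : t ++ bk (y, true) b1 <+: List.replicate n z :=
    List.prefix_of_prefix_length_le hpre hp (by simp only [List.length_append, List.length_replicate]; omega)
  have hb := h.sh.blk b1 (h.mem (by simp))
  obtain ⟨a, Z, hz⟩ := List.exists_cons_of_ne_nil hb.1
  have e1 : a = z := List.eq_of_mem_replicate (h2.subset (show a ∈ _ by simp [bk, hz]))
  have e2 : (y, true) = z := List.eq_of_mem_replicate (h2.subset (show (y, true) ∈ _ by
    have := hb.2.2.1
    simp [bk]; omega))
  exact hb.2.1 (by rw [hz, e2, e1]; simp)

end Win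

theorem NP.rot {w w' : List (GenSym S.A × Bool)} (h : w ∈ NP S) (hr : w' ~r w) : w' ∈ NP S := by
  obtain ⟨y, Bs, h1, h2⟩ := h
  exact ⟨y, Bs, h1, hr.trans h2⟩

theorem NP.win {w : List (GenSym S.A × Bool)} (h : w ∈ NP S) :
    ∃ y Bs b0 b1 b2 r t t', Win S y Bs w b0 b1 b2 r t t' := by
  obtain ⟨y, Bs, h1, h2⟩ := h
  exact ⟨y, Bs, exists_win h1 h2⟩

/-- run bound -/
theorem NP.run {w : List (GenSym S.A × Bool)} (h : w ∈ NP S) {n z} (hp : List.replicate n z <:+: w) :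
    24 * n ≤ w.length := by
  obtain ⟨u, v, huv⟩ := hp
  have hr : (List.replicate n z ++ v ++ u) ~r w := by
    rw [← huv]
    have := List.isRotated_append (l := List.replicate n z ++ v) (l' := u)
    simpa using this
  obtain ⟨y, Bs, b0, b1, b2, r, t, t', hw⟩ := NP.win (NP.rot h hr)
  have h1 := hw.run (n := n) (z := z) ⟨v ++ u, by simp⟩
  have h2 := hw.bound
  rw [hr.perm.length_eq] at h2
  omega

theorem NP.prim {w : List (GenSym S.A × Bool)} (h : w ∈ NP S) {k : ℕ} (hk : w.rotate k = w)
    (hlt : k < w.length) : k = 0 := by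
  obtain ⟨y, Bs, h1, j, hj⟩ := h
  have hlen : (bw (y, true) Bs).length = w.length := by rw [← hj]; simp
  have hW : (bw (y, true) Bs).rotate k = bw (y, true) Bs := by
    rw [← hj, List.rotate_rotate, add_comm, ← List.rotate_rotate, hk]
  rw [List.rotate_eq_drop_append_take (by omega)] at hW
  have hs := List.take_append_drop k (bw (y, true) Bs)
  have hu : (List.take k (bw (y, true) Bs)).length = k := by simp; omega
  have hv : List.drop k (bw (y, true) Bs) ≠ [] := by simp; omega
  generalize List.drop k (bw (y, true) Bs) = v at *
  generalize List.take k (bw (y, true) Bs) = u at *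
  obtain ⟨B1, b, B2, t', t, e1, e2, e3, e4, e5⟩ := bw_split _ Bs u v hs.symm hv
  have hbb := h1.blk b (by rw [e1]; simp)
  obtain ⟨⟨s, i, ht, hs1, hi1, hi2, hi3⟩, ht'⟩ := suffix_shape e2 e3 hbb.2.1 hbb.2.2.1 hbb.1
  have h3 := h1.len3
  obtain ⟨c, C, hC⟩ : ∃ c C, Bs = c :: C := by
    cases Bs with
    | nil => simp at h3
    | cons c C => exact ⟨c, C, rfl⟩
  have hcc := h1.blk c (by rw [hC]; simp)
  have hCne : C ≠ [] := by rintro rfl; rw [hC] at h3; simp at h3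
  have hG := h1.good
  obtain ⟨c2, C2, hC2⟩ := List.exists_cons_of_ne_nil hCne
  have hcc2 := h1.blk c2 (by rw [hC, hC2]; simp)
  have hp : c.1 ++ List.replicate c.2 (y, true) ++ bw (y, true) C <+:
      s ++ List.replicate i (y, true) ++ (bw (y, true) (B2 ++ B1) ++ t') := by
    refine ⟨[], ?_⟩
    have := hW
    rw [e5, e4, ht] at this
    rw [bw_append]
    conv_rhs at this => rw [hC, bw_cons, bk]
    simpa using this.symm
  have hGC : GoodB (y, true) C := fun b hb => hG b (by rw [hC]; simp [hb])
  have hGB : GoodB (y, true) (B2 ++ B1) := fun b hb => hG b (by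
    rw [e1]; simp only [List.mem_append, List.mem_cons] at hb ⊢; tauto)
  have hh := head_bw hGC (r := []) (by simp)
  rw [List.append_nil] at hh
  have p := parse_one c.1 s c.2 i _ _ hcc.2.1 hs1 hcc.2.2.1 hi1 (by rw [hC2]; simp [bk, hcc2.1])
    hh (head_bw hGB ht') hp
  have hi : i = b.2 := hi3 (by rw [← p.1]; exact hcc.1)
  have hB1 : B1 = [] := by
    cases B1 with
    | nil => rfl
    | cons c' B1 =>
      exfalso
      have hnd := h1.nodup
      have : c = c' := by rw [hC] at e1; simp at e1; exact e1.1
      subst this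
      rw [e1] at hnd
      simp at hnd
      apply hnd.1.2.1
      rw [← hi, ← p.2.1]
  subst hB1
  have hcb : c = b := by rw [hC] at e1; simp at e1; exact e1.1
  subst hcb
  have : t' = [] := by
    have hl := congrArg List.length e2
    rw [ht, bk_len, ← p.1, hi] at hl
    simp at hl
    exact hl
  rw [← hu, e4, this]; simp

end rels

set_option linter.unusedSectionVars false
set_option linter.unusedVariables false

section smallc
open FreeGroup
variable {S : IndexedStructure}

/-- power words -/
def isPow (S : IndexedStructure) (p1 p2 : ℕ) (w : List (GenSym S.A × Bool)) : Prop :=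
  w = List.replicate p1 (.f1, true) ∨ w = List.replicate p2 (.f2, true)

theorem mem_RR {p1 p2 : ℕ} {w : List (GenSym S.A × Bool)} :
    w ∈ RR S p1 p2 ↔ w ∈ NP S ∨ isPow S p1 p2 w := by
  simp [RR, isPow]; tauto

theorem isPow.spec {p1 p2 : ℕ} (h1 : 10 ^ 10 < p1) (h2 : 10 ^ 10 < p2)
    {w : List (GenSym S.A × Bool)} (h : isPow S p1 p2 w) :
    ∃ p f, (f = .f1 ∨ f = .f2) ∧ 10 ^ 10 < p ∧ w = List.replicate p (f, true) := by
  rcases h with h | h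
  · exact ⟨p1, _, Or.inl rfl, h1, h⟩
  · exact ⟨p2, _, Or.inr rfl, h2, h⟩

theorem isPow.rot {p1 p2 : ℕ} {w w' : List (GenSym S.A × Bool)} (h : isPow S p1 p2 w)
    (hr : w' ~r w) : w' = w := by
  rcases h with rfl | rfl
  · obtain ⟨n, hn⟩ := hr.symm
    rw [← hn, List.rotate_replicate]
  · obtain ⟨n, hn⟩ := hr.symm
    rw [← hn, List.rotate_replicate]

theorem RR.rot {p1 p2 : ℕ} {w w' : List (GenSym S.A × Bool)} (h : w ∈ RR S p1 p2)
    (hr : w' ~r w) : w' ∈ RR S p1 p2 := by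
  rw [mem_RR] at *
  rcases h with h | h
  · exact Or.inl (NP.rot h hr)
  · right; rw [h.rot hr]; exact h

theorem bw_mem {β : Type*} {Y : β} {Bs : List (List β × ℕ)} {z : β} (h : z ∈ bw Y Bs) :
    ∃ b ∈ Bs, z ∈ b.1 ∨ z = Y := by
  simp only [bw, List.mem_flatten, List.mem_map] at h
  obtain ⟨l, ⟨b, hb, rfl⟩, hz⟩ := h
  simp only [bk, List.mem_append, List.mem_replicate] at hz
  exact ⟨b, hb, by tauto⟩

/-- only chains contain letters which are neither elements nor `b` -/
theorem Sh.chain_of_letter {y Bs} (h : Sh S y Bs) {z : GenSym S.A × Bool} (hz : z ∈ bw (y, true) Bs)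
    (he : ¬ isElt z.1) (hb : z.1 ≠ .b) : ∃ lo x, Ok lo x y ∧ Bs = chainBs lo x := by
  cases h with
  | chain lo x y h => exact ⟨lo, x, h, rfl⟩
  | rel m as Z0 e0 N hm h =>
    exfalso
    obtain ⟨b, hb', hz⟩ := bw_mem hz
    rcases hz with hz | rfl
    · rcases List.mem_cons.1 hb' with rfl | hb'
      · exact he ((h.props hm).2.1 z hz)
      · obtain ⟨k, hk, rfl⟩ := mem_stdBs hb'
        exact he (argW_mem hz).1
    · exact hb rfl

theorem Win.rotW {y : GenSym S.A} {Bs w b0 b1 b2 r t t'} (h : Win S y Bs w b0 b1 b2 r t t') :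
    w ~r bw (y, true) (b0 :: b1 :: b2 :: r) := by
  rw [h.eq, bw_cons (b := b0), h.split]
  have := List.isRotated_append (l := t ++ bw (y, true) (b1 :: b2 :: r)) (l' := t')
  simpa using this

theorem Win.memW {y : GenSym S.A} {Bs w b0 b1 b2 r t t'} (h : Win S y Bs w b0 b1 b2 r t t')
    {z} (hz : z ∈ w) : z ∈ bw (y, true) Bs := by
  have := h.rotW.mem_iff.1 hz
  obtain ⟨b, hb, hz⟩ : ∃ b ∈ (b0 :: b1 :: b2 :: r), z ∈ bk (y, true) b := by
    simp only [bw, List.mem_flatten, List.mem_map] at this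
    obtain ⟨l, ⟨b, hb, rfl⟩, hz⟩ := this
    exact ⟨b, hb, hz⟩
  simp only [bw, List.mem_flatten, List.mem_map]
  exact ⟨_, ⟨b, h.mem hb, rfl⟩, hz⟩

theorem f_ne {A : Type} {f : GenSym A} (hf : f = .f1 ∨ f = .f2) : ¬ isElt f ∧ f ≠ .b := by
  rcases hf with rfl | rfl <;> simp

/-- an absolute bound on runs of `f` -/
theorem NP.frun {w : List (GenSym S.A × Bool)} (h : w ∈ NP S) {f : GenSym S.A} {n : ℕ}
    (hf : f = .f1 ∨ f = .f2) (hp : List.replicate n (f, true) <+: w) : n ≤ 50000002 := by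
  by_cases hn : n = 0
  · omega
  obtain ⟨y, Bs, b0, b1, b2, r, t, t', hw⟩ := NP.win h
  have h1 := hw.run hp
  have hm : (f, true) ∈ w := hp.subset (by simp [hn])
  obtain ⟨lo, x, hok, hBs⟩ := hw.sh.chain_of_letter (hw.memW hm) (f_ne hf).1 (f_ne hf).2
  have htl := hw.tlen
  rw [bk_len] at h1
  obtain ⟨k0, hk0, e0⟩ := mem_chainBs (hBs ▸ hw.mem (b := b0) (by simp))
  obtain ⟨k1, hk1, e1⟩ := mem_chainBs (hBs ▸ hw.mem (b := b1) (by simp))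
  have hlo := hok.props.2.2.2
  have q0 : (lo + k0 + 1) ^ 2 ≤ 5000 ^ 2 := Nat.pow_le_pow_left (by omega) 2
  have q1 : (lo + k1 + 1) ^ 2 ≤ 5000 ^ 2 := Nat.pow_le_pow_left (by omega) 2
  rw [e0] at htl
  rw [e1] at h1
  simp only [List.length_singleton] at htl h1
  omega

theorem RR.letters {p1 p2 : ℕ} {w : List (GenSym S.A × Bool)} (h : w ∈ RR S p1 p2) :
    ∀ z ∈ w, z.2 = true ∨ isElt z.1 := by
  rcases mem_RR.1 h with h | h
  · obtain ⟨y, Bs, b0, b1, b2, r, t, t', hw⟩ := NP.win h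
    exact hw.letters
  · rcases h with rfl | rfl <;> intro z hz <;> rw [List.eq_of_mem_replicate hz] <;> simp

theorem RR.winpos {p1 p2 : ℕ} (h1 : 10 ^ 10 < p1) (h2 : 10 ^ 10 < p2)
    {w : List (GenSym S.A × Bool)} (h : w ∈ RR S p1 p2) {n : ℕ} (hn : w.length ≤ 24 * n) :
    ∃ z ∈ w.take n, z.2 = true ∧ ¬ isElt z.1 := by
  rcases mem_RR.1 h with h | h
  · obtain ⟨y, Bs, b0, b1, b2, r, t, t', hw⟩ := NP.win h
    exact ⟨(y, true), (hw.yy hn).subset (by simp), rfl, hw.sh.notElt⟩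
  · obtain ⟨p, f, hf, hp, rfl⟩ := h.spec h1 h2
    rw [List.length_replicate] at hn
    refine ⟨(f, true), ?_, rfl, (f_ne hf).1⟩
    rw [List.take_replicate, List.mem_replicate]
    exact ⟨by omega, rfl⟩

theorem RR.cyc {p1 p2 : ℕ} {w : List (GenSym S.A × Bool)} (h : w ∈ RR S p1 p2) :
    IsReduced (w ++ w) := by
  rcases mem_RR.1 h with h | h
  · obtain ⟨y, Bs, b0, b1, b2, r, t, t', hw⟩ := NP.win h
    exact hw.red
  · rcases h with rfl | rfl <;> rw [← List.replicate_add] <;>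
      exact List.isChain_replicate_of_rel _ (fun _ => rfl)

theorem cyc_of_sq {α : Type*} {w : List (α × Bool)} (h : IsReduced (w ++ w)) :
    IsCyclicallyReduced w := by
  have h' := List.isChain_append.1 h
  exact ⟨h'.1, fun a ha b hb => h'.2.2 a ha b hb⟩

theorem mem_invRev' {α : Type*} {w : List (α × Bool)} {z} :
    z ∈ invRev w ↔ (z.1, !z.2) ∈ w := by
  simp only [invRev, List.mem_reverse, List.mem_map]
  constructor
  · rintro ⟨a, ha, rfl⟩; simpa using ha
  · intro h; exact ⟨_, h, by simp⟩

theorem take_invRev {α : Type*} (w : List (α × Bool)) (n : ℕ) (hn : n ≤ w.length) :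
    (invRev w).take n = invRev (w.drop (w.length - n)) := by
  unfold invRev
  rw [List.take_reverse, List.length_map, List.map_drop]

theorem rr_smallC {p1 p2 : ℕ} (h1 : 10 ^ 10 < p1) (h2 : 10 ^ 10 < p2) : SmallC (RR S p1 p2) := by
  refine ⟨?_, ?_, ?_, ?_, ?_, ?_⟩
  · intro u v h
    exact RR.rot h List.isRotated_append
  · intro w hw; exact cyc_of_sq (RR.cyc hw)
  · intro w hw
    rcases mem_RR.1 hw with h | h
    · obtain ⟨y, Bs, b0, b1, b2, r, t, t', hw⟩ := NP.win h
      have := hw.bound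
      omega
    · obtain ⟨p, f, hf, hp, rfl⟩ := h.spec h1 h2
      rw [List.length_replicate]; omega
  · intro w hw w1 hw1 n hn hn1 he hl
    have key : ∀ w ∈ NP S, ∀ p f, (f = GenSym.f1 ∨ f = GenSym.f2) → 10 ^ 10 < p → ∀ n ≤ w.length,
        n ≤ p → w.take n = (List.replicate p (f, true)).take n →
        w.length ≤ 24 * n ∨ p ≤ 24 * n → False := by
      intro w hw p f hf hp n hn hnp he hl
      have hpre : List.replicate n (f, true) <+: w := by
        rw [List.prefix_iff_eq_take, List.length_replicate, he, List.take_replicate, min_eq_left hnp]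
      rcases hl with hl | hl
      · have := NP.run hw hpre.isInfix
        obtain ⟨y, Bs, b0, b1, b2, r, t, t', hw⟩ := NP.win hw
        have h3 := hw.bound
        have h4 := hw.run hpre
        omega
      · have := NP.frun hw hf hpre
        omega
    rcases mem_RR.1 hw with h | h <;> rcases mem_RR.1 hw1 with h' | h'
    · obtain ⟨y, Bs, b0, b1, b2, r, t, t', hW⟩ := NP.win h
      obtain ⟨y1, Bs1, c0, c1, c2, r1, u, u', hW1⟩ := NP.win h'
      by_cases hy : y = y1
      · subst hy
        exact hW.core hW1 hl he
      · exfalso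
        have := hW.yy hl
        rw [he] at this
        exact hW1.noYY hy hW.sh.notElt (this.trans (take_pre _ _).isInfix)
    · obtain ⟨p, f, hf, hp, rfl⟩ := h'.spec h1 h2
      exact (key w h p f hf hp n hn (by simpa using hn1) he (Or.inl hl)).elim
    · obtain ⟨p, f, hf, hp, rfl⟩ := h.spec h1 h2
      exact (key w1 h' p f hf hp n hn1 (by simpa using hn) he.symm (Or.inr (by simpa using hl))).elim
    · rcases h with rfl | rfl <;> rcases h' with rfl | rfl
      · rfl
      · exfalso
        rw [List.length_replicate] at hl hn hn1
        have := congrArg List.head? he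
        rw [List.take_replicate, List.take_replicate, List.head?_replicate, List.head?_replicate,
          if_neg (by omega), if_neg (by omega)] at this
        simp at this
      · exfalso
        rw [List.length_replicate] at hl hn hn1
        have := congrArg List.head? he
        rw [List.take_replicate, List.take_replicate, List.head?_replicate, List.head?_replicate,
          if_neg (by omega), if_neg (by omega)] at this
        simp at this
      · rfl
  · intro w hw w1 hw1 n hn hn1 he hl
    obtain ⟨z, hz, hz1, hz2⟩ := RR.winpos h1 h2 hw hl
    rw [he] at hz
    have := mem_invRev'.1 (List.mem_of_mem_take hz)
    rcases RR.letters hw1 _ this with h | h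
    · simp [hz1] at h
    · exact hz2 h
  · intro w hw w1 hw1 n hn hn1 he hl
    rw [take_invRev _ _ hn1] at he
    have hr : (w1.rotate (w1.length - n)) ~r w1 := (List.IsRotated.forall w1 _)
    obtain ⟨z, hz, hz1, hz2⟩ := RR.winpos (n := n) h1 h2 (RR.rot hw1 hr) (by simpa using hl)
    rw [List.rotate_eq_drop_append_take (by omega), List.take_append_of_le_length (by simp; omega)] at hz
    have hz := List.mem_of_mem_take hz
    have h3 : (z.1, !z.2) ∈ w := by
      apply List.mem_of_mem_take (i := n)
      rw [he, mem_invRev']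
      simpa using hz
    rcases RR.letters hw _ h3 with h | h
    · simp [hz1] at h
    · exact hz2 h

end smallc

set_option linter.unusedSectionVars false
set_option linter.unusedVariables false

section pres
open FreeGroup
variable {S : IndexedStructure}

theorem mk_app {α : Type*} (u w : List (α × Bool)) :
    FreeGroup.mk (u ++ w) = FreeGroup.mk u * FreeGroup.mk w := by
  rw [FreeGroup.mul_mk]

theorem mk_repl {α : Type*} (n : ℕ) (Y : α × Bool) :
    FreeGroup.mk (List.replicate n Y) = FreeGroup.mk [Y] ^ n := by
  induction n with
  | zero => rfl
  | succ n ih => rw [List.replicate_succ', mk_app, ih, pow_succ]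

theorem mk_bw {α : Type*} (Y : α × Bool) (Bs : List (List (α × Bool) × ℕ)) :
    FreeGroup.mk (bw Y Bs) = (Bs.map (fun b => FreeGroup.mk b.1 * FreeGroup.mk [Y] ^ b.2)).prod := by
  induction Bs with
  | nil => rfl
  | cons b Bs ih => rw [bw_cons, mk_app, ih, bk, mk_app, mk_repl]; rfl

theorem mk_chain {A : Type} (lo : ℕ) (x y : GenSym A) :
    FreeGroup.mk (bw (y, true) (chainBs lo x)) = chainProd lo (FreeGroup.of x) (FreeGroup.of y) := by
  rw [mk_bw, chainBs, chainProd, List.map_map]; rfl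

theorem mk_argW (m : ℕ) (as : Fin (S.arity m) → S.A) :
    FreeGroup.mk (argW S m as) = (List.ofFn (fun i => FreeGroup.of (GenSym.elt (as i)))).prod := by
  unfold argW
  have : ∀ L : List (GenSym S.A × Bool), FreeGroup.mk L = (L.map (fun z => FreeGroup.mk [z])).prod := by
    intro L
    induction L with
    | nil => rfl
    | cons a L ih => rw [← List.singleton_append, mk_app, ih]; rfl
  rw [this, List.map_ofFn]
  rfl

theorem wProd_eq (m : ℕ) (as : Fin (S.arity m) → S.A) :
    wProd m (fun i => FreeGroup.of (GenSym.elt (as i))) (FreeGroup.of GenSym.b) =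
      FreeGroup.mk (argW S m as) * FreeGroup.of GenSym.b ^ (100 * m + 1) *
        FreeGroup.mk (bw (GenSym.b, true) (stdBs (argW S m as) m 99)) := by
  unfold wProd
  rw [← mk_argW, List.range_succ_eq_map, List.map_cons, List.prod_cons, mk_bw, stdBs, List.map_map,
    List.map_map]
  congr 2

theorem rel_conj {m : ℕ} {as : Fin (S.arity m) → S.A} {Z0 e0 N} (h : RelOk S m as Z0 e0 N) :
    (¬ S.isFunc m ∧ S.relInterp m as ∧ IsConj
      (wProd m (fun i => FreeGroup.of (GenSym.elt (as i))) (FreeGroup.of GenSym.b))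
      (FreeGroup.mk (bw (GenSym.b, true) ((Z0, e0) :: stdBs (argW S m as) m N)))) ∨
    (S.isFunc m ∧ IsConj
      (wProd m (fun i => FreeGroup.of (GenSym.elt (as i))) (FreeGroup.of GenSym.b) *
        (FreeGroup.of (GenSym.elt (S.funcInterp m as)))⁻¹)
      (FreeGroup.mk (bw (GenSym.b, true) ((Z0, e0) :: stdBs (argW S m as) m N)))) := by
  have hb : (FreeGroup.mk [(GenSym.b, true)] : FreeGroup (GenSym S.A)) = FreeGroup.of .b := rfl
  have hc : ∀ x y : FreeGroup (GenSym S.A), IsConj (x * y) (y * x) := fun x y =>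
    isConj_iff.2 ⟨y, by group⟩
  cases h with
  | rel h1 h2 =>
    refine Or.inl ⟨h1, h2, ?_⟩
    rw [wProd_eq, bw_cons, mk_app, bk, mk_app, mk_repl, hb]
  | neg h1 h2 =>
    refine Or.inr ⟨h1, ?_⟩
    refine (hc _ _).trans ?_
    rw [wProd_eq, bw_cons, mk_app, bk, mk_app, mk_repl, hb]
    have : FreeGroup.mk ((GenSym.elt (S.funcInterp m as), false) :: argW S m as) =
        (FreeGroup.of (GenSym.elt (S.funcInterp m as)))⁻¹ * FreeGroup.mk (argW S m as) := by
      rw [← List.singleton_append, mk_app]; rfl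
    simp only [this, mul_assoc]
    exact IsConj.refl _
  | canc z T h1 h2 =>
    refine Or.inr ⟨h1, ?_⟩
    refine (hc _ _).trans ?_
    rw [wProd_eq, bw_cons, mk_app, bk, mk_app, mk_repl, hb]
    have : FreeGroup.mk (argW S m as) =
        (FreeGroup.of (GenSym.elt (S.funcInterp m as))) * FreeGroup.mk (z :: T) := by
      rw [h2, ← List.singleton_append, mk_app]; rfl
    rw [this]
    simp only [mul_assoc, inv_mul_cancel_left]
    exact IsConj.refl _
  | merge h1 h2 =>
    refine Or.inr ⟨h1, ?_⟩
    refine (hc _ _).trans ?_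
    have e : stdBs (argW S m as) m 99 = stdBs (argW S m as) m 98 ++ [(argW S m as, 100 * m + 100)] := by
      rw [stdBs, List.range_succ, List.map_append]; rfl
    rw [wProd_eq, e, bw_append, mk_app, bw_cons, mk_app, bk, mk_app, mk_repl, hb, bw_nil, bw_cons, mk_app,
      bk, mk_app, mk_repl, hb, show FreeGroup.mk ([] : List (GenSym S.A × Bool)) = 1 from rfl, mul_one]
    have : FreeGroup.mk (argW S m as) = FreeGroup.of (GenSym.elt (S.funcInterp m as)) := by
      rw [h2]; rfl
    generalize FreeGroup.mk (bw (GenSym.b, true) (stdBs (argW S m as) m 98)) = P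
    rw [this]
    generalize FreeGroup.of (GenSym.elt (S.funcInterp m as)) = a
    have e2 : a⁻¹ * (a * FreeGroup.of GenSym.b ^ (100 * m + 1) * (P * (a * FreeGroup.of GenSym.b ^ (100 * m + 100))))
      = (FreeGroup.of GenSym.b ^ (100 * m + 1) * P) * (a * FreeGroup.of GenSym.b ^ (100 * m + 100)) := by
      group
    have e3 : a * FreeGroup.of GenSym.b ^ (200 * m + 101) * P =
       (a * FreeGroup.of GenSym.b ^ (100 * m + 100)) * (FreeGroup.of GenSym.b ^ (100 * m + 1) * P) := by
      rw [show 200 * m + 101 = (100 * m + 100) + (100 * m + 1) by ring, pow_add]; group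
    rw [e2, e3]
    exact hc _ _

theorem RelOk.exists (m : ℕ) (as : Fin (S.arity m) → S.A) (h : S.isFunc m ∨ S.relInterp m as) :
    ∃ Z e N, RelOk S m as Z e N := by
  by_cases hf : S.isFunc m
  · by_cases hh : ∃ T, argW S m as = (.elt (S.funcInterp m as), true) :: T
    · obtain ⟨T, hT⟩ := hh
      cases T with
      | nil => exact ⟨_, _, _, .merge hf hT⟩
      | cons z T => exact ⟨_, _, _, .canc z T hf hT⟩
    · push Not at hh
      exact ⟨_, _, _, .neg hf hh⟩
  · exact ⟨_, _, _, .rel hf (h.resolve_left hf)⟩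

theorem Sh.conj {y Bs} (h : Sh S y Bs) (p1 p2 : ℕ) :
    ∃ r ∈ grpRels S p1 p2, IsConj r (FreeGroup.mk (bw (y, true) Bs)) := by
  cases h with
  | chain lo x y h =>
    refine ⟨_, ?_, by rw [mk_chain]⟩
    unfold grpRels
    cases h with
    | ac a => left; left; right; exact ⟨a, Or.inl rfl⟩
    | ad a => left; left; right; exact ⟨a, Or.inr rfl⟩
    | _ => left; left; left; simp
  | rel m as Z0 e0 N hm h =>
    rcases rel_conj h with ⟨h1, h2, h3⟩ | ⟨h1, h3⟩
    · exact ⟨_, Or.inr ⟨m, hm, h1, as, h2, rfl⟩, h3⟩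
    · exact ⟨_, Or.inl (Or.inr ⟨m, hm, h1, as, rfl⟩), h3⟩

theorem grpRels_conj {p1 p2 : ℕ} {r : FreeGroup (GenSym S.A)} (h : r ∈ grpRels S p1 p2) :
    ∃ w ∈ RR S p1 p2, IsConj r (FreeGroup.mk w) := by
  have np : ∀ {y Bs}, Sh S y Bs → bw (y, true) Bs ∈ RR S p1 p2 := fun h =>
    Or.inl ⟨_, _, h, List.IsRotated.refl _⟩
  have ch : ∀ {lo x y}, Ok lo x y → ∃ w ∈ RR S p1 p2,
      IsConj (chainProd lo (FreeGroup.of x) (FreeGroup.of y)) (FreeGroup.mk w) := fun {lo x y} h =>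
    ⟨_, np (.chain lo x y h), (mk_chain lo x y) ▸ IsConj.refl _⟩
  rcases h with ((h | ⟨a, h | h⟩) | ⟨m, hm, h1, as, h⟩) | ⟨m, hm, h1, as, h2, h⟩
  · simp only [Set.mem_insert_iff, Set.mem_singleton_iff] at h
    rcases h with h | h | h | h | h | h | h | h | h | h
    · exact ⟨_, Or.inr (Or.inl rfl), by rw [h, mk_repl]; exact IsConj.refl _⟩
    · exact ⟨_, Or.inr (Or.inr rfl), by rw [h, mk_repl]; exact IsConj.refl _⟩
    · rw [h]; exact ch .v1
    · rw [h]; exact ch .v2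
    · rw [h]; exact ch .b1
    · rw [h]; exact ch .b2
    · rw [h]; exact ch .c1
    · rw [h]; exact ch .c2
    · rw [h]; exact ch .d1
    · rw [h]; exact ch .d2
  · rw [h]; exact ch (.ac a)
  · rw [h]; exact ch (.ad a)
  · rw [h]; obtain ⟨Z, e, N, h⟩ := RelOk.exists m as (Or.inl h1)
    rcases rel_conj h with ⟨h1', h2, h3⟩ | ⟨_, h3⟩
    · exact absurd h1 h1'
    · exact ⟨_, np (.rel m as Z e N hm h), h3⟩
  · rw [h]; obtain ⟨Z, e, N, h⟩ := RelOk.exists m as (Or.inr h2)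
    rcases rel_conj h with ⟨h1', h2, h3⟩ | ⟨h1', h3⟩
    · exact ⟨_, np (.rel m as Z e N hm h), h3⟩
    · exact absurd h1' h1

theorem rot_conj {α : Type*} {w w' : List (α × Bool)} (h : w ~r w') :
    IsConj (FreeGroup.mk w) (FreeGroup.mk w') := by
  obtain ⟨n, hn', h⟩ := List.isRotated_iff_mod.1 h
  rw [List.rotate_eq_drop_append_take hn'] at h
  have hs := List.take_append_drop n w
  rw [← h, mk_app]
  conv_lhs => rw [← hs, mk_app]
  exact isConj_iff.2 ⟨(FreeGroup.mk (List.take n w))⁻¹, by group⟩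

theorem RR_conj {p1 p2 : ℕ} {w} (h : w ∈ RR S p1 p2) :
    ∃ r ∈ grpRels S p1 p2, IsConj r (FreeGroup.mk w) := by
  rcases mem_RR.1 h with ⟨y, Bs, h, hr⟩ | h | h
  · obtain ⟨r, h1, h2⟩ := h.conj p1 p2
    exact ⟨r, h1, h2.trans (rot_conj hr.symm)⟩
  · refine ⟨FreeGroup.of .f1 ^ p1, by unfold grpRels; left; left; left; simp, ?_⟩
    rw [h, mk_repl]; exact IsConj.refl _
  · refine ⟨FreeGroup.of .f2 ^ p2, by unfold grpRels; left; left; left; simp, ?_⟩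
    rw [h, mk_repl]; exact IsConj.refl _

/-- the value of a word in `G(𝒜)` -/
def val (S : IndexedStructure) (p1 p2 : ℕ) (w : List (GenSym S.A × Bool)) : GA S p1 p2 :=
  PresentedGroup.mk (grpRels S p1 p2) (FreeGroup.mk w)

theorem val_append (p1 p2 : ℕ) (u w : List (GenSym S.A × Bool)) :
    val S p1 p2 (u ++ w) = val S p1 p2 u * val S p1 p2 w := by
  unfold val; rw [mk_app, _root_.map_mul]

theorem val_nil (p1 p2 : ℕ) : val S p1 p2 [] = 1 := by
  unfold val; exact _root_.map_one _

theorem val_invRev (p1 p2 : ℕ) (u : List (GenSym S.A × Bool)) :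
    val S p1 p2 (invRev u) = (val S p1 p2 u)⁻¹ := by
  unfold val; rw [← FreeGroup.inv_mk, _root_.map_inv]

theorem val_rel {p1 p2 : ℕ} {w} (h : w ∈ RR S p1 p2 ∨ invRev w ∈ RR S p1 p2) : val S p1 p2 w = 1 := by
  have key : ∀ w ∈ RR S p1 p2, val S p1 p2 w = 1 := by
    intro w h
    obtain ⟨r, h1, h2⟩ := RR_conj h
    obtain ⟨c, hc⟩ := isConj_iff.1 h2
    have hr : PresentedGroup.mk (grpRels S p1 p2) r = 1 := PresentedGroup.one_of_mem h1
    unfold val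
    rw [← hc, _root_.map_mul, _root_.map_mul, hr, _root_.map_inv]; simp
  rcases h with h | h
  · exact key w h
  · have := key _ h
    rw [val_invRev] at this
    simpa using this

theorem val_surj (p1 p2 : ℕ) (x : GA S p1 p2) : ∃ w, IsReduced w ∧ val S p1 p2 w = x := by
  classical
  obtain ⟨g, rfl⟩ := PresentedGroup.mk_surjective _ x
  exact ⟨g.toWord, isReduced_toWord, by unfold val; rw [mk_toWord]⟩

/-- Dehn: a nonempty reduced word which is trivial contains most of a relator. -/
theorem dehn {p1 p2 : ℕ} (h1 : 10 ^ 10 < p1) (h2 : 10 ^ 10 < p2) {n : List (GenSym S.A × Bool)}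
    (hr : IsReduced n) (hne : n ≠ []) (hn : val S p1 p2 n = 1) :
    ∃ w, (w ∈ RR S p1 p2 ∨ invRev w ∈ RR S p1 p2) ∧ ∃ k, k ≤ w.length ∧ 5 * w.length ≤ 6 * k ∧
      w.take k <:+: n := by
  classical
  have hw : (FreeGroup.mk n).toWord = n := toWord_mk_red hr
  have hmem : FreeGroup.mk n ∈ Subgroup.normalClosure (grpRels S p1 p2) := by
    have : PresentedGroup.mk (grpRels S p1 p2) (FreeGroup.mk n) = 1 := hn
    exact PresentedGroup.mk_eq_one_iff.1 this
  have hle : Subgroup.normalClosure (grpRels S p1 p2) ≤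
      Subgroup.normalClosure (FreeGroup.mk '' (RR S p1 p2)) := by
    apply Subgroup.normalClosure_le_normal
    intro r hr
    obtain ⟨w, hw, hc⟩ := grpRels_conj hr
    obtain ⟨c, hc⟩ := isConj_iff.1 hc.symm
    rw [← hc]
    have hm : FreeGroup.mk w ∈ Subgroup.normalClosure (FreeGroup.mk '' (RR S p1 p2)) :=
      Subgroup.subset_normalClosure ⟨w, hw, rfl⟩
    exact Subgroup.normalClosure_normal.conj_mem _ hm _
  have := greendlinger (rr_smallC h1 h2) (hle hmem) (by
    intro h0; rw [h0] at hw; simp at hw; exact hne hw)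
  rwa [hw] at this

end pres

set_option linter.unusedSectionVars false
set_option linter.unusedVariables false

section sym
open FreeGroup
variable {S : IndexedStructure} {p1 p2 : ℕ}

theorem invRev_app {α : Type*} (u v : List (α × Bool)) : invRev (u ++ v) = invRev v ++ invRev u := by
  simp [invRev]

theorem invRev_repl {α : Type*} (n : ℕ) (z : α × Bool) :
    invRev (List.replicate n z) = List.replicate n (z.1, !z.2) := by
  simp [invRev]

/-- symmetrized set of nonpower relators -/
def NPs (S : IndexedStructure) (w : List (GenSym S.A × Bool)) : Prop := w ∈ NP S ∨ invRev w ∈ NP S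

def Rs (S : IndexedStructure) (p1 p2 : ℕ) (w : List (GenSym S.A × Bool)) : Prop :=
  w ∈ RR S p1 p2 ∨ invRev w ∈ RR S p1 p2

theorem Rs.cases {w : List (GenSym S.A × Bool)} (h : Rs S p1 p2 w) :
    NPs S w ∨ ∃ f s p, ((f = GenSym.f1 ∧ p = p1) ∨ (f = GenSym.f2 ∧ p = p2)) ∧
      w = List.replicate p (f, s) := by
  have key : ∀ v : List (GenSym S.A × Bool), isPow S p1 p2 v → ∃ f p,
      ((f = GenSym.f1 ∧ p = p1) ∨ (f = GenSym.f2 ∧ p = p2)) ∧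
      v = List.replicate p (f, true) := by
    rintro v (h | h)
    · exact ⟨.f1, p1, Or.inl ⟨rfl, rfl⟩, h⟩
    · exact ⟨.f2, p2, Or.inr ⟨rfl, rfl⟩, h⟩
  rcases h with h | h <;> rcases mem_RR.1 h with h | h
  · exact Or.inl (Or.inl h)
  · obtain ⟨f, p, hf, h⟩ := key _ h
    exact Or.inr ⟨f, true, p, hf, h⟩
  · exact Or.inl (Or.inr h)
  · obtain ⟨f, p, hf, h⟩ := key _ h
    right
    refine ⟨f, false, p, hf, ?_⟩
    have := congrArg invRev h
    rw [invRev_invRev, invRev_repl] at this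
    exact this

theorem NPs.run {w : List (GenSym S.A × Bool)} (h : NPs S w) {n z} (hp : List.replicate n z <:+: w) :
    24 * n ≤ w.length := by
  rcases h with h | h
  · exact NP.run h hp
  · obtain ⟨u, v, rfl⟩ := hp
    have := NP.run h (n := n) (z := (z.1, !z.2)) ⟨invRev v, invRev u, by
      rw [invRev_app, invRev_app, invRev_repl, List.append_assoc]⟩
    rwa [invRev_length] at this

theorem NP.comm {u v : List (GenSym S.A × Bool)} (h : u ++ v ∈ NP S) (hc : u ++ v = v ++ u) :
    u = [] ∨ v = [] := by
  by_cases hv : v = []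
  · exact Or.inr hv
  left
  have := List.length_pos_iff.2 hv
  have := NP.prim h (k := u.length) (by rw [List.rotate_append_length_eq]; exact hc.symm)
    (by simp; omega)
  simpa using this

theorem NPs.piece (h1 : 10 ^ 10 < p1) (h2 : 10 ^ 10 < p2) {w T a1 a2 c1 c2 : List (GenSym S.A × Bool)} (h : NPs S w)
    (e1 : w = a1 ++ T ++ c1) (e2 : w = a2 ++ T ++ c2) (hne : a1.length < a2.length) :
    24 * T.length < w.length := by
  by_contra hc
  push Not at hc
  have hsc := rr_smallC (S := S) h1 h2
  have rot : ∀ {u v : List (GenSym S.A × Bool)}, u ++ v ∈ NP S → v ++ u ∈ NP S :=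
    fun h => NP.rot h List.isRotated_append
  have hin : ∀ {u}, u ∈ NP S → u ∈ RR S p1 p2 := fun h => Or.inl h
  have l1 := congrArg List.length e1
  have l2 := congrArg List.length e2
  simp only [List.length_append] at l1 l2
  have eq : c1 ++ a1 = c2 ++ a2 := by
    rcases h with h | h
    · have q1 : T ++ (c1 ++ a1) ∈ NP S := by
        have := rot (u := a1) (v := T ++ c1) (by rw [e1] at h; simpa using h)
        simpa using this
      have q2 : T ++ (c2 ++ a2) ∈ NP S := by
        have := rot (u := a2) (v := T ++ c2) (by rw [e2] at h; simpa using h)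
        simpa using this
      have := hsc.sc _ (hin q1) _ (hin q2) T.length (by simp) (by simp) (by simp)
        (by simp only [List.length_append]; omega)
      exact List.append_cancel_left this
    · have q1 : invRev T ++ invRev (c1 ++ a1) ∈ NP S := by
        have := rot (u := invRev c1) (v := invRev T ++ invRev a1) (by
          rw [e1, invRev_app, invRev_app] at h; exact h)
        rw [invRev_app]; simpa using this
      have q2 : invRev T ++ invRev (c2 ++ a2) ∈ NP S := by
        have := rot (u := invRev c2) (v := invRev T ++ invRev a2) (by
          rw [e2, invRev_app, invRev_app] at h; exact h)
        rw [invRev_app]; simpa using this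
      have := hsc.sc _ (hin q1) _ (hin q2) T.length (by simp) (by simp) (by simp)
        (by simp only [List.length_append, invRev_length]; omega)
      exact invRev_injective (List.append_cancel_left this)
  -- now `a2 = a1 ++ d`
  obtain ⟨d, hd⟩ : ∃ d, a2 = a1 ++ d := by
    have p1 : a1 <+: w := ⟨T ++ c1, by rw [e1]; simp⟩
    have p2 : a2 <+: w := ⟨T ++ c2, by rw [e2]; simp⟩
    obtain ⟨d, hd⟩ := List.prefix_of_prefix_length_le p1 p2 hne.le
    exact ⟨d, hd.symm⟩
  have hdne : d ≠ [] := by rintro rfl; simp [hd] at hne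
  subst hd
  have e3 : T ++ c1 = d ++ (T ++ c2) := by
    have := e1.symm.trans e2
    simpa using this
  -- the rotated word `d ++ (T ++ c2) ++ a1 = (T ++ c2 ++ a1) ++ d`
  have e4 : d ++ (T ++ c2 ++ a1) = (T ++ c2 ++ a1) ++ d := by
    have : T ++ (c1 ++ a1) = T ++ (c2 ++ (a1 ++ d)) := by rw [eq]
    rw [← List.append_assoc, e3] at this
    simpa using this
  rcases h with h | h
  · have q : d ++ (T ++ c2 ++ a1) ∈ NP S := by
      have := rot (u := a1) (v := d ++ (T ++ c2)) (by rw [e2] at h; simpa using h)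
      simpa using this
    rcases NP.comm q e4 with hh | hh
    · exact hdne hh
    · have : (T ++ c2 ++ a1).length = 0 := by rw [hh]; rfl
      simp only [List.length_append] at this
      have := List.length_pos_iff.2 hdne
      simp only [List.length_append] at l2
      omega
  · have q : invRev (T ++ c2 ++ a1) ++ invRev d ∈ NP S := by
      have h' : invRev (d ++ (T ++ c2)) ++ invRev a1 ∈ NP S := by
        rw [← invRev_app]; rw [e2] at h; simpa using h
      have := rot h'
      rw [← invRev_app] at this ⊢
      simpa using this
    rcases NP.comm q (by rw [← invRev_app, ← invRev_app, e4]) with hh | hh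
    · have : (T ++ c2 ++ a1).length = 0 := by rw [← invRev_length, hh]; rfl
      simp only [List.length_append] at this
      have := List.length_pos_iff.2 hdne
      simp only [List.length_append] at l2
      omega
    · have := congrArg List.length hh
      rw [invRev_length] at this
      exact hdne (List.length_eq_zero_iff.1 this)

theorem Rs.len (h1 : 10 ^ 10 < p1) (h2 : 10 ^ 10 < p2) {w : List (GenSym S.A × Bool)}
    (h : Rs S p1 p2 w) : 24 ≤ w.length := by
  rcases h with h | h
  · exact (rr_smallC h1 h2).len _ h
  · have := (rr_smallC h1 h2).len _ h
    rwa [invRev_length] at this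

/-- an infix of a power is controlled by a rotation of the base -/
theorem per_inf {β : Type*} {y s : List β} {p : ℕ} (h : s <:+: (List.replicate p y).flatten) :
    ∃ y', y' ~r y ∧ (s.length ≤ y.length → s <+: y') ∧
      (y.length ≤ s.length → y' <+: s ∧ s.drop y.length <+: s) := by
  have step1 : ∃ y' q, y' ~r y ∧ s <+: (List.replicate q y').flatten := by
    clear * - h
    obtain ⟨u, v, h⟩ := h
    induction p generalizing u with
    | zero =>
      simp at h
      exact ⟨y, 0, List.IsRotated.refl _, by simp [h.2.1]⟩
    | succ p ih =>
      rw [List.replicate_succ, List.flatten_cons, List.append_assoc, List.append_eq_append_iff] at h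
      rcases h with ⟨x, h3, h4⟩ | ⟨x, h3, h4⟩
      · refine ⟨x ++ u, p + 1, ?_, ?_⟩
        · rw [h3]; exact List.isRotated_append
        · have e : (List.replicate (p + 1) (x ++ u)).flatten =
              x ++ (List.replicate p y).flatten ++ u := by
            rw [h3]
            clear * -
            induction p with
            | zero => simp
            | succ p ih => rw [List.replicate_succ, List.flatten_cons, ih, List.replicate_succ,
                List.flatten_cons]; simp
          rw [e, ← h4]
          exact ⟨v ++ u, by simp⟩
      · obtain ⟨y', q, h5, h6⟩ := ih x (by rw [h4]; simp)
        exact ⟨y', q, h5, h6⟩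
  obtain ⟨y', q, h1, h2⟩ := step1
  have hl := h1.perm.length_eq
  cases q with
  | zero =>
    simp at h2
    subst h2
    refine ⟨y', h1, by simp, ?_⟩
    intro h
    have : y' = [] := List.length_eq_zero_iff.1 (by simp at h; simp [hl, h])
    simp [this]
  | succ q =>
    rw [List.replicate_succ, List.flatten_cons] at h2
    refine ⟨y', h1, fun h => List.prefix_of_prefix_length_le h2 (List.prefix_append _ _) (by omega), ?_⟩
    intro h
    obtain ⟨s', hs'⟩ := List.prefix_of_prefix_length_le (List.prefix_append y' _) h2 (by omega)
    refine ⟨⟨s', hs'⟩, ?_⟩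
    rw [← hl, ← hs', List.drop_left]
    rw [← hs', List.prefix_append_right_inj] at h2
    have h3 : s' <+: y' ++ (List.replicate q y').flatten := by
      refine h2.trans ⟨y', ?_⟩
      rw [← List.flatten_cons, ← List.replicate_succ, List.replicate_succ', List.flatten_append]
      simp
    refine List.prefix_of_prefix_length_le h3 ?_ (by simp)
    rwa [List.prefix_append_right_inj]

end sym

set_option linter.unusedSectionVars false
set_option linter.unusedVariables false

section sgn
open FreeGroup
variable {S : IndexedStructure} {p1 p2 : ℕ}

theorem countP_bw_pos {A : Type} {Y : GenSym A × Bool} {Bs : List (List (GenSym A × Bool) × ℕ)}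
    (h : ∀ z ∈ bw Y Bs, z.2 = true) : (bw Y Bs).countP (fun z => !z.2) = 0 := by
  rw [List.countP_eq_zero]
  intro z hz
  simp [h z hz]

theorem Sh.neg_le {y Bs} (h : Sh S y Bs) : (bw (y, true) Bs).countP (fun z => !z.2) ≤ 1 := by
  cases h with
  | chain lo x y h =>
    rw [countP_bw_pos]
    · omega
    intro z hz
    obtain ⟨b, hb, hz⟩ := bw_mem hz
    obtain ⟨k, hk, rfl⟩ := mem_chainBs hb
    rcases hz with hz | rfl
    · simp at hz; rw [hz]
    · rfl
  | rel m as Z0 e0 N hm h =>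
    rw [bw_cons, List.countP_append, countP_bw_pos (Bs := stdBs _ _ _), bk, List.countP_append]
    · have e : (List.replicate e0 ((GenSym.b : GenSym S.A), true)).countP (fun z => !z.2) = 0 := by
        rw [List.countP_eq_zero]
        intro z hz
        rw [List.eq_of_mem_replicate hz]; simp
      simp only [e, add_zero]
      have ha : (argW S m as).countP (fun z => !z.2) = 0 := by
        rw [List.countP_eq_zero]
        intro z hz
        simp [(argW_mem hz).2]
      cases h with
      | rel => omega
      | neg => rw [List.countP_cons]; simp [ha]
      | canc z T h1 h2 =>
        rw [h2, List.countP_cons] at ha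
        simp only at ha ⊢
        omega
      | merge => omega
    · intro z hz
      obtain ⟨b, hb, hz⟩ := bw_mem hz
      obtain ⟨k, hk, rfl⟩ := mem_stdBs hb
      rcases hz with hz | rfl
      · exact (argW_mem hz).2
      · rfl

theorem RR.neg_le {w} (h : w ∈ RR S p1 p2) : w.countP (fun z => !z.2) ≤ 1 := by
  rcases mem_RR.1 h with ⟨y, Bs, h, hr⟩ | h
  · rw [hr.perm.countP_eq]; exact h.neg_le
  · have : w.countP (fun z => !z.2) = 0 := by
      rw [List.countP_eq_zero]
      intro z hz
      rcases h with h | h <;> rw [h] at hz <;> rw [List.eq_of_mem_replicate hz] <;> simp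
    omega

theorem countP_invRev {α : Type*} (w : List (α × Bool)) :
    (invRev w).countP (fun z => !z.2) = w.countP (fun z => z.2) := by
  unfold invRev
  rw [List.countP_reverse, List.countP_map]
  congr 1; funext z; simp

theorem Rs.fold {w u m : List (GenSym S.A × Bool)} (h : Rs S p1 p2 w)
    (hu : (invRev u ++ m ++ u) <:+: w) : u.length ≤ 1 := by
  have hl : ∀ u : List (GenSym S.A × Bool),
      u.length = u.countP (fun z => z.2) + u.countP (fun z => !z.2) := by
    intro u
    rw [List.length_eq_countP_add_countP (fun z : GenSym S.A × Bool => z.2)]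
    simp
  have hc : ∀ P : GenSym S.A × Bool → Bool, (invRev u ++ m ++ u).countP P ≤ w.countP P :=
    fun P => hu.sublist.countP_le
  have h1 := hc (fun z => z.2)
  have h2 := hc (fun z => !z.2)
  have e := countP_invRev u
  have e' := countP_invRev (invRev u)
  rw [invRev_invRev] at e'
  simp only [List.countP_append] at h1 h2
  have := hl u
  rcases h with h | h
  · have := RR.neg_le h; omega
  · have := RR.neg_le h; rw [countP_invRev] at this; omega

theorem RR.pos_f {w} (h : w ∈ RR S p1 p2) {f : GenSym S.A} {s} (hf : f = .f1 ∨ f = .f2)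
    (hm : (f, s) ∈ w) : ∀ z ∈ w, z.2 = true := by
  rcases mem_RR.1 h with ⟨y, Bs, h, hr⟩ | h
  · obtain ⟨lo, x, hok, hB⟩ := h.chain_of_letter (z := (f, s)) (hr.mem_iff.1 hm) (f_ne hf).1 (f_ne hf).2
    intro z hz
    have hz := hr.mem_iff.1 hz
    rw [hB] at hz
    obtain ⟨b, hb, hz⟩ := bw_mem hz
    obtain ⟨k, hk, rfl⟩ := mem_chainBs hb
    rcases hz with hz | rfl
    · simp at hz; rw [hz]
    · rfl
  · intro z hz
    rcases h with h | h <;> rw [h] at hz <;> rw [List.eq_of_mem_replicate hz]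

theorem Rs.sign_f {w} (h : Rs S p1 p2 w) {f : GenSym S.A} {s} (hf : f = .f1 ∨ f = .f2)
    (hm : (f, s) ∈ w) : ∀ z ∈ w, z.2 = s := by
  rcases h with h | h
  · intro z hz
    rw [RR.pos_f h hf hm z hz, ← RR.pos_f h hf hm _ hm]
  · have hm' : (f, !s) ∈ invRev w := by rw [mem_invRev']; simpa using hm
    intro z hz
    have a := RR.pos_f h hf hm' (z.1, !z.2) (by rw [mem_invRev']; simpa using hz)
    have b := RR.pos_f h hf hm' _ hm'
    simp at a b
    rw [a, b]

theorem dehn' (h1 : 10 ^ 10 < p1) (h2 : 10 ^ 10 < p2) {n : List (GenSym S.A × Bool)}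
    (hr : IsReduced n) (hne : n ≠ []) (hn : val S p1 p2 n = 1) :
    ∃ s v, Rs S p1 p2 (s ++ v) ∧ 5 * v.length ≤ s.length ∧ s <:+: n := by
  obtain ⟨w, hw, k, hk, hk', hi⟩ := dehn h1 h2 hr hne hn
  refine ⟨w.take k, w.drop k, ?_, ?_, hi⟩
  · rw [List.take_append_drop]; exact hw
  · simp only [List.length_take, List.length_drop]; omega

theorem Rs.val {s v} (h : Rs S p1 p2 (s ++ v)) : val S p1 p2 s = (val S p1 p2 v)⁻¹ := by
  have := val_rel h
  rw [val_append] at this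
  exact eq_inv_of_mul_eq_one_left this

/-- words of minimal length with value in a conjugation invariant set -/
structure MinC (K : GA S p1 p2 → Prop) (y : List (GenSym S.A × Bool)) : Prop where
  hK : K (val S p1 p2 y)
  min : ∀ y', K (val S p1 p2 y') → y.length ≤ y'.length

theorem exists_minC {K : GA S p1 p2 → Prop} (hx : ∃ x, K x) : ∃ y, MinC K y := by
  classical
  have : ∃ n, ∃ y : List (GenSym S.A × Bool), y.length = n ∧ K (val S p1 p2 y) := by
    obtain ⟨x, hx⟩ := hx
    obtain ⟨y, _, rfl⟩ := val_surj p1 p2 x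
    exact ⟨_, y, rfl, hx⟩
  obtain ⟨y, h1, h2⟩ := Nat.find_spec this
  refine ⟨y, h2, fun y' hy' => ?_⟩
  rw [h1]
  exact Nat.find_min' this ⟨y', rfl, hy'⟩

theorem red_of_min {h : List (GenSym S.A × Bool)}
    (hm : ∀ h', val S p1 p2 h' = val S p1 p2 h → h.length ≤ h'.length) : IsReduced h := by
  classical
  have h1 := hm (FreeGroup.reduce h) (by
    unfold _root_.val; rw [FreeGroup.reduce.self])
  have h2 : List.Sublist (FreeGroup.reduce h) h := (FreeGroup.reduce.red (L := h)).sublist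
  have := h2.eq_of_length (le_antisymm h2.length_le h1)
  exact IsReduced.of_reduce_eq this

namespace MinC
variable {K : GA S p1 p2 → Prop} {y : List (GenSym S.A × Bool)}

theorem rot (hc : ∀ x g, K x → K (g * x * g⁻¹)) (h : MinC K y) {y'} (hr : y' ~r y) : MinC K y' := by
  refine ⟨?_, fun z hz => hr.perm.length_eq ▸ h.min z hz⟩
  obtain ⟨n, hn', h'⟩ := List.isRotated_iff_mod.1 hr.symm
  rw [List.rotate_eq_drop_append_take hn'] at h'
  have hs := List.take_append_drop n y
  have := hc _ (val S p1 p2 (y.take n))⁻¹ h.hK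
  rw [← h']
  convert this using 1
  have e : val S p1 p2 y = val S p1 p2 (y.take n) * val S p1 p2 (y.drop n) := by
    rw [← val_append, hs]
  rw [val_append, e]
  group

theorem red (hc : ∀ x g, K x → K (g * x * g⁻¹)) (h : MinC K y) : IsCyclicallyReduced y := by
  refine ⟨red_of_min (p1 := p1) (p2 := p2) (fun h' hh => h.min h' (hh ▸ h.hK)), ?_⟩
  intro a ha b hb hab
  by_contra hne
  cases y with
  | nil => simp at hb
  | cons b' m =>
    simp at hb
    subst hb
    rcases List.eq_nil_or_concat m with rfl | ⟨m, a', rfl⟩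
    · simp at ha; subst ha; exact hne rfl
    · have : a = a' := by
        rw [List.concat_eq_append, ← List.cons_append, List.getLast?_append] at ha
        simp at ha
        exact ha.symm
      subst this
      rw [List.concat_eq_append] at h
      have := h.min m (by
        have := hc _ (val S p1 p2 [b'])⁻¹ h.hK
        convert this using 1
        have e : val S p1 p2 [a] = (val S p1 p2 [b'])⁻¹ := by
          rw [← val_invRev]
          congr 1
          simp only [invRev, List.map_cons, List.map_nil, List.reverse_singleton]
          congr 1
          refine Prod.ext hab ?_
          cases h1 : a.2 <;> cases h2 : b'.2 <;> simp_all
        rw [← List.singleton_append (l := m ++ [a]), val_append, val_append, e]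
        group)
      simp at this

theorem half (hc : ∀ x g, K x → K (g * x * g⁻¹)) (h : MinC K y) {u z v}
    (hr : (u ++ z) ~r y) (hR : Rs S p1 p2 (u ++ v)) : u.length ≤ v.length := by
  have h' := h.rot hc hr
  have := h'.min (invRev v ++ z) (by
    have := h'.hK
    rw [val_append, hR.val] at this
    rw [val_append, val_invRev]; exact this)
  simp only [List.length_append, invRev_length] at this
  omega

end MinC

theorem torsion (h1 : 10 ^ 10 < p1) (h2 : 10 ^ 10 < p2) (t : GA S p1 p2) (p : ℕ) (hp : 0 < p)
    (ht : t ^ p = 1) (hne : t ≠ 1) :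
    ∃ g f, ∃ i : ℤ, (f = GenSym.f1 ∨ f = GenSym.f2) ∧ t = g * (val S p1 p2 [(f, true)]) ^ i * g⁻¹ := by
  let K : GA S p1 p2 → Prop := fun x => ∃ g, x = g * t * g⁻¹
  have hc : ∀ x g, K x → K (g * x * g⁻¹) := by
    rintro x g ⟨k, rfl⟩
    exact ⟨g * k, by group⟩
  obtain ⟨y, hy⟩ := exists_minC (K := K) ⟨t, 1, by simp⟩
  have hyne : y ≠ [] := by
    rintro rfl
    obtain ⟨g, hg⟩ := hy.hK
    rw [val_nil] at hg
    apply hne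
    have : g⁻¹ * 1 * g = t := by rw [hg]; group
    rw [← this]; group
  have hcyc := hy.red hc
  have hval : ∀ n, val S p1 p2 (List.replicate n y).flatten = (val S p1 p2 y) ^ n := by
    intro n
    induction n with
    | zero => simp [val_nil]
    | succ n ih => rw [List.replicate_succ, List.flatten_cons, val_append, ih, pow_succ']
  obtain ⟨s, v, hR, hs, hi⟩ := dehn' h1 h2 (hcyc.flatten_replicate p).1 (by
    intro h0
    have := congrArg List.length h0
    simp at this
    rcases this with h | h
    · omega
    · exact hyne h) (by
    rw [hval]
    obtain ⟨g, hg⟩ := hy.hK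
    rw [hg, conj_pow, ht]; group)
  have hRl := hR.len h1 h2
  simp only [List.length_append] at hRl
  obtain ⟨y', hr, hA, hB⟩ := per_inf hi
  have hl := hr.perm.length_eq
  by_cases hsy : s.length ≤ y.length
  · obtain ⟨z, hz⟩ := hA hsy
    have := hy.half hc (hz ▸ hr) hR
    omega
  push Not at hsy
  obtain ⟨⟨s', hs'⟩, ⟨q, hq⟩⟩ := hB hsy.le
  rcases hR.cases with hN | ⟨f, sg, p', hf, hw⟩
  · exfalso
    have hd : s.drop y.length = s' := by rw [← hs', ← hl, List.drop_left]
    rw [hd] at hq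
    have hpc := hN.piece h1 h2 (T := s') (a1 := []) (a2 := y') (c1 := q ++ v) (c2 := v)
      (by rw [← hq]; simp) (by rw [← hs']) (by rw [hl]; exact List.length_pos_iff.2 hyne)
    have := hy.half hc (u := y') (z := []) (v := s' ++ v) (by simpa using hr)
      (by rw [← List.append_assoc, hs']; exact hR)
    have l1 := congrArg List.length hs'
    simp only [List.length_append] at *
    omega
  · have hy' : y' = List.replicate y'.length (f, sg) := by
      rw [List.eq_replicate_iff]
      refine ⟨rfl, fun b hb => ?_⟩
      have : b ∈ s ++ v := by rw [← hs']; simp [hb]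
      rw [hw] at this
      exact List.eq_of_mem_replicate this
    have hv : ∀ n, val S p1 p2 (List.replicate n (f, sg)) = (val S p1 p2 [(f, sg)]) ^ n := by
      intro n
      induction n with
      | zero => simp [val_nil]
      | succ n ih => rw [List.replicate_succ', val_append, ih, pow_succ]
    obtain ⟨g, hg⟩ := (hy.rot hc hr).hK
    rw [hy', hv] at hg
    have e : t = g⁻¹ * (val S p1 p2 [(f, sg)]) ^ y'.length * g⁻¹⁻¹ := by rw [hg]; group
    have hf' : f = .f1 ∨ f = .f2 := by tauto
    cases sg
    · refine ⟨g⁻¹, f, -(y'.length : ℤ), hf', ?_⟩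
      have : val S p1 p2 [(f, false)] = (val S p1 p2 [(f, true)])⁻¹ := by
        rw [← val_invRev]; rfl
      rw [e, this]
      simp
    · exact ⟨g⁻¹, f, (y'.length : ℤ), hf', by rw [e]; simp⟩

end sgn

set_option linter.unusedSectionVars false
set_option linter.unusedVariables false

section cfg
open FreeGroup
variable {S : IndexedStructure} {p1 p2 : ℕ}

theorem Rs.rot {u v : List (GenSym S.A × Bool)} (h : Rs S p1 p2 (u ++ v)) : Rs S p1 p2 (v ++ u) := by
  rcases h with h | h
  · exact Or.inl (RR.rot h List.isRotated_append)
  · right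
    rw [invRev_app] at h ⊢
    exact RR.rot h List.isRotated_append

/-- the word `f^e` -/
def fw {A : Type} (f : GenSym A) (e : ℤ) : List (GenSym A × Bool) :=
  List.replicate e.natAbs (f, decide (0 < e))

@[simp] theorem fw_zero {A : Type} (f : GenSym A) : fw f 0 = [] := rfl

theorem fw_len {A : Type} (f : GenSym A) (e : ℤ) : (fw f e).length = e.natAbs := by simp [fw]

theorem fw_neg {A : Type} (f : GenSym A) (e : ℤ) : invRev (fw f e) = fw f (-e) := by
  unfold fw
  rw [invRev_repl]
  by_cases h : e = 0
  · simp [h]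
  · rw [Int.natAbs_neg]
    have : (!decide (0 < e)) = decide (0 < -e) := by
      by_cases h' : 0 < e
      · simp [h', h'.le]
      · simp [h']; omega
    simp [this]

theorem fw_mem {A : Type} {f : GenSym A} {e : ℤ} {z} (h : z ∈ fw f e) : z = (f, decide (0 < e)) :=
  List.eq_of_mem_replicate h

theorem fw_red {A : Type} (f : GenSym A) (e : ℤ) : IsReduced (fw f e) :=
  List.isChain_replicate_of_rel _ (fun _ => rfl)

/-- the element `F` -/
def FF (S : IndexedStructure) (p1 p2 : ℕ) (f : GenSym S.A) : GA S p1 p2 := val S p1 p2 [(f, true)]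

theorem val_repl (n : ℕ) (z : GenSym S.A × Bool) :
    val S p1 p2 (List.replicate n z) = (val S p1 p2 [z]) ^ n := by
  induction n with
  | zero => simp [val_nil]
  | succ n ih => rw [List.replicate_succ', val_append, ih, pow_succ]

theorem val_fw (f : GenSym S.A) (e : ℤ) : val S p1 p2 (fw f e) = FF S p1 p2 f ^ e := by
  have hpos : ∀ n : ℕ, val S p1 p2 (fw f n) = FF S p1 p2 f ^ (n : ℤ) := by
    intro n
    unfold fw FF
    by_cases h : n = 0
    · simp [h, val_nil]
    · rw [val_repl]
      have : decide ((0 : ℤ) < (n : ℤ)) = true := by simp; omega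
      rw [this]; simp
  rcases Int.natAbs_eq e with h | h
  · rw [h]; exact hpos _
  · rw [h, ← fw_neg, val_invRev, hpos, zpow_neg]

/-- prefixes and suffixes of `f^e` are again of this form -/
theorem fw_sub {A : Type} {f : GenSym A} {e : ℤ} {u : List (GenSym A × Bool)} (h : u <:+: fw f e) :
    ∃ e' : ℤ, u = fw f e' ∧ e'.natAbs ≤ e.natAbs := by
  have hl := h.length_le
  rw [fw_len] at hl
  have hu : u = List.replicate u.length (f, decide (0 < e)) :=
    List.eq_replicate_iff.2 ⟨rfl, fun b hb => fw_mem (h.subset hb)⟩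
  by_cases h0 : u = []
  · exact ⟨0, by simp [h0], by simp⟩
  have := List.length_pos_iff.2 h0
  by_cases he : 0 < e
  · refine ⟨u.length, ?_, by simpa using hl⟩
    conv_lhs => rw [hu]
    unfold fw
    simp [he, this]
  · refine ⟨-u.length, ?_, by simpa using hl⟩
    conv_lhs => rw [hu]
    unfold fw
    simp [he]

def QF (S : IndexedStructure) (p1 p2 : ℕ) (f : GenSym S.A) (x z : GA S p1 p2) : Prop :=
  ∃ i j : ℤ, z = FF S p1 p2 f ^ i * x * FF S p1 p2 f ^ j

theorem QF.mul {f : GenSym S.A} {x z : GA S p1 p2} (h : QF S p1 p2 f x z) (i j : ℤ) :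
    QF S p1 p2 f x (FF S p1 p2 f ^ i * z * FF S p1 p2 f ^ j) := by
  obtain ⟨a, b, rfl⟩ := h
  exact ⟨i + a, b + j, by rw [zpow_add, zpow_add]; group⟩

theorem QF.mul' {f : GenSym S.A} {x z z' : GA S p1 p2} (h : QF S p1 p2 f x z) (i j : ℤ)
    (e : z' = FF S p1 p2 f ^ i * z * FF S p1 p2 f ^ j) : QF S p1 p2 f x z' := e ▸ h.mul i j

def KF (S : IndexedStructure) (p1 p2 : ℕ) (f : GenSym S.A) (x z : GA S p1 p2) : Prop :=
  ∃ g, QF S p1 p2 f x (g⁻¹ * z * g)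

theorem KF.conj {f : GenSym S.A} {x : GA S p1 p2} : ∀ z g, KF S p1 p2 f x z → KF S p1 p2 f x (g * z * g⁻¹) := by
  rintro z g ⟨k, hk⟩
  refine ⟨g * k, ?_⟩
  convert hk using 1
  group

structure Cfg (S : IndexedStructure) (p1 p2 P : ℕ) (f : GenSym S.A) (x : GA S p1 p2)
    (y h : List (GenSym S.A × Bool)) : Prop where
  h1 : 10 ^ 10 < p1
  h2 : 10 ^ 10 < p2
  hf : (f = .f1 ∧ P = p1) ∨ (f = .f2 ∧ P = p2)
  hx : ∀ i : ℤ, x ≠ FF S p1 p2 f ^ i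
  mc : MinC (KF S p1 p2 f x) y
  q : QF S p1 p2 f x (val S p1 p2 (invRev h ++ y ++ h))
  m2 : ∀ y' h', y'.length = y.length → QF S p1 p2 f x (val S p1 p2 (invRev h' ++ y' ++ h')) →
    h.length ≤ h'.length

theorem exists_cfg {P : ℕ} {f : GenSym S.A} {x : GA S p1 p2} (h1 : 10 ^ 10 < p1) (h2 : 10 ^ 10 < p2)
    (hf : (f = .f1 ∧ P = p1) ∨ (f = .f2 ∧ P = p2)) (hx : ∀ i : ℤ, x ≠ FF S p1 p2 f ^ i) :
    ∃ y h, Cfg S p1 p2 P f x y h := by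
  classical
  obtain ⟨y0, hy0⟩ := exists_minC (K := KF S p1 p2 f x) ⟨x, 1, 0, 0, by simp⟩
  have hex : ∃ n, ∃ y h : List (GenSym S.A × Bool), h.length = n ∧ y.length = y0.length ∧
      QF S p1 p2 f x (val S p1 p2 (invRev h ++ y ++ h)) := by
    obtain ⟨g, hg⟩ := hy0.hK
    obtain ⟨h, _, rfl⟩ := val_surj p1 p2 g
    exact ⟨_, y0, h, rfl, rfl, by rw [val_append, val_append, val_invRev]; exact hg⟩
  obtain ⟨y, h, e1, e2, hq⟩ := Nat.find_spec hex
  refine ⟨y, h, h1, h2, hf, hx, ⟨⟨val S p1 p2 h, ?_⟩, fun y' hy' => e2 ▸ hy0.min y' hy'⟩, hq, ?_⟩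
  · rw [val_append, val_append, val_invRev] at hq; exact hq
  · intro y' h' hl hq'
    rw [e1]
    exact Nat.find_min' hex ⟨y', h', rfl, hl.trans e2, hq'⟩

namespace Cfg
variable {P : ℕ} {f : GenSym S.A} {x : GA S p1 p2} {y h : List (GenSym S.A × Bool)}

theorem hf' (C : Cfg S p1 p2 P f x y h) : f = .f1 ∨ f = .f2 := by have := C.hf; tauto

theorem yne (C : Cfg S p1 p2 P f x y h) : y ≠ [] := by
  rintro rfl
  obtain ⟨g, i, j, hg⟩ := C.mc.hK
  rw [val_nil] at hg
  apply C.hx (-i - j)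
  have : x = FF S p1 p2 f ^ (-i) * (g⁻¹ * 1 * g) * FF S p1 p2 f ^ (-j) := by rw [hg]; group
  rw [this]; group

theorem cyc (C : Cfg S p1 p2 P f x y h) : IsCyclicallyReduced y := C.mc.red KF.conj

theorem kq {z : GA S p1 p2} (hz : QF S p1 p2 f x z) : KF S p1 p2 f x z := ⟨1, by simpa using hz⟩

theorem half (C : Cfg S p1 p2 P f x y h) {u z v} (hr : (u ++ z) ~r y) (hR : Rs S p1 p2 (u ++ v)) :
    u.length ≤ v.length := C.mc.half KF.conj hr hR

/-- replacing a rotated `y` -/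
theorem m3 (C : Cfg S p1 p2 P f x y h) {y1 y2 h'} (i : ℤ) (hy : y = y1 ++ y2)
    (he : val S p1 p2 h' = (val S p1 p2 y1)⁻¹ * val S p1 p2 h * FF S p1 p2 f ^ i) :
    h.length ≤ h'.length := by
  refine C.m2 (y2 ++ y1) h' (by rw [hy]; simp [add_comm]) ?_
  refine C.q.mul' (-i) i ?_
  simp only [val_append, val_invRev, he, hy]
  group

theorem m4 (C : Cfg S p1 p2 P f x y h) {y1 y2 h'} (i : ℤ) (hy : y = y2 ++ y1)
    (he : val S p1 p2 h' = (val S p1 p2 y1) * val S p1 p2 h * FF S p1 p2 f ^ i) :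
    h.length ≤ h'.length := by
  refine C.m2 (y1 ++ y2) h' (by rw [hy]; simp [add_comm]) ?_
  refine C.q.mul' (-i) i ?_
  simp only [val_append, val_invRev, he, hy]
  group

theorem lemL (C : Cfg S p1 p2 P f x y h) {X H Z y1 y2 v} (i : ℤ) (hh : invRev h = X ++ H ++ Z)
    (hy : y = y1 ++ y2) (c1 : y1 = [] ∨ Z = []) (c2 : i = 0 ∨ X = [])
    (hR : Rs S p1 p2 (fw f i ++ H ++ y1 ++ v)) : H.length ≤ v.length := by
  have hv := hR.val
  simp only [val_append, val_fw] at hv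
  have hh' : val S p1 p2 h = (val S p1 p2 X * val S p1 p2 H * val S p1 p2 Z)⁻¹ := by
    rw [← val_append, ← val_append, ← hh, val_invRev, inv_inv]
  have := C.m3 (y1 := y1) (y2 := y2) (h' := invRev (X ++ invRev v ++ Z)) (-i) hy (by
    rw [val_invRev, val_append, val_append, val_invRev, ← hv, hh']
    rcases c1 with rfl | rfl <;> rcases c2 with rfl | rfl <;> simp only [val_nil] <;> group)
  have hl := congrArg List.length hh
  simp only [List.length_append, invRev_length] at this hl
  omega

theorem lemR (C : Cfg S p1 p2 P f x y h) {X H Z y1 y2 v} (i : ℤ) (hh : h = Z ++ H ++ X)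
    (hy : y = y2 ++ y1) (c1 : y1 = [] ∨ Z = []) (c2 : i = 0 ∨ X = [])
    (hR : Rs S p1 p2 (y1 ++ H ++ fw f i ++ v)) : H.length ≤ v.length := by
  have hv := hR.val
  simp only [val_append, val_fw] at hv
  have hh' : val S p1 p2 h = (val S p1 p2 Z * val S p1 p2 H * val S p1 p2 X) := by
    rw [← val_append, ← val_append, ← hh]
  have := C.m4 (y1 := y1) (y2 := y2) (h' := (Z ++ invRev v ++ X)) i hy (by
    rw [val_append, val_append, val_invRev, ← hv, hh']
    rcases c1 with rfl | rfl <;> rcases c2 with rfl | rfl <;> simp only [val_nil] <;> group)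
  have hl := congrArg List.length hh
  simp only [List.length_append, invRev_length] at this hl
  omega

theorem hred (C : Cfg S p1 p2 P f x y h) : IsReduced h :=
  red_of_min (p1 := p1) (p2 := p2) (fun h' hh => C.m3 (y1 := []) (y2 := y) 0 (by simp) (by
    rw [hh, val_nil]; simp))

theorem hlast (C : Cfg S p1 p2 P f x y h) {h0 s} : h ≠ h0 ++ [(f, s)] := by
  intro hh
  have := C.m3 (y1 := []) (y2 := y) (h' := h0) (cond s (-1) 1) (by simp) (by
    have hs : val S p1 p2 [(f, s)] = FF S p1 p2 f ^ (cond s (1 : ℤ) (-1)) := by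
      cases s
      · have : val S p1 p2 [(f, false)] = (val S p1 p2 [(f, true)])⁻¹ := by
          rw [← val_invRev]; rfl
        rw [this]; simp [FF]
      · simp [FF]
    rw [val_nil, hh, val_append, hs]
    cases s <;> simp)
  rw [hh] at this
  simp at this

theorem yfirst (C : Cfg S p1 p2 P f x y h) (h0 : h = []) {y0 s} : y ≠ (f, s) :: y0 := by
  intro hh
  have hq := C.q
  rw [h0] at hq
  have hs : val S p1 p2 [(f, s)] = FF S p1 p2 f ^ (cond s (1 : ℤ) (-1)) := by
    cases s
    · have : val S p1 p2 [(f, false)] = (val S p1 p2 [(f, true)])⁻¹ := by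
        rw [← val_invRev]; rfl
      rw [this]; simp [FF]
    · simp [FF]
  have := C.mc.min y0 (kq (hq.mul' (cond s (-1) 1) 0 (by
    rw [hh, ← List.singleton_append (l := y0)]
    simp only [val_append, val_invRev, val_nil, hs]
    cases s <;> simp)))
  rw [hh] at this
  simp at this

theorem ylast (C : Cfg S p1 p2 P f x y h) (h0 : h = []) {y0 s} : y ≠ y0 ++ [(f, s)] := by
  intro hh
  have hq := C.q
  rw [h0] at hq
  have hs : val S p1 p2 [(f, s)] = FF S p1 p2 f ^ (cond s (1 : ℤ) (-1)) := by
    cases s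
    · have : val S p1 p2 [(f, false)] = (val S p1 p2 [(f, true)])⁻¹ := by
        rw [← val_invRev]; rfl
      rw [this]; simp [FF]
    · simp [FF]
  have := C.mc.min y0 (kq (hq.mul' 0 (cond s (-1) 1) (by
    rw [hh]
    simp only [val_append, val_invRev, val_nil, hs]
    cases s <;> simp)))
  rw [hh] at this
  simp at this

/-- the word `M` -/
def MM (y h : List (GenSym S.A × Bool)) : List (GenSym S.A × Bool) := invRev h ++ y ++ h

theorem Mne (C : Cfg S p1 p2 P f x y h) : MM y h ≠ [] := by
  simp [MM, C.yne]

theorem Mlast (C : Cfg S p1 p2 P f x y h) {m s} : MM y h ≠ m ++ [(f, s)] := by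
  intro hh
  unfold MM at hh
  rcases List.eq_nil_or_concat h with h0 | ⟨h', a, h0⟩
  · rw [h0] at hh
    simp at hh
    exact C.ylast h0 hh
  · rw [List.concat_eq_append] at h0
    conv_lhs at hh => rw [h0, ← List.append_assoc]
    have := (List.append_inj' hh rfl).2
    exact C.hlast (h0.trans (by rw [this]))

theorem Mfirst (C : Cfg S p1 p2 P f x y h) {m s} : MM y h ≠ (f, s) :: m := by
  intro hh
  unfold MM at hh
  rcases List.eq_nil_or_concat h with h0 | ⟨h', a, h0⟩
  · rw [h0] at hh
    simp at hh
    exact C.yfirst h0 hh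
  · rw [List.concat_eq_append] at h0
    have e : invRev h = (a.1, !a.2) :: invRev h' := by rw [h0, invRev_app]; simp [invRev]
    rw [e, List.cons_append, List.cons_append] at hh
    have := (List.cons.inj hh).1
    refine C.hlast (s := !s) (h0 := h') ?_
    rw [h0]
    have : a = (f, !s) := by
      have e1 := (Prod.ext_iff.1 this).1
      have e2 := (Prod.ext_iff.1 this).2
      refine Prod.ext e1 ?_
      simp only at e2 ⊢
      rw [← e2]; simp
    rw [this]

theorem Mred (C : Cfg S p1 p2 P f x y h) : IsReduced (MM y h) := by
  unfold MM
  have hi : IsReduced (invRev h) := by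
    refine red_of_min (p1 := p1) (p2 := p2) (fun h' hh => ?_)
    rw [invRev_length, ← invRev_length (L₁ := h')]
    exact C.m3 (y1 := []) (y2 := y) (h' := invRev h') 0 (by simp) (by
      rw [val_invRev, hh, val_invRev, val_nil]; simp)
  have hy := C.cyc
  cases hh : h with
  | nil => simpa [invRev] using hy.1
  | cons a h' =>
    rw [← hh]
    unfold FreeGroup.IsReduced
    rw [List.isChain_append, List.isChain_append]
    refine ⟨⟨hi, hy.1, ?_⟩, C.hred, ?_⟩
    · intro z hz c hc hzc
      have : z = (a.1, !a.2) := by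
        rw [hh] at hz; simp [invRev] at hz; exact hz.symm
      by_contra hne
      cases hyy : y with
      | nil => exact C.yne hyy
      | cons c' y' =>
        rw [hyy] at hc; simp at hc; subst hc
        have hca : c' = a := by
          refine Prod.ext (by rw [← hzc, this]) ?_
          rw [this] at hne
          cases h1 : a.2 <;> cases h2 : c'.2 <;> simp_all
        have := C.m3 (y1 := [c']) (y2 := y') (h' := h') 0 (by simp [hyy]) (by
          rw [hca, hh, ← List.singleton_append (l := h'), val_append]; simp)
        rw [hh] at this
        simp at this
    · intro c hc z hz hzc
      have : z = a := by rw [hh] at hz; simp at hz; exact hz.symm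
      subst this
      by_contra hne
      rcases List.eq_nil_or_concat y with hyy | ⟨y', c', hyy⟩
      · exact C.yne hyy
      rw [List.concat_eq_append] at hyy
      rw [hyy] at hc
      rw [List.getLast?_append, List.getLast?_append] at hc
      simp at hc
      subst hc
      have hca : [c'] = invRev [z] := by
        simp only [invRev, List.map_cons, List.map_nil, List.reverse_singleton]
        congr 1
        refine Prod.ext hzc ?_
        cases h1 : z.2 <;> cases h2 : c'.2 <;> simp_all
      have := C.m4 (y1 := [c']) (y2 := y') (h' := h') 0 hyy (by
          rw [hca, val_invRev, hh, ← List.singleton_append (l := h'), val_append]; simp)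
      rw [hh] at this
      simp at this

end Cfg
end cfg

set_option linter.unusedSectionVars false
set_option linter.unusedVariables false

section nocr
open FreeGroup
variable {S : IndexedStructure} {p1 p2 : ℕ}

theorem Rs.np {w : List (GenSym S.A × Bool)} (h : Rs S p1 p2 w) {z z'} (hz : z ∈ w) (hz' : z' ∈ w)
    (hne : z ≠ z') : NPs S w := by
  rcases h.cases with h | ⟨f, s, p, hf, hw⟩
  · exact h
  · rw [hw] at hz hz'
    exact absurd ((List.eq_of_mem_replicate hz).trans (List.eq_of_mem_replicate hz').symm) hne

theorem NPs.fw {w : List (GenSym S.A × Bool)} (h : NPs S w) {f : GenSym S.A} {i : ℤ}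
    (hi : fw f i <:+: w) : 24 * i.natAbs ≤ w.length := NPs.run h hi

theorem fw_ne {A : Type} {f : GenSym A} {i : ℤ} (hi : i ≠ 0) : (f, decide (0 < i)) ∈ fw f i := by
  unfold fw; simp [hi]

namespace Cfg
variable {P : ℕ} {f : GenSym S.A} {x : GA S p1 p2} {y h : List (GenSym S.A × Bool)}

theorem bndL (C : Cfg S p1 p2 P f x y h) {N Z v : List (GenSym S.A × Bool)} {i j : ℤ} (hM : MM y h = N ++ Z)
    (hN : N ≠ []) (hi : i ≠ 0) (hR : Rs S p1 p2 (fw f i ++ N ++ fw f j ++ v)) :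
    NPs S (fw f i ++ N ++ fw f j ++ v) := by
  cases N with
  | nil => exact absurd rfl hN
  | cons a N =>
    refine hR.np (z := (f, decide (0 < i))) (z' := a) (by simp [fw_ne hi]) (by simp) ?_
    intro h
    rw [← h] at hM
    exact C.Mfirst hM

theorem bndR (C : Cfg S p1 p2 P f x y h) {X N v : List (GenSym S.A × Bool)} {i j : ℤ} (hM : MM y h = X ++ N)
    (hN : N ≠ []) (hj : j ≠ 0) (hR : Rs S p1 p2 (fw f i ++ N ++ fw f j ++ v)) :
    NPs S (fw f i ++ N ++ fw f j ++ v) := by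
  rcases List.eq_nil_or_concat N with h0 | ⟨N, a, rfl⟩
  · exact absurd h0 hN
  · rw [List.concat_eq_append] at *
    refine hR.np (z := (f, decide (0 < j))) (z' := a) (by simp [fw_ne hj]) (by simp) ?_
    intro h
    rw [← h, ← List.append_assoc] at hM
    exact C.Mlast hM

theorem nocross (C : Cfg S p1 p2 P f x y h) {X N Z v : List (GenSym S.A × Bool)} {i j : ℤ}
    (hM : MM y h = X ++ N ++ Z) (hN : N ≠ []) (ci : i = 0 ∨ X = []) (cj : j = 0 ∨ Z = [])
    (hR : Rs S p1 p2 (fw f i ++ N ++ fw f j ++ v))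
    (hv : 5 * v.length ≤ i.natAbs + N.length + j.natAbs) : False := by
  have hlen := hR.len C.h1 C.h2
  simp only [List.length_append, fw_len] at hlen
  have bi : 24 * i.natAbs ≤ i.natAbs + N.length + j.natAbs + v.length := by
    by_cases hi : i = 0
    · simp [hi]
    · have hX := ci.resolve_left hi
      have hn := C.bndL (N := N) (Z := Z) (by rw [hM, hX]; simp) hN hi hR
      have := hn.fw (f := f) (i := i) ⟨[], N ++ fw f j ++ v, by simp⟩
      simpa [List.length_append, fw_len, add_assoc] using this
  have bj : 24 * j.natAbs ≤ i.natAbs + N.length + j.natAbs + v.length := by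
    by_cases hj : j = 0
    · simp [hj]
    · have hZ := cj.resolve_left hj
      have hn := C.bndR (N := N) (X := X) (by rw [hM, hZ]; simp) hN hj hR
      have := hn.fw (f := f) (i := j) ⟨fw f i ++ N, v, by simp⟩
      simpa [List.length_append, fw_len, add_assoc] using this
  -- infixes of `y` are short
  have hhalf : ∀ {A N' B A' B'}, y = A ++ N' ++ B → N = A' ++ N' ++ B' →
      2 * N'.length ≤ i.natAbs + N.length + j.natAbs + v.length := by
    intro A N' B A' B' e1 e2
    have := C.half (u := N') (z := B ++ A) (v := B' ++ fw f j ++ v ++ (fw f i ++ A')) (by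
      rw [e1]
      have := List.isRotated_append (l := N' ++ B) (l' := A)
      simpa using this) (by
      have := Rs.rot (u := fw f i ++ A') (v := N' ++ B' ++ fw f j ++ v) (by
        rw [e2] at hR; simpa using hR)
      simpa using this)
    have l2 := congrArg List.length e2
    simp only [List.length_append, fw_len] at this l2
    omega
  by_cases h0 : h = []
  · have e : y = X ++ N ++ Z := by rw [← hM, MM, h0]; simp
    have := hhalf (A' := []) (B' := []) e (by simp)
    omega
  have hlp := List.length_pos_iff.2 h0
  unfold MM at hM
  rcases List.append_eq_append_iff.1 hM with ⟨h1, e1, e2⟩ | ⟨Z', e1, e2⟩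
  · -- `X ++ N = (invRev h ++ y) ++ h1`, `h = h1 ++ Z`
    rw [List.append_assoc] at e1
    rcases List.append_eq_append_iff.1 e1.symm with ⟨X', e3, e4⟩ | ⟨X', e3, e4⟩
    · -- X = invRev h ++ X'
      have hi : i = 0 := by
        rcases ci with h | h
        · exact h
        · exfalso
          have := congrArg List.length e3
          rw [h, List.length_append, invRev_length] at this
          simp only [List.length_nil] at this; omega
      rcases List.append_eq_append_iff.1 e4 with ⟨X'', e5, e6⟩ | ⟨y1, e5, e6⟩
      · -- h1 = X'' ++ N
        have := C.lemR (Z := X'') (H := N) (X := Z) (y1 := []) (y2 := y) (v := v) j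
          (by rw [e2, e6]) (by simp) (Or.inl rfl) cj (by rw [hi] at hR; simpa using hR)
        rw [hi] at hv bj hlen
        simp only [Int.natAbs_zero] at *
        omega
      · have hh := hhalf (A := X') (N' := y1) (B := []) (A' := []) (B' := h1) (by simp [e5]) (by simp [e6])
        have := C.lemR (Z := []) (H := h1) (X := Z) (y1 := y1) (y2 := X') (v := v) j
          (by simp [e2]) e5 (Or.inr rfl) cj (by rw [hi, e6] at hR; simpa using hR)
        have l := congrArg List.length e6
        rw [hi] at hv bj hlen hh
        simp only [Int.natAbs_zero, List.length_append] at *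
        omega
    · -- invRev h = X ++ X', N = X' ++ (y ++ h1)
      have hh := hhalf (A := []) (N' := y) (B := []) (A' := X') (B' := h1) (by simp) (by simp [e4])
      have l := congrArg List.length e4
      simp only [List.length_append] at l
      have eh : h = invRev X' ++ invRev X := by
        rw [← invRev_app, ← e3, invRev_invRev]
      by_cases hX' : X' = []
      · -- N = y ++ h1
        have hi : i = 0 := by
          rcases ci with h | h
          · exact h
          · exfalso
            rw [h, hX'] at eh
            exact h0 (by simpa [invRev] using eh)
        have := C.lemR (Z := []) (H := h1) (X := Z) (y1 := y) (y2 := []) (v := v) j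
          (by simp [e2]) (by simp) (Or.inr rfl) cj (by rw [hi, e4, hX'] at hR; simpa using hR)
        rw [hi] at hv bj hlen hh
        simp only [Int.natAbs_zero, hX', List.length_nil] at *
        omega
      by_cases hh1 : h1 = []
      · have hj : j = 0 := by
          rcases cj with h | h
          · exact h
          · exfalso
            rw [h, hh1] at e2
            exact h0 (by simpa using e2)
        have := C.lemL (X := X) (H := X') (Z := []) (y1 := y) (y2 := []) (v := v) i
          (by simp [e3]) (by simp) (Or.inr rfl) ci (by rw [hj, e4, hh1] at hR; simpa using hR)
        rw [hj] at hv bj hlen hh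
        simp only [Int.natAbs_zero, hh1, List.length_nil] at *
        omega
      -- genuine fold
      have heq : invRev X' ++ invRev X = h1 ++ Z := eh.symm.trans e2
      have lX' := List.length_pos_iff.2 hX'
      have lh1 := List.length_pos_iff.2 hh1
      -- signs exclude `f`
      obtain ⟨a, ta, ea⟩ : ∃ a t, h1 = a :: t := List.exists_cons_of_ne_nil hh1
      have ha' : (a.1, !a.2) ∈ X' := by
        rw [← invRev_invRev (L₁ := X'), mem_invRev']
        cases hq : invRev X' with
        | nil => exfalso; have := congrArg List.length hq; rw [invRev_length] at this; simp at this
                 exact hX' this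
        | cons b t =>
          rw [hq, ea] at heq
          have := (List.cons.inj heq).1
          simp [this]
      have ha : a ∈ h1 := by simp [ea]
      have nof : ∀ s, (f, s) ∉ fw f i ++ N ++ fw f j ++ v := by
        intro s hs
        have sg := hR.sign_f C.hf' hs
        have s1 := sg a (by rw [e4]; simp [ha])
        have s2 := sg (a.1, !a.2) (by rw [e4]; simp [ha'])
        simp [s1] at s2
      have hi : i = 0 := by
        by_contra hi
        exact nof _ (by simp only [List.mem_append]; exact Or.inl (Or.inl (Or.inl (fw_ne hi))))
      have hj : j = 0 := by
        by_contra hj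
        exact nof _ (by simp only [List.mem_append]; exact Or.inl (Or.inr (fw_ne hj)))
      rw [hi, hj] at hR hv hlen hh
      simp only [fw_zero, List.nil_append, List.append_nil, Int.natAbs_zero] at *
      rcases List.append_eq_append_iff.1 heq with ⟨u, e5, e6⟩ | ⟨u, e5, e6⟩
      · -- h1 = invRev X' ++ u
        have hf := hR.fold (u := invRev X') (m := y) ⟨[], u ++ v, by
          rw [e4, e5, invRev_invRev]; simp⟩
        rw [invRev_length] at hf
        have := C.lemR (Z := []) (H := h1) (X := Z) (y1 := y) (y2 := []) (v := v ++ X') 0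
          (by simp [e2]) (by simp) (Or.inr rfl) (Or.inl rfl) (by
            have := Rs.rot (u := X') (v := y ++ h1 ++ v) (by rw [e4] at hR; simpa using hR)
            simpa using this)
        simp only [List.length_append] at this
        omega
      · -- invRev X' = h1 ++ u
        have e7 : X' = invRev u ++ invRev h1 := by rw [← invRev_app, ← e5, invRev_invRev]
        have hf := hR.fold (u := h1) (m := y) ⟨invRev u, v, by
          rw [e4, e7]; simp⟩
        have := C.lemL (X := X) (H := X') (Z := []) (y1 := y) (y2 := []) (v := h1 ++ v) 0
          (by simp [e3]) (by simp) (Or.inr rfl) (Or.inl rfl) (by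
            rw [e4] at hR; simpa using hR)
        simp only [List.length_append] at this
        omega
  · -- invRev h ++ y = X ++ N ++ Z', Z = Z' ++ h
    have hj : j = 0 := by
      rcases cj with h' | h'
      · exact h'
      · exfalso
        rw [h'] at e2
        simp at e2; exact h0 e2.2
    rw [hj] at hR hv bi hlen hhalf
    simp only [fw_zero, List.append_nil, Int.natAbs_zero] at *
    rw [List.append_assoc] at e1
    rcases List.append_eq_append_iff.1 e1 with ⟨X', e3, e4⟩ | ⟨X', e3, e4⟩
    · have hi : i = 0 := by
        rcases ci with h | h
        · exact h
        · exfalso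
          have := congrArg List.length e3
          rw [h, List.length_append, invRev_length] at this
          simp only [List.length_nil] at this; omega
      have := hhalf (A := X') (N' := N) (B := Z') (A' := []) (B' := []) (by simp [e4]) (by simp)
      rw [hi] at this hv hlen
      simp only [Int.natAbs_zero] at *
      omega
    · rcases List.append_eq_append_iff.1 e4.symm with ⟨y1, e5, e6⟩ | ⟨Z'', e5, e6⟩
      · -- N = X' ++ y1
        have hh := hhalf (A := []) (N' := y1) (B := Z') (A' := X') (B' := []) (by simp [e6]) (by simp [e5])
        have := C.lemL (X := X) (H := X') (Z := []) (y1 := y1) (y2 := Z') (v := v) i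
          (by simp [e3]) e6 (Or.inr rfl) ci (by rw [e5] at hR; simpa using hR)
        have l := congrArg List.length e5
        simp only [List.length_append] at *
        omega
      · have := C.lemL (X := X) (H := N) (Z := Z'') (y1 := []) (y2 := y) (v := v) i
          (by rw [e3, e5]; simp) (by simp) (Or.inl rfl) ci (by simpa using hR)
        omega

end Cfg
end nocr

set_option linter.unusedSectionVars false
set_option linter.unusedVariables false

section crossing
open FreeGroup

/-- the word `M f^{e_1} M f^{e_2} ...` -/
def Lw {A : Type} (f : GenSym A) (M : List (GenSym A × Bool)) : List ℤ → List (GenSym A × Bool)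
  | [] => []
  | e :: es => M ++ fw f e ++ Lw f M es

theorem Lw_append {A : Type} (f : GenSym A) (M : List (GenSym A × Bool)) (a b : List ℤ) :
    Lw f M (a ++ b) = Lw f M a ++ Lw f M b := by
  induction a with
  | nil => simp [Lw]
  | cons e a ih => simp [Lw, ih]

theorem Lw_pre {A : Type} {f : GenSym A} {M : List (GenSym A × Bool)} (es : List ℤ) :
    ∀ s, s ≠ [] → s <+: Lw f M es → ∃ mid e' post S2, es = mid ++ e' :: post ∧
      s = Lw f M mid ++ S2 ∧ S2 ≠ [] ∧ S2 <+: M ++ fw f e' := by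
  induction es with
  | nil => intro s hs hp; simp [Lw] at hp; exact absurd hp hs
  | cons e es ih =>
    intro s hs hp
    rw [Lw] at hp
    obtain ⟨t, ht⟩ := hp
    rcases List.append_eq_append_iff.1 ht with ⟨u, e1, e2⟩ | ⟨u, e1, e2⟩
    · exact ⟨[], e, es, s, rfl, by simp [Lw], hs, ⟨u, e1.symm⟩⟩
    · by_cases hu : u = []
      · refine ⟨[], e, es, s, rfl, by simp [Lw], hs, ⟨[], ?_⟩⟩
        rw [e1, hu]; simp
      · obtain ⟨mid, e', post, S2, h1, h2, h3, h4⟩ := ih u hu ⟨t, e2.symm⟩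
        exact ⟨e :: mid, e', post, S2, by rw [h1]; rfl, by rw [e1, h2]; simp [Lw], h3, h4⟩

theorem Lw_inf {A : Type} {f : GenSym A} {M : List (GenSym A × Bool)} (es : List ℤ) :
    ∀ s, s ≠ [] → s <:+: Lw f M es → (∃ e ∈ es, s <:+: M ++ fw f e) ∨
      ∃ pre e0 mid e' post S1 S2, es = pre ++ e0 :: mid ++ e' :: post ∧
      s = S1 ++ Lw f M mid ++ S2 ∧ S1 ≠ [] ∧ S1 <:+ M ++ fw f e0 ∧ S2 ≠ [] ∧ S2 <+: M ++ fw f e' := by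
  induction es with
  | nil => intro s hs hp; simp [Lw] at hp; exact absurd hp hs
  | cons e es ih =>
    intro s hs hp
    have lift : s <:+: Lw f M es → ((∃ e' ∈ e :: es, s <:+: M ++ fw f e') ∨
      ∃ pre e0 mid e' post S1 S2, e :: es = pre ++ e0 :: mid ++ e' :: post ∧
      s = S1 ++ Lw f M mid ++ S2 ∧ S1 ≠ [] ∧ S1 <:+ M ++ fw f e0 ∧ S2 ≠ [] ∧ S2 <+: M ++ fw f e') := by
      intro h
      rcases ih s hs h with ⟨e', h1, h2⟩ | ⟨pre, e0, mid, e', post, S1, S2, h1, h2⟩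
      · exact Or.inl ⟨e', List.mem_cons_of_mem _ h1, h2⟩
      · exact Or.inr ⟨e :: pre, e0, mid, e', post, S1, S2, by rw [h1]; rfl, h2⟩
    rw [Lw] at hp
    obtain ⟨a, t, ht⟩ := hp
    rw [List.append_assoc] at ht
    rcases List.append_eq_append_iff.1 ht with ⟨B', e1, e2⟩ | ⟨a', e1, e2⟩
    · by_cases hB : B' = []
      · apply lift
        rw [hB] at e2
        exact ⟨[], t, by simpa using e2⟩
      rcases List.append_eq_append_iff.1 e2 with ⟨u, e3, e4⟩ | ⟨u, e3, e4⟩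
      · left
        exact ⟨e, by simp, ⟨a, u, by rw [e1, e3]; simp⟩⟩
      · by_cases hu : u = []
        · left
          refine ⟨e, by simp, ⟨a, [], ?_⟩⟩
          rw [e1, e3, hu]; simp
        · obtain ⟨mid, e', post, S2, h1, h2, h3, h4⟩ := Lw_pre es u hu ⟨t, e4.symm⟩
          exact Or.inr ⟨[], e, mid, e', post, B', S2, by rw [h1]; rfl, by rw [e3, h2]; simp, hB,
            ⟨a, e1.symm⟩, h3, h4⟩
    · exact lift ⟨a', t, by rw [e2]; simp⟩

variable {S : IndexedStructure} {p1 p2 : ℕ}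

theorem Lw_len {f : GenSym S.A} {M : List (GenSym S.A × Bool)} {W : ℕ} (es : List ℤ)
    (h : ∀ e ∈ es, 24 * e.natAbs ≤ W) :
    24 * (Lw f M es).length ≤ es.length * (24 * M.length + W) := by
  induction es with
  | nil => simp [Lw]
  | cons e es ih =>
    have := ih (fun e he => h e (by simp [he]))
    have := h e (by simp)
    simp only [Lw, List.length_append, fw_len, List.length_cons]
    rw [add_mul]
    omega

theorem Lw_fw_inf {A : Type} {f : GenSym A} {M : List (GenSym A × Bool)} {es : List ℤ} {e : ℤ}
    (h : e ∈ es) : fw f e <:+: Lw f M es := by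
  obtain ⟨a, b, rfl⟩ := List.append_of_mem h
  exact ⟨Lw f M a ++ M, Lw f M b, by simp [Lw_append, Lw]⟩

namespace Cfg
variable {P : ℕ} {f : GenSym S.A} {x : GA S p1 p2} {y h : List (GenSym S.A × Bool)}

theorem Lw_red (C : Cfg S p1 p2 P f x y h) (es : List ℤ) (hes : ∀ e ∈ es.dropLast, e ≠ 0) :
    IsReduced (Lw f (MM y h) es) := by
  have hfw : ∀ e, IsReduced (MM y h ++ fw f e) := by
    intro e
    unfold FreeGroup.IsReduced
    rw [List.isChain_append]
    refine ⟨C.Mred, fw_red f e, ?_⟩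
    intro a ha b hb hab
    have hb' := fw_mem (List.mem_of_mem_head? hb)
    obtain ⟨m, hm⟩ := List.getLast?_eq_some_iff.1 ha
    rw [hb'] at hab
    exact absurd hm (by rw [show a = (f, a.2) from Prod.ext hab rfl]; exact C.Mlast)
  induction es with
  | nil => simp [Lw]
  | cons e es ih =>
    cases es with
    | nil => simpa [Lw] using hfw e
    | cons e' es =>
      have he : e ≠ 0 := hes e (by simp)
      have := ih (fun z hz => hes z (by simp [hz]))
      rw [Lw]
      unfold FreeGroup.IsReduced
      rw [List.isChain_append]
      refine ⟨hfw e, this, ?_⟩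
      intro a ha b hb hab
      rw [List.getLast?_append_of_ne_nil _ (by intro h0; have := fw_ne (f := f) he; rw [h0] at this; simp at this)] at ha
      have ha' := fw_mem (List.mem_of_mem_getLast? ha)
      cases hM : MM y h with
      | nil => exact absurd hM C.Mne
      | cons c m =>
        rw [Lw, hM] at hb
        simp at hb
        subst hb
        rw [ha'] at hab
        exact absurd hM (by rw [show c = (f, c.2) from Prod.ext hab.symm rfl]; exact C.Mfirst)

theorem norun (C : Cfg S p1 p2 P f x y h) {e : ℤ} {v : List (GenSym S.A × Bool)} (he : 2 * e.natAbs < P)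
    (hne : e ≠ 0) (hR : Rs S p1 p2 (fw f e ++ v)) (hv : 5 * v.length ≤ e.natAbs) : False := by
  rcases hR.cases with hR | ⟨g, s, p, hg, hw⟩
  · have := hR.fw (f := f) (i := e) ⟨[], v, by simp⟩
    rw [List.length_append, fw_len] at this
    omega
  · have hm : (f, decide (0 < e)) ∈ List.replicate p (g, s) := by
      rw [← hw]; exact List.mem_append_left _ (fw_ne hne)
    have hfg := congrArg Prod.fst (List.eq_of_mem_replicate hm)
    simp only at hfg
    have hl := congrArg List.length hw
    rw [List.length_append, fw_len, List.length_replicate] at hl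
    have hp : p = P := by
      have := C.hf
      rcases hg with ⟨a, b⟩ | ⟨a, b⟩ <;> rcases this with ⟨c, d⟩ | ⟨c, d⟩
      · rw [b, d]
      · rw [hfg, a] at c; cases c
      · rw [hfg, a] at c; cases c
      · rw [b, d]
    omega

/-- the first form of the crossing data -/
structure Cross (f : GenSym S.A) (M : List (GenSym S.A × Bool)) (es : List ℤ) (s : List (GenSym S.A × Bool))
    (i j e : ℤ) (es1 : List ℤ) (X Q P' Z : List (GenSym S.A × Bool)) : Prop where
  eq : s = fw f i ++ Q ++ fw f e ++ Lw f M es1 ++ P' ++ fw f j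
  inf : e :: es1 <:+: es.dropLast
  hQ : M = X ++ Q
  hP : M = P' ++ Z
  Qne : Q ≠ []
  Pne : P' ≠ []
  ci : i = 0 ∨ X = []
  cj : j = 0 ∨ Z = []

theorem split (C : Cfg S p1 p2 P f x y h) {es : List ℤ} (hes : ∀ e ∈ es, 2 * e.natAbs < P)
    {s v : List (GenSym S.A × Bool)} (hs : s <:+: Lw f (MM y h) es)
    (hR : Rs S p1 p2 (s ++ v)) (hv : 5 * v.length ≤ s.length) :
    ∃ i j e es1 X Q P' Z, Cross f (MM y h) es s i j e es1 X Q P' Z := by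
  have hlen := hR.len C.h1 C.h2
  rw [List.length_append] at hlen
  have hsne : s ≠ [] := by rintro rfl; simp at hv hlen; simp [hv] at hlen
  -- prefix analysis
  have hpre : ∀ {S2 e'}, S2 <+: MM y h ++ fw f e' → S2 ≠ [] → ∃ (P' Z : List (GenSym S.A × Bool)) (j : ℤ),
      S2 = P' ++ fw f j ∧ P' ≠ [] ∧ MM y h = P' ++ Z ∧ (j = 0 ∨ Z = []) := by
    rintro S2 e' ⟨t, ht⟩ hne
    rcases List.append_eq_append_iff.1 ht with ⟨u, e1, e2⟩ | ⟨u, e1, e2⟩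
    · exact ⟨S2, u, 0, by simp, hne, e1, Or.inl rfl⟩
    · obtain ⟨j, hj, _⟩ := fw_sub (u := u) (f := f) (e := e') ⟨[], t, by rw [e2]; simp⟩
      exact ⟨MM y h, [], j, by rw [e1, hj], C.Mne, by simp, Or.inr rfl⟩
  rcases Lw_inf es s hsne hs with ⟨e, he, a, t, hat⟩ | ⟨pre, e0, mid, e', post, S1, S2, h1, h2, h3, h4, h5, h6⟩
  · exfalso
    rw [List.append_assoc] at hat
    rcases List.append_eq_append_iff.1 hat with ⟨u, e1, e2⟩ | ⟨u, e1, e2⟩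
    · by_cases hu : u = []
      · rw [hu] at e2
        obtain ⟨j, hj, hj'⟩ := fw_sub (u := s) (f := f) (e := e) ⟨[], t, by simpa using e2⟩
        rw [hj] at hR hv hsne
        rw [fw_len] at hv
        have := hes e he
        exact C.norun (by omega) (by rintro rfl; simp at hsne) hR hv
      · rcases List.append_eq_append_iff.1 e2 with ⟨u', e3, e4⟩ | ⟨u', e3, e4⟩
        · exact C.nocross (i := 0) (j := 0) (X := a) (N := s) (Z := u') (v := v) (by rw [e1, e3]; simp) hsne (Or.inl rfl)
            (Or.inl rfl) (by simpa using hR) (by simpa using hv)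
        · obtain ⟨j, hj, hj'⟩ := fw_sub (u := u') (f := f) (e := e) ⟨[], t, by rw [e4]; simp⟩
          refine C.nocross (i := 0) (j := j) (X := a) (N := u) (Z := []) (v := v) (by rw [e1]; simp) hu (Or.inl rfl)
            (Or.inr rfl) (by rw [e3, hj] at hR; simpa using hR) ?_
          have := congrArg List.length e3
          rw [List.length_append, hj, fw_len] at this
          simp; omega
    · obtain ⟨j, hj, hj'⟩ := fw_sub (u := s) (f := f) (e := e) ⟨u, t, by rw [e2]; simp⟩
      rw [hj] at hR hv hsne
      rw [fw_len] at hv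
      have := hes e he
      exact C.norun (by omega) (by rintro rfl; simp at hsne) hR hv
  · obtain ⟨P', Z, j, hS2, hP', hPZ, cj⟩ := hpre h6 h5
    have hdl : es.dropLast = pre ++ e0 :: mid ++ (e' :: post).dropLast := by
      rw [h1, List.dropLast_append_of_ne_nil (by simp)]
    obtain ⟨a, ha⟩ := h4
    rcases List.append_eq_append_iff.1 ha with ⟨u, e1, e2⟩ | ⟨u, e1, e2⟩
    · -- M = a ++ u, S1 = u ++ fw e0
      by_cases hu : u = []
      · -- S1 = fw e0
        rw [hu] at e2 e1
        have e2' : S1 = fw f e0 := by simpa using e2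
        cases mid with
        | nil =>
          exfalso
          refine C.nocross (i := e0) (j := j) (X := []) (N := P') (Z := Z) (v := v) (by rw [hPZ]; simp) hP' (Or.inr rfl)
            cj (by rw [h2, e2', hS2] at hR; simpa [Lw] using hR) ?_
          have := congrArg List.length h2
          rw [e2', hS2] at this
          simp only [List.length_append, fw_len, Lw, List.length_nil] at this
          omega
        | cons e mid =>
          exact ⟨e0, j, e, mid, [], MM y h, P', Z, by rw [h2, e2', hS2]; simp [Lw],
            ⟨pre ++ [e0], (e' :: post).dropLast, by rw [hdl]; simp⟩, by simp, hPZ, C.Mne, hP', Or.inr rfl, cj⟩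
      · exact ⟨0, j, e0, mid, a, u, P', Z, by rw [h2, e2, hS2]; simp,
          ⟨pre, (e' :: post).dropLast, by rw [hdl]⟩, e1, hPZ, hu, hP', Or.inl rfl, cj⟩
    · -- S1 inside fw e0
      obtain ⟨i, hi, hi'⟩ := fw_sub (u := S1) (f := f) (e := e0) ⟨u, [], by rw [e2]; simp⟩
      cases mid with
      | nil =>
        exfalso
        refine C.nocross (i := i) (j := j) (X := []) (N := P') (Z := Z) (v := v) (by rw [hPZ]; simp) hP' (Or.inr rfl)
          cj (by rw [h2, hi, hS2] at hR; simpa [Lw] using hR) ?_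
        have := congrArg List.length h2
        rw [hi, hS2] at this
        simp only [List.length_append, fw_len, Lw, List.length_nil] at this
        omega
      | cons e mid =>
        exact ⟨i, j, e, mid, [], MM y h, P', Z, by rw [h2, hi, hS2]; simp [Lw],
          ⟨pre ++ [e0], (e' :: post).dropLast, by rw [hdl]; simp⟩, by simp, hPZ, C.Mne, hP', Or.inr rfl, cj⟩

end Cfg
end crossing

set_option linter.unusedSectionVars false
set_option linter.unusedVariables false

section crossing2
open FreeGroup
variable {S : IndexedStructure} {p1 p2 : ℕ}

namespace Cfg
variable {P : ℕ} {f : GenSym S.A} {x : GA S p1 p2} {y h : List (GenSym S.A × Bool)}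

theorem cross_nil (C : Cfg S p1 p2 P f x y h) {es : List ℤ} {s v : List (GenSym S.A × Bool)}
    {i j e : ℤ} {es1 : List ℤ} {X Q P' Z : List (GenSym S.A × Bool)}
    (X' : Cross f (MM y h) es s i j e es1 X Q P' Z) (hnz : ∀ e ∈ es.dropLast, e ≠ 0)
    (hR : Rs S p1 p2 (s ++ v)) : h = [] := by
  rcases List.eq_nil_or_concat h with h0 | ⟨h', a, h0⟩
  · exact h0
  exfalso
  rw [List.concat_eq_append] at h0
  have he : e ≠ 0 := hnz e (X'.inf.subset (by simp))
  have hf : (f, decide (0 < e)) ∈ s ++ v := by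
    rw [X'.eq]; simp [fw_ne he]
  have sg := hR.sign_f C.hf' hf
  have hQ := X'.hQ
  have hP := X'.hP
  unfold MM at hQ hP
  have haQ : a ∈ Q := by
    rcases List.eq_nil_or_concat Q with h1 | ⟨Q', b, h1⟩
    · exact absurd h1 X'.Qne
    · rw [List.concat_eq_append] at h1
      rw [h1, ← List.append_assoc, h0, ← List.append_assoc] at hQ
      have := (List.append_inj' hQ rfl).2
      rw [h1]; simp at this; simp [this]
  have haP : (a.1, !a.2) ∈ P' := by
    have e : invRev h = (a.1, !a.2) :: invRev h' := by rw [h0, invRev_app]; simp [invRev]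
    cases h1 : P' with
    | nil => exact absurd h1 X'.Pne
    | cons b t =>
      rw [h1, e] at hP
      simp at hP
      simp [hP.1]
  have s1 := sg a (by rw [X'.eq]; simp [haQ])
  have s2 := sg _ (show (a.1, !a.2) ∈ s ++ v by rw [X'.eq]; simp [haP])
  simp [s1] at s2

theorem cross (C : Cfg S p1 p2 P f x y h) {es : List ℤ} {s v : List (GenSym S.A × Bool)}
    {i j e : ℤ} {es1 : List ℤ} {X Q P' Z : List (GenSym S.A × Bool)}
    (X' : Cross f (MM y h) es s i j e es1 X Q P' Z) (hnz : ∀ e ∈ es.dropLast, e ≠ 0)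
    (hR : Rs S p1 p2 (s ++ v)) (hv : 5 * v.length ≤ s.length) (h0 : h = []) :
    NPs S (s ++ v) ∧ 8 ≤ es1.length := by
  have hM : MM y h = y := by rw [MM, h0]; simp [invRev]
  have hq : QF S p1 p2 f x (val S p1 p2 y) := by
    have := C.q
    rw [h0] at this; simpa [invRev] using this
  obtain ⟨hs, inf, hQ, hP, Qne, Pne, ci, cj⟩ := X'
  rw [hM] at hs hQ hP
  have he : e ≠ 0 := hnz e (inf.subset (by simp))
  have hNP : NPs S (s ++ v) := by
    cases h1 : P' with
    | nil => exact absurd h1 Pne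
    | cons b t =>
      refine hR.np (z := (f, decide (0 < e))) (z' := b) (by rw [hs]; simp [fw_ne he]) (by rw [hs, h1]; simp) ?_
      intro hb
      rw [h1, ← hb] at hP
      exact C.yfirst h0 hP
  refine ⟨hNP, ?_⟩
  have hlen := hR.len C.h1 C.h2
  have bi : 24 * i.natAbs ≤ (s ++ v).length := hNP.fw (f := f) ⟨[], Q ++ fw f e ++ Lw f y es1 ++ P' ++ fw f j ++ v, by
    rw [hs]; simp⟩
  have bj : 24 * j.natAbs ≤ (s ++ v).length := hNP.fw (f := f) ⟨fw f i ++ Q ++ fw f e ++ Lw f y es1 ++ P', v, by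
    rw [hs]⟩
  have be : 24 * e.natAbs ≤ (s ++ v).length := hNP.fw (f := f) ⟨fw f i ++ Q, Lw f y es1 ++ P' ++ fw f j ++ v, by
    rw [hs]; simp⟩
  have bes : ∀ e' ∈ es1, 24 * e'.natAbs ≤ (s ++ v).length := by
    intro e' he'
    refine hNP.fw (f := f) ((Lw_fw_inf (M := y) he').trans ⟨fw f i ++ Q ++ fw f e, P' ++ fw f j ++ v, ?_⟩)
    rw [hs]; simp
  have hl := congrArg List.length hs
  have lQ := congrArg List.length hQ
  have lP := congrArg List.length hP
  have pQ := List.length_pos_iff.2 Qne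
  have pP := List.length_pos_iff.2 Pne
  simp only [List.length_append, fw_len] at hl lQ lP hlen bi bj be bes
  have hhalf : ∀ {a b}, s ++ v = a ++ y ++ b → 2 * y.length ≤ s.length + v.length := by
    intro a b hab
    have := C.half (u := y) (z := []) (v := b ++ a) (by rw [List.append_nil]) (by
      rw [hab, List.append_assoc] at hR
      have := Rs.rot hR
      simpa using this)
    have hl := congrArg List.length hab
    simp only [List.length_append] at this hl
    omega
  match es1, hs, hl, bes, inf with
  | [], hs, hl, bes, inf =>
    exfalso
    simp only [Lw, List.length_nil, List.append_nil] at hl hs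
    by_cases hPQ : P'.length + Q.length ≤ y.length
    · have hi : i = 0 := by
        rcases ci with h | h
        · exact h
        · rw [h] at lQ; simp at lQ; omega
      have hj : j = 0 := by
        rcases cj with h | h
        · exact h
        · rw [h] at lP; simp at lP; omega
      rw [hi, hj] at hs hl
      simp only [fw_zero, List.nil_append, List.append_nil, Int.natAbs_zero] at hs hl
      obtain ⟨z, e1, e2⟩ : ∃ z, X = P' ++ z ∧ Z = z ++ Q := by
        rcases List.append_eq_append_iff.1 (hQ.symm.trans hP) with ⟨z, e1, e2⟩ | ⟨z, e1, e2⟩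
        · have l1 := congrArg List.length e1
          simp only [List.length_append] at l1
          have : z = [] := List.length_eq_zero_iff.1 (by omega)
          rw [this] at e1 e2
          exact ⟨[], by simpa using e1.symm, by simpa using e2.symm⟩
        · exact ⟨z, e1, e2⟩
      have hv' := hR.val
      rw [hs] at hv'
      simp only [val_append, val_fw] at hv'
      have := C.mc.min (invRev v ++ z) (by
        have h1 := KF.conj _ (val S p1 p2 P' * val S p1 p2 z)⁻¹ (kq (hq.mul 0 e))
        convert h1 using 1
        rw [val_append, val_invRev, ← hv', hQ, e1]
        simp only [val_append]
        group)
      have l1 := congrArg List.length e1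
      simp only [List.length_append, invRev_length] at this l1
      omega
    · obtain ⟨O, e1, e2⟩ : ∃ O, P' = X ++ O ∧ Q = O ++ Z := by
        rcases List.append_eq_append_iff.1 (hQ.symm.trans hP) with ⟨z, e1, e2⟩ | ⟨z, e1, e2⟩
        · exact ⟨z, e1, e2⟩
        · have l1 := congrArg List.length e1
          simp only [List.length_append] at l1
          exfalso; omega
      have hO := hNP.piece C.h1 C.h2 (a1 := fw f i) (T := O) (c1 := Z ++ fw f e ++ P' ++ fw f j ++ v)
        (a2 := fw f i ++ Q ++ fw f e ++ X) (c2 := fw f j ++ v) (by rw [hs, e2]; simp) (by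
          rw [hs, e1]; simp) (by simp; omega)
      have l1 := congrArg List.length e1
      have l2 := congrArg List.length e2
      simp only [List.length_append] at l1 l2 hO
      have hi : i = 0 := by
        rcases ci with h | h
        · exact h
        · exfalso
          have hyQ : y = Q := by rw [hQ, h]; simp
          have := hhalf (a := fw f i) (b := fw f e ++ P' ++ fw f j ++ v) (by rw [hs, hyQ]; simp)
          rw [h] at l1; simp at l1
          omega
      have hj : j = 0 := by
        rcases cj with h | h
        · exact h
        · exfalso
          have hyQ : y = P' := by rw [hP, h]; simp
          have := hhalf (a := fw f i ++ Q ++ fw f e) (b := fw f j ++ v) (by rw [hs, hyQ]; simp)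
          rw [h] at l2; simp at l2
          omega
      rw [hi, hj] at hs hl
      simp only [fw_zero, List.nil_append, List.append_nil, Int.natAbs_zero] at hs hl
      have hv' := hR.val
      rw [hs, e1] at hv'
      simp only [val_append, val_fw] at hv'
      have := C.mc.min (invRev v ++ invRev O) (by
        have h1 := KF.conj _ (val S p1 p2 X)⁻¹ (kq (hq.mul 0 e))
        convert h1 using 1
        rw [val_append, val_invRev, val_invRev, ← hv', hQ]
        simp only [val_append]
        group)
      simp only [List.length_append, invRev_length] at this
      omega
  | [e2], hs, hl, bes, inf =>
    exfalso
    have b2 := bes e2 (by simp)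
    simp only [Lw, List.append_nil, List.length_append, fw_len] at hl hs
    have hh := hhalf (a := fw f i ++ Q ++ fw f e) (b := fw f e2 ++ P' ++ fw f j ++ v) (by rw [hs]; simp)
    have kQ := hNP.piece C.h1 C.h2 (a1 := fw f i) (T := Q) (c1 := fw f e ++ (y ++ fw f e2) ++ P' ++ fw f j ++ v)
        (a2 := fw f i ++ Q ++ fw f e ++ X) (c2 := fw f e2 ++ P' ++ fw f j ++ v) (by rw [hs]; simp) (by
          conv_lhs => rw [hs, hQ]
          simp) (by simp; omega)
    have kP := hNP.piece C.h1 C.h2 (a2 := fw f i ++ Q ++ fw f e ++ y ++ fw f e2) (T := P') (c2 := fw f j ++ v)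
        (a1 := fw f i ++ Q ++ fw f e) (c1 := Z ++ fw f e2 ++ P' ++ fw f j ++ v) (by
          conv_lhs => rw [hs, hP]
          simp) (by rw [hs]; simp) (by simp; omega)
    simp only [List.length_append] at kQ kP
    omega
  | e2 :: e3 :: es2, hs, hl, bes, inf =>
    have hL := Lw_len (f := f) (M := y) (e2 :: e3 :: es2) bes
    have ky := hNP.piece C.h1 C.h2 (a1 := fw f i ++ Q ++ fw f e) (T := y)
        (c1 := fw f e2 ++ y ++ fw f e3 ++ Lw f y es2 ++ P' ++ fw f j ++ v)
        (a2 := fw f i ++ Q ++ fw f e ++ y ++ fw f e2) (c2 := fw f e3 ++ Lw f y es2 ++ P' ++ fw f j ++ v)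
        (by rw [hs]; simp [Lw]) (by rw [hs]; simp [Lw]) (by simp; omega)
    simp only [List.length_append] at ky
    by_contra hc
    push Not at hc
    have hL' : 24 * (Lw f y (e2 :: e3 :: es2)).length ≤ 7 * (24 * y.length + (s.length + v.length)) :=
      hL.trans (Nat.mul_le_mul_right _ (by omega))
    omega

/-- Main consequence of the crossing analysis. -/
theorem thmX (C : Cfg S p1 p2 P f x y h) {es : List ℤ} (hes : ∀ e ∈ es, 2 * e.natAbs < P)
    (hnz : ∀ e ∈ es.dropLast, e ≠ 0) (hne : es ≠ []) (h1 : val S p1 p2 (Lw f (MM y h) es) = 1) :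
    h = [] ∧ ∃ w es1 z t, NPs S w ∧ es1 <:+: es.dropLast ∧ 8 ≤ es1.length ∧ y = z :: t ∧
      Lw f y es1 ++ [z] <:+: w := by
  obtain ⟨s, v, hR, hv, hs⟩ := dehn' C.h1 C.h2 (C.Lw_red es hnz) (by
    cases es with
    | nil => exact absurd rfl hne
    | cons e es => simp [Lw, C.Mne]) h1
  obtain ⟨i, j, e, es1, X, Q, P', Z, hX⟩ := C.split hes hs hR hv
  have h0 := C.cross_nil hX hnz hR
  obtain ⟨hN, h8⟩ := C.cross hX hnz hR hv h0
  have hM : MM y h = y := by rw [MM, h0]; simp [invRev]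
  obtain ⟨e1, e2, e3, e4, e5, e6, _, _⟩ := hX
  cases hP' : P' with
  | nil => exact absurd hP' e6
  | cons z t =>
    refine ⟨h0, s ++ v, es1, z, t ++ Z, hN, ?_, h8, ?_, ?_⟩
    · exact (List.infix_cons (List.infix_refl es1)).trans e2
    · rw [← hM, e4, hP']; rfl
    · refine ⟨fw f i ++ Q ++ fw f e, t ++ fw f j ++ v, ?_⟩
      rw [e1, hM, hP']; simp

end Cfg
end crossing2

set_option linter.unusedSectionVars false
set_option linter.unusedVariables false

section parse
open FreeGroup
variable {S : IndexedStructure}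

theorem chain_start {lo : ℕ} {β f : GenSym S.A} (hβ : β ≠ f) {w t : List (GenSym S.A × Bool)}
    (hw : w ~r bw (f, true) (chainBs lo β)) (hs : w = (β, true) :: t) :
    ∃ C, C ~r chainBs lo β ∧ w = bw (f, true) C := by
  obtain ⟨b0, B, u, u', hc⟩ := exists_cut hw (by rw [hs]; simp)
  have hb0 : b0 ∈ chainBs lo β := hc.rot.perm.subset (by simp)
  obtain ⟨k, hk, hb⟩ := mem_chainBs hb0
  have hsp := hc.split
  have : u' = [] := by
    cases hu' : u' with
    | nil => rfl
    | cons a u'' =>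
      exfalso
      rw [hb, hu', bk] at hsp
      simp only [List.cons_append, List.nil_append, List.cons.injEq] at hsp
      have he := hc.eq
      cases hu : u with
      | nil => exact hc.ne hu
      | cons c u1 =>
        have : c ∈ List.replicate ((lo + k + 1) ^ 2) (f, true) := by rw [hsp.2, hu]; simp
        have h1 := List.eq_of_mem_replicate this
        rw [hs, hu] at he
        simp only [List.cons_append, List.cons.injEq] at he
        rw [← he.1] at h1
        exact hβ (congrArg Prod.fst h1)
  refine ⟨b0 :: B, hc.rot, ?_⟩
  rw [hc.eq, bw_cons, hsp, this]; simp

theorem run_det {α : Type*} {F : α} {t r1 r2 : List α} {m m2 : ℕ} (ht : t ≠ []) (hl : ∀ z ∈ t.getLast?, z ≠ F)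
    (h1 : t <+: List.replicate m F ++ r1) (h2 : t <+: List.replicate m2 F ++ r2)
    (hr1 : ∀ z ∈ r1.head?, z ≠ F) (hr2 : ∀ z ∈ r2.head?, z ≠ F) : m = m2 := by
  have key : ∀ {m m2 : ℕ} {r1 r2 : List α}, t <+: List.replicate m F ++ r1 → t <+: List.replicate m2 F ++ r2 →
      (∀ z ∈ r1.head?, z ≠ F) → m2 ≤ m := by
    intro m m2 r1 r2 h1 h2 hr1
    by_contra hc
    push Not at hc
    obtain ⟨u, hu⟩ := h2
    rcases List.append_eq_append_iff.1 hu with ⟨a, e1, e2⟩ | ⟨a, e1, e2⟩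
    · obtain ⟨t0, z, hz⟩ : ∃ t0 z, t = t0 ++ [z] := by
        rcases List.eq_nil_or_concat t with h | ⟨a, b, h⟩
        · exact absurd h ht
        · exact ⟨a, b, by simpa using h⟩
      have hzm : z ∈ List.replicate m2 F := by rw [e1, hz]; simp
      exact hl z (by rw [hz]; simp) (List.eq_of_mem_replicate hzm)
    · rw [e1, show m2 = m + (m2 - m) by omega, List.replicate_add, List.append_assoc,
        List.prefix_append_right_inj] at h1
      obtain ⟨q, hq⟩ := h1
      obtain ⟨d, hd⟩ : ∃ d, m2 - m = d + 1 := ⟨m2 - m - 1, by omega⟩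
      rw [hd, List.replicate_succ] at hq
      exact hr1 F (by rw [← hq]; simp) rfl
  exact le_antisymm (key h2 h1 hr2) (key h1 h2 hr1)

theorem Lw_inv {A : Type} (f : GenSym A) (y : List (GenSym A × Bool)) (es : List ℤ) :
    invRev (Lw f y es ++ y) = Lw f (invRev y) (es.reverse.map (fun e => -e)) ++ invRev y := by
  induction es with
  | nil => simp [Lw]
  | cons e es ih =>
    rw [Lw, List.append_assoc, invRev_app, ih, invRev_app, fw_neg, List.reverse_cons, List.map_append, Lw_append]
    simp [Lw]

theorem parse_pos {f : GenSym S.A} (hf : f = .f1 ∨ f = .f2) {w y t : List (GenSym S.A × Bool)} {z}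
    (hw : w ∈ NP S) {es : List ℤ} (hl : 2 ≤ es.length) (hl' : es.length ≤ 1000) (hnz : ∀ e ∈ es, e ≠ 0)
    (hnd : es.Nodup) (hy : y = z :: t) (hz : z.1 ≠ f) (hlast : ∀ z ∈ y.getLast?, z.1 ≠ f)
    (hi : Lw f y es ++ [z] <:+: w) :
    ∃ lo β, Ok lo β f ∧ y = [(β, true)] ∧ (∀ e ∈ es, 0 < e) ∧ ∃ C, C ~r chainBs lo β ∧
      es.map (fun e => e.natAbs) <+: C.map Prod.snd := by
  obtain ⟨pre, post, hpp⟩ := hi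
  obtain ⟨w', hw'⟩ : ∃ w', w' = Lw f y es ++ [z] ++ (post ++ pre) := ⟨_, rfl⟩
  have hww : w' ∈ NP S := NP.rot hw (by
    rw [← hpp, hw']
    have := List.isRotated_append (l := Lw f y es ++ [z] ++ post) (l' := pre)
    simpa using this)
  have hww0 := hww
  obtain ⟨Y, Bs, hSh, hrot⟩ := hww
  obtain ⟨e1, e2, es', hes⟩ : ∃ e1 e2 es', es = e1 :: e2 :: es' := by
    match es, hl with
    | e1 :: e2 :: es', _ => exact ⟨e1, e2, es', rfl⟩
  have hfm : ∀ e ∈ es, (f, decide (0 < e)) ∈ w' := fun e he => by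
    rw [hw', List.mem_append, List.mem_append]
    exact Or.inl (Or.inl ((Lw_fw_inf he).subset (fw_ne (hnz e he))))
  obtain ⟨lo, β, hok, hBs⟩ := hSh.chain_of_letter (hrot.perm.subset (hfm e1 (by simp [hes]))) (f_ne hf).1 (f_ne hf).2
  have hp := hok.props
  have hlet : ∀ c ∈ w', c = (β, true) ∨ c = (Y, true) := by
    intro c hc
    obtain ⟨b, hb, hcb⟩ := bw_mem (hrot.perm.subset hc)
    rcases hcb with hcb | hcb
    · rw [hBs] at hb
      obtain ⟨k, _, hk⟩ := mem_chainBs hb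
      rw [hk] at hcb
      left; simpa using hcb
    · exact Or.inr hcb
  have hpos : ∀ e ∈ es, 0 < e := by
    intro e he
    have := hlet _ (hfm e he)
    rcases this with h | h <;> simpa using congrArg Prod.snd h
  have hfe : ∀ e ∈ es, fw f e = List.replicate e.natAbs (f, true) := by
    intro e he
    rw [fw, decide_eq_true (hpos e he)]
  have hfY : f = β ∨ f = Y := by
    rcases hlet _ (hfm e1 (by simp [hes])) with h | h
    · left; simpa using congrArg Prod.fst h
    · right; simpa using congrArg Prod.fst h
  rcases hfY with hfb | hfY
  · -- `f = β`
    exfalso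
    obtain ⟨e, he, he2⟩ : ∃ e ∈ es, 2 ≤ e.natAbs := by
      by_contra hc
      push Not at hc
      have a1 := hc e1 (by simp [hes])
      have a2 := hc e2 (by simp [hes])
      have b1 := hpos e1 (by simp [hes])
      have b2 := hpos e2 (by simp [hes])
      have : e1 = e2 := by omega
      rw [hes, this] at hnd
      simp at hnd
    have hinf : [(f, true), (f, true)] <:+: w' := by
      refine List.IsInfix.trans ?_ ((Lw_fw_inf (f := f) (M := y) he).trans ⟨[], [z] ++ (post ++ pre), ?_⟩)
      · rw [hfe e he]
        exact ⟨[], List.replicate (e.natAbs - 2) (f, true), by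
          rw [show e.natAbs = 2 + (e.natAbs - 2) by omega, List.replicate_add]; simp [List.replicate]⟩
      · rw [hw']; simp
    obtain ⟨b0, b1, b2, r, u, u', hW⟩ := exists_win hSh hrot
    exact hW.noYY (by rw [hfb]; exact hp.1) (f_ne hf).1 hinf
  · -- `f = Y`
    rw [← hfY] at hrot hok hp hlet
    have hzβ : ∀ c ∈ w', c.1 ≠ f → c = (β, true) := by
      intro c hc hcf
      rcases hlet c hc with h | h
      · exact h
      · rw [h] at hcf; exact absurd rfl hcf
    have hywsub : ∀ c ∈ y, c ∈ w' := by
      intro c hc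
      rw [hw', hes]; simp [Lw, hc]
    have hz' : z = (β, true) := hzβ z (hywsub z (by simp [hy])) hz
    have hw1 : w' = y ++ fw f e1 ++ (y ++ (fw f e2 ++ Lw f y es' ++ [z] ++ (post ++ pre))) := by
      rw [hw', hes]; simp [Lw]
    rw [hBs] at hrot
    obtain ⟨C, hC, hwC⟩ := chain_start hp.1 hrot (t := t ++ fw f e1 ++ (y ++ (fw f e2 ++ Lw f y es' ++ [z] ++ (post ++ pre))))
      (by rw [hw1, hy, hz']; simp)
    have hCn : (chainBs lo β).Nodup := List.Nodup.of_map _ ((Sh.chain lo β f hok).nodup)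
    have hCG : GoodB (f, true) C := fun b hb => (Sh.chain lo β f hok).good b (hC.perm.subset hb)
    have htn : t = [] := by
      by_contra htn
      obtain ⟨w2, hw2⟩ : ∃ w2, w2 = (y ++ (fw f e2 ++ Lw f y es' ++ [z] ++ (post ++ pre))) ++ (y ++ fw f e1) := ⟨_, rfl⟩
      have hr2 : w2 ~r bw (f, true) (chainBs lo β) := by
        refine List.IsRotated.trans ?_ hrot
        rw [hw2, hw1]; exact List.isRotated_append
      obtain ⟨C2, hC2, hwC2⟩ := chain_start hp.1 hr2 (t := (t ++ (fw f e2 ++ Lw f y es' ++ [z] ++ (post ++ pre))) ++ (y ++ fw f e1))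
        (by rw [hw2, hy, hz']; simp)
      have main : ∀ {C : List (List (GenSym S.A × Bool) × ℕ)} {q}, C ~r chainBs lo β → y ++ q = bw (f, true) C →
          ∃ m C', C = ([(β, true)], m) :: C' ∧ ∃ r, (∀ z ∈ r.head?, z ≠ (f, true)) ∧
            t <+: List.replicate m (f, true) ++ r := by
        intro C q hC hq
        cases hC0 : C with
        | nil => rw [hC0, hy] at hq; simp at hq
        | cons b C' =>
          rw [hC0] at hC hq
          obtain ⟨k, _, hk⟩ := mem_chainBs (hC.perm.subset (List.mem_cons_self))
          have hG : GoodB (f, true) C' := fun b hb => (Sh.chain lo β f hok).good b (hC.perm.subset (by simp [hb]))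
          refine ⟨(lo + k + 1) ^ 2, C', by rw [hk], bw (f, true) C', ?_, q, ?_⟩
          · have := head_bw hG (r := []) (by simp)
            simpa using this
          · rw [bw_cons, hk, bk, hy, hz'] at hq
            simpa using hq
      obtain ⟨m, C', hm, r, hr, ht⟩ := main hC (q := fw f e1 ++ (y ++ (fw f e2 ++ Lw f y es' ++ [z] ++ (post ++ pre))))
        (by rw [← hwC, hw1]; simp)
      obtain ⟨m2, C2', hm2, r2, hr2', ht2⟩ := main hC2 (q := (fw f e2 ++ Lw f y es' ++ [z] ++ (post ++ pre)) ++ (y ++ fw f e1))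
        (by rw [← hwC2, hw2]; simp)
      have hmm : m = m2 := run_det htn (by
        intro c hc h
        refine hlast c ?_ (by rw [h])
        rw [hy, List.getLast?_cons_of_ne_nil htn]; exact hc) ht ht2 hr hr2'
      rw [← hmm] at hm2
      have hCC : C' = C2' := rot_cons_eq (a := ([(β, true)], m)) (by
        rw [← hm, ← hm2]; exact hC.trans hC2.symm) (by
        rw [← hm2]; exact hC2.perm.nodup_iff.2 hCn)
      have hwe : w' = w2 := by rw [hwC, hwC2, hm, hm2, hCC]
      rw [hw1] at hww0
      rcases NP.comm hww0 (by rw [← hw1, hwe, hw2]) with h | h <;> simp [hy] at h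
    have hy1 : y = [(β, true)] := by rw [hy, htn, hz']
    refine ⟨lo, β, hok, hy1, hpos, C, hC, ?_⟩
    have hL : ∀ es : List ℤ, (∀ e ∈ es, fw f e = List.replicate e.natAbs (f, true)) →
        Lw f y es = bw (f, true) (es.map (fun e => ([(β, true)], e.natAbs))) := by
      intro es
      induction es with
      | nil => intro _; rfl
      | cons e es ih =>
        intro h
        rw [Lw, ih (fun e he => h e (by simp [he])), h e (by simp), hy1]; rfl
    have := parse_blocks (Y := (f, true)) (es.map (fun e => ([(β, true)], e.natAbs))) C z [] (by
        intro b hb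
        simp only [List.mem_map] at hb
        obtain ⟨e, he, rfl⟩ := hb
        refine ⟨by simp, by simp [Ne.symm hp.1], ?_⟩
        have := hpos e he
        show 1 ≤ e.natAbs
        omega) hCG (by intro h; exact hz (by rw [h])) (by simp) (by
        rw [hC.perm.length_eq]; simpa [chainBs] using hl') (by
        rw [← hL es hfe]
        exact ⟨post ++ pre, by rw [List.append_nil, ← hwC, hw']⟩)
    have := this.map Prod.snd
    simpa [Function.comp_def] using this

end parse

set_option linter.unusedSectionVars false
set_option linter.unusedVariables false

section mainlemma
open FreeGroup
variable {S : IndexedStructure} {p1 p2 : ℕ}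

theorem arith_pos {P : ℕ} (hP : P.Prime) (hb : 10 ^ 10 < P) {l s0 : ℤ} {N N' : ℕ} (hN : N ≤ 10000)
    (hN' : N' ≤ 10000)
    (h : ∀ d : ℕ, d < 3 → (P : ℤ) ∣ l * ((N : ℤ) + d) ^ 2 + s0 - ((N' : ℤ) + d) ^ 2) :
    (P : ℤ) ∣ l - 1 ∧ N = N' ∧ (P : ℤ) ∣ s0 := by
  have hP' : Prime (P : ℤ) := Nat.prime_iff_prime_int.1 hP
  have h0 := h 0 (by norm_num)
  have h1 := h 1 (by norm_num)
  have h2 := h 2 (by norm_num)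
  push_cast at h0 h1 h2
  have hd : (P : ℤ) ∣ 2 * (l - 1) := by
    have := dvd_add (dvd_sub h2 h1) (dvd_sub h0 h1)
    ring_nf at this ⊢; exact this
  have hl : (P : ℤ) ∣ l - 1 := by
    rcases hP'.dvd_or_dvd hd with h | h
    · have := Int.le_of_dvd (by norm_num) h
      omega
    · exact h
  have he : (P : ℤ) ∣ 2 * ((N : ℤ) - N') := by
    have := dvd_sub (dvd_sub h1 h0) (hl.mul_right (2 * N + 1))
    ring_nf at this ⊢; exact this
  have hNN : N = N' := by
    have := Int.eq_zero_of_abs_lt_dvd he (by rw [abs_lt]; omega)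
    omega
  refine ⟨hl, hNN, ?_⟩
  have := dvd_sub h0 (hl.mul_right ((N : ℤ) ^ 2))
  rw [hNN] at this; ring_nf at this; exact this

theorem arith_neg {P : ℕ} (hP : P.Prime) (hb : 10 ^ 10 < P) {l s0 : ℤ} {N N' : ℕ} (hN : N ≤ 10000)
    (hN' : N' ≤ 10000)
    (h : ∀ d : ℕ, d < 3 → (P : ℤ) ∣ l * ((N : ℤ) + 2 - d) ^ 2 + s0 + ((N' : ℤ) + d) ^ 2) : False := by
  have hP' : Prime (P : ℤ) := Nat.prime_iff_prime_int.1 hP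
  have h0 := h 0 (by norm_num)
  have h1 := h 1 (by norm_num)
  have h2 := h 2 (by norm_num)
  push_cast at h0 h1 h2
  have hd : (P : ℤ) ∣ 2 * (l + 1) := by
    have := dvd_add (dvd_sub h2 h1) (dvd_sub h0 h1)
    ring_nf at this ⊢; exact this
  have hl : (P : ℤ) ∣ l + 1 := by
    rcases hP'.dvd_or_dvd hd with h | h
    · have := Int.le_of_dvd (by norm_num) h
      omega
    · exact h
  have he : (P : ℤ) ∣ 2 * N + 2 * N' + 4 := by
    have := dvd_add (dvd_sub h1 h0) (hl.mul_right (2 * N + 3))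
    ring_nf at this ⊢; exact this
  have := Int.le_of_dvd (by positivity) he
  omega

theorem no_wrap (n n' : ℕ) : ∃ i0 ≤ 4, (n + (i0 + 1)) % 1000 = (n + i0) % 1000 + 1 ∧
    (n + (i0 + 2)) % 1000 = (n + i0) % 1000 + 2 ∧ (n' + (i0 + 1)) % 1000 = (n' + i0) % 1000 + 1 ∧
    (n' + (i0 + 2)) % 1000 = (n' + i0) % 1000 + 2 := by
  by_contra hc
  push Not at hc
  have a := hc 0 (by norm_num)
  have b := hc 2 (by norm_num)
  have c := hc 4 (by norm_num)
  omega

theorem no_wrap' (n n' : ℕ) (hn : 6 ≤ n) : ∃ i0 ≤ 4, (n - (i0 + 1)) % 1000 = (n - (i0 + 2)) % 1000 + 1 ∧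
    (n - i0) % 1000 = (n - (i0 + 2)) % 1000 + 2 ∧ (n' + (i0 + 1)) % 1000 = (n' + i0) % 1000 + 1 ∧
    (n' + (i0 + 2)) % 1000 = (n' + i0) % 1000 + 2 := by
  by_contra hc
  push Not at hc
  have a := hc 0 (by norm_num)
  have b := hc 2 (by norm_num)
  have c := hc 4 (by norm_num)
  omega

/-- list indexing facts -/
theorem infix_get {α : Type*} {a l : List α} (h : a <:+: l) : ∃ p, p + a.length ≤ l.length ∧
    ∀ i, (hi : i < a.length) → l[p + i]? = some a[i] := by
  obtain ⟨u, v, rfl⟩ := h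
  refine ⟨u.length, by simp, fun i hi => ?_⟩
  rw [List.append_assoc, List.getElem?_append_right (by omega), Nat.add_sub_cancel_left,
    List.getElem?_append_left hi, List.getElem?_eq_getElem hi]

theorem rot_get {α : Type*} (g : ℕ → α) (k j : ℕ) (hj : j < 1000) :
    (((List.range 1000).map g).rotate k)[j]? = some (g ((j + k) % 1000)) := by
  rw [List.getElem?_rotate (by simpa using hj)]
  rw [List.length_map, List.length_range, List.getElem?_map, List.getElem?_range (Nat.mod_lt _ (by norm_num))]
  rfl

namespace Cfg
variable {P : ℕ} {f : GenSym S.A} {x : GA S p1 p2} {y h : List (GenSym S.A × Bool)}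

theorem thmY (C : Cfg S p1 p2 P f x y h) {es : List ℤ} (hes : ∀ e ∈ es, 2 * e.natAbs < P)
    (hnz : ∀ e ∈ es.dropLast, e ≠ 0) (hlen : es.length = 1000) (hnd : es.Nodup)
    (h1 : val S p1 p2 (Lw f (MM y h) es) = 1) :
    h = [] ∧ ∃ lo β, Ok lo β f ∧ ∃ es2 C', C' ~r chainBs lo β ∧ 7 ≤ es2.length ∧
      (∀ e ∈ es2, 0 < e) ∧ es2.map (fun e => e.natAbs) <+: C'.map Prod.snd ∧
      ((y = [(β, true)] ∧ es2 <:+: es) ∨ es2 <:+: es.reverse.map (fun e => -e)) := by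
  obtain ⟨h0, w, es1, z, t, hw, hi, h8, hy, hL⟩ := C.thmX hes hnz (by rintro rfl; simp at hlen) h1
  refine ⟨h0, ?_⟩
  have hsub : es1 <:+: es := hi.trans (dropLast_pre es).isInfix
  have hle : es1.length ≤ 1000 := hlen ▸ hsub.length_le
  have hnd1 : es1.Nodup := hnd.sublist hsub.sublist
  have hnz1 : ∀ e ∈ es1, e ≠ 0 := fun e he => hnz e (hi.subset he)
  have hz : z.1 ≠ f := by
    intro hz
    exact C.yfirst h0 (s := z.2) (y0 := t) (by rw [hy, ← hz])
  have hyl : ∀ z ∈ y.getLast?, z.1 ≠ f := by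
    intro c hc hcf
    obtain ⟨y0, hy0⟩ := List.getLast?_eq_some_iff.1 hc
    exact C.ylast h0 (s := c.2) (y0 := y0) (by rw [hy0, ← hcf])
  rcases hw with hw | hw
  · obtain ⟨lo, β, hok, hyb, hpos, C', hC', hp⟩ := parse_pos C.hf' hw (by omega) hle hnz1 hnd1 hy hz hyl hL
    exact ⟨lo, β, hok, es1, C', hC', by omega, hpos, hp, Or.inl ⟨hyb, hsub⟩⟩
  · obtain ⟨es2, en, hes2⟩ : ∃ es2 en, es1 = es2 ++ [en] := by
      rcases List.eq_nil_or_concat es1 with h | ⟨a, b, h⟩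
      · rw [h] at h8; simp at h8
      · exact ⟨a, b, by simpa using h⟩
    have l2 : es1.length = es2.length + 1 := by rw [hes2]; simp
    have hinf : Lw f (invRev y) (es2.reverse.map (fun e => -e)) ++ invRev y <:+: invRev w := by
      rw [← Lw_inv]
      obtain ⟨a, b, hab⟩ := hL
      rw [hes2, Lw_append] at hab
      refine ⟨invRev (fw f en ++ [z] ++ b), invRev a, ?_⟩
      rw [← invRev_app, ← invRev_app, ← hab]
      simp [Lw]
    obtain ⟨y0, c, hyc⟩ : ∃ y0 c, y = y0 ++ [c] := by
      rcases List.eq_nil_or_concat y with h | ⟨a, b, h⟩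
      · exact absurd h C.yne
      · exact ⟨a, b, by simpa using h⟩
    have hiy : invRev y = (c.1, !c.2) :: invRev y0 := by rw [hyc, invRev_app]; simp [invRev]
    obtain ⟨lo, β, hok, hyb, hpos, C', hC', hp⟩ := parse_pos C.hf' hw (es := es2.reverse.map (fun e => -e))
      (by simp; omega) (by simp; omega) (by
        intro e he
        simp only [List.mem_map, List.mem_reverse] at he
        obtain ⟨e', he', rfl⟩ := he
        have := hnz1 e' (by simp [hes2, he'])
        omega) (by
        refine List.Nodup.map neg_injective (List.nodup_reverse.2 ?_)
        rw [hes2] at hnd1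
        exact (List.nodup_append.1 hnd1).1) hiy (hyl c (by rw [hyc]; simp)) (by
        intro d hd hdf
        have : invRev y = invRev t ++ [(z.1, !z.2)] := by
          rw [hy, ← List.singleton_append, invRev_app]; simp [invRev]
        rw [this] at hd
        simp at hd
        rw [← hd] at hdf
        exact hz hdf) (by
        refine List.IsInfix.trans ?_ hinf
        rw [hiy]
        exact ⟨[], invRev y0, by simp⟩)
    refine ⟨lo, β, hok, _, C', hC', by simp; omega, hpos, hp, Or.inr ?_⟩
    obtain ⟨a, b, hab⟩ := hsub
    refine ⟨(([en] ++ b).reverse).map (fun e => -e), a.reverse.map (fun e => -e), ?_⟩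
    rw [← hab, hes2]
    simp

end Cfg
end mainlemma

set_option linter.unusedSectionVars false
set_option linter.unusedVariables false

section mainlemma2
open FreeGroup
variable {S : IndexedStructure} {p1 p2 : ℕ}

theorem val_Lw (f : GenSym S.A) (M : List (GenSym S.A × Bool)) (es : List ℤ) :
    val S p1 p2 (Lw f M es) = (es.map fun e => val S p1 p2 M * FF S p1 p2 f ^ e).prod := by
  induction es with
  | nil => simp [Lw, val_nil]
  | cons e es ih => 
    rw [List.map_cons, List.prod_cons, ← ih]
    simp only [Lw, val_append, val_fw]

theorem prod_conj {G : Type*} [Group G] (g : G) (l : List G) :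
    (l.map fun z => g * z * g⁻¹).prod = g * l.prod * g⁻¹ := by
  induction l with
  | nil => simp
  | cons a l ih => simp [ih]

theorem small_rep {P : ℕ} (hP : P % 2 = 1) (m : ℤ) : ∃ e : ℤ, (P : ℤ) ∣ m - e ∧ 2 * e.natAbs < P := by
  have h0 := Int.emod_nonneg m (b := P) (by omega)
  have h1 := Int.emod_lt_of_pos m (b := P) (by omega)
  have h2 : (P : ℤ) ∣ m - m % P := Int.dvd_self_sub_emod
  by_cases h : 2 * (m % P) < P
  · exact ⟨m % P, h2, by omega⟩
  · refine ⟨m % P - P, ?_, by omega⟩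
    have := dvd_add h2 (dvd_refl (P : ℤ))
    rwa [← sub_add] 

theorem prefix_get {α : Type*} {a l : List α} (h : a <+: l) {i : ℕ} (hi : i < a.length) :
    l[i]? = some a[i] := by
  obtain ⟨v, rfl⟩ := h
  rw [List.getElem?_append_left hi, List.getElem?_eq_getElem hi]

theorem zpow_congr {G : Type*} [Group G] {F : G} {P : ℕ} (hF : F ^ P = 1) {m e : ℤ}
    (h : (P : ℤ) ∣ m - e) : F ^ m = F ^ e := by
  obtain ⟨q, hq⟩ := h
  have : m = P * q + e := by omega
  rw [this, zpow_add, zpow_mul, zpow_natCast, hF, one_zpow, one_mul]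

theorem FF_pow {P : ℕ} {f : GenSym S.A} (hf : (f = .f1 ∧ P = p1) ∨ (f = .f2 ∧ P = p2)) :
    FF S p1 p2 f ^ P = 1 := by
  unfold FF
  rw [← val_repl]
  apply val_rel
  left
  rcases hf with ⟨h, h'⟩ | ⟨h, h'⟩ <;> rw [h, h']
  · exact Or.inr (by simp)
  · exact Or.inr (by simp)

/-- the combinatorial core, indices -/
theorem idx_core {Q : Prop} {P : ℕ} (hP : P.Prime) (hb : 10 ^ 10 < P) {l s0 : ℤ} {E : ℕ → ℤ} {lo lo' k : ℕ}
    (hlo : lo = 1000 ∨ lo = 2000 ∨ lo = 3000 ∨ lo = 4000)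
    (hlo' : lo' = 0 ∨ lo' = 1000 ∨ lo' = 2000 ∨ lo' = 3000 ∨ lo' = 4000)
    (hE : ∀ j, (P : ℤ) ∣ (l * ((lo : ℤ) + j + 1) ^ 2 + s0) - E j)
    {es es2 : List ℤ} (hes : es = ((List.range 1000).map E).rotate k) {C : List ℕ} {n' : ℕ}
    (hC : C = ((List.range 1000).map fun j => (lo' + j + 1) ^ 2).rotate n')
    (h7 : 7 ≤ es2.length) (hpos : ∀ e ∈ es2, 0 < e)
    (hp : es2.map (fun e => e.natAbs) <+: C)
    (hi : (Q ∧ es2 <:+: es) ∨ es2 <:+: es.reverse.map (fun e => -e)) :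
    Q ∧ (P : ℤ) ∣ l - 1 ∧ lo = lo' ∧ (P : ℤ) ∣ s0 := by
  have hel : es.length = 1000 := by rw [hes]; simp
  have hv : ∀ i, (hi : i < es2.length) → i < 7 → es2[i] = ((lo' : ℤ) + (n' + i) % 1000 + 1) ^ 2 := by
    intro i hi h7
    have := prefix_get hp (i := i) (by simpa using hi)
    rw [hC, rot_get _ _ _ (by omega)] at this
    have h2 := Option.some.inj this
    simp only [List.getElem_map] at h2
    have h3 := hpos es2[i] (List.getElem_mem hi)
    have h4 : es2[i] = (es2[i].natAbs : ℤ) := by omega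
    rw [h4, ← h2, Nat.add_comm i n']
    push_cast
    ring
  rcases hi with ⟨hq, hi⟩ | hi
  · refine ⟨hq, ?_⟩
    obtain ⟨p, hpl, hg⟩ := infix_get hi
    have hval : ∀ i, i < 7 → E ((p + k + i) % 1000) = ((lo' : ℤ) + (n' + i) % 1000 + 1) ^ 2 := by
      intro i hi7
      have h1 := hg i (by omega)
      rw [hes, rot_get _ _ _ (by omega)] at h1
      rw [← hv i (by omega) hi7, ← Option.some.inj h1]
      congr 2; omega
    obtain ⟨i0, hi0, a1, a2, b1, b2⟩ := no_wrap (p + k) n'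
    have := arith_pos hP hb (l := l) (s0 := s0) (N := lo + 1 + (p + k + i0) % 1000)
      (N' := lo' + 1 + (n' + i0) % 1000) (by omega) (by omega) (by
        intro d hd
        have h1 := hE ((p + k + (i0 + d)) % 1000)
        rw [hval (i0 + d) (by omega)] at h1
        have e1 : (p + k + (i0 + d)) % 1000 = (p + k + i0) % 1000 + d := by
          interval_cases d <;> [rfl; exact a1; exact a2]
        have e2 : (n' + (i0 + d)) % 1000 = (n' + i0) % 1000 + d := by
          interval_cases d <;> [rfl; exact b1; exact b2]
        have e2' : ((n' : ℤ) + ((i0 + d : ℕ) : ℤ)) % 1000 = ((n' : ℤ) + i0) % 1000 + d := by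
          exact_mod_cast e2
        rw [e1, e2'] at h1
        push_cast at h1 ⊢
        convert h1 using 2 <;> ring)
    refine ⟨this.1, ?_, this.2.2⟩
    have := this.2.1
    omega
  · exfalso
    obtain ⟨p, hpl, hg⟩ := infix_get hi
    rw [List.length_map, List.length_reverse, hel] at hpl
    have hval : ∀ i, i < 7 → E ((999 - p + k - i) % 1000) = -((lo' : ℤ) + (n' + i) % 1000 + 1) ^ 2 := by
      intro i hi7
      have h1 := hg i (by omega)
      rw [List.getElem?_map, List.getElem?_reverse (by omega), hel, hes, rot_get _ _ _ (by omega)] at h1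
      rw [← hv i (by omega) hi7, ← Option.some.inj h1, neg_neg]
      congr 2; omega
    obtain ⟨i0, hi0, a1, a2, b1, b2⟩ := no_wrap' (999 - p + k) n' (by omega)
    refine arith_neg hP hb (l := l) (s0 := s0) (N := lo + 1 + (999 - p + k - (i0 + 2)) % 1000)
      (N' := lo' + 1 + (n' + i0) % 1000) (by omega) (by omega) (by
        intro d hd
        have h1 := hE ((999 - p + k - (i0 + d)) % 1000)
        rw [hval (i0 + d) (by omega)] at h1
        have e1 : (((999 - p + k - (i0 + d)) % 1000 : ℕ) : ℤ) = ((999 - p + k - (i0 + 2)) % 1000 : ℕ) + 2 - d := by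
          interval_cases d
          · rw [Nat.add_zero, a2]; push_cast; ring
          · rw [a1]; push_cast; ring
          · push_cast; ring
        have e2 : (n' + (i0 + d)) % 1000 = (n' + i0) % 1000 + d := by
          interval_cases d <;> [rfl; exact b1; exact b2]
        have e2' : ((n' : ℤ) + ((i0 + d : ℕ) : ℤ)) % 1000 = ((n' : ℤ) + i0) % 1000 + d := by
          exact_mod_cast e2
        rw [e1, e2'] at h1
        generalize (999 - p + k - (i0 + 2)) % 1000 = Q' at *
        push_cast at h1 ⊢
        convert h1 using 1 <;> ring)

theorem ML {P : ℕ} {f : GenSym S.A} {x : GA S p1 p2} (h1 : 10 ^ 10 < p1) (h2 : 10 ^ 10 < p2)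
    (hf : (f = .f1 ∧ P = p1) ∨ (f = .f2 ∧ P = p2)) (hP : P.Prime) {lo : ℕ}
    (hlo : lo = 1000 ∨ lo = 2000 ∨ lo = 3000 ∨ lo = 4000) {l : ℤ} (hl : ¬ (P : ℤ) ∣ l)
    (hx : ∀ i : ℤ, x ≠ FF S p1 p2 f ^ i) (hc : chainProd lo x (FF S p1 p2 f ^ l) = 1) :
    (P : ℤ) ∣ l - 1 ∧ ∃ β, ∃ i : ℤ, Ok lo β f ∧
      x = FF S p1 p2 f ^ i * FF S p1 p2 β * (FF S p1 p2 f ^ i)⁻¹ := by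
  obtain ⟨y, h, C⟩ := exists_cfg h1 h2 hf hx
  obtain ⟨a, b, hab⟩ := C.q
  have hb : 10 ^ 10 < P := by rcases hf with h | h <;> omega
  have hodd : P % 2 = 1 := hP.eq_two_or_odd.resolve_left (by omega)
  have hF := FF_pow (S := S) hf
  set F := FF S p1 p2 f with hFdef
  choose red hred1 hred2 using small_rep hodd
  obtain ⟨E, hE⟩ : ∃ E : ℕ → ℤ, E = fun j : ℕ => red (l * ((lo : ℤ) + j + 1) ^ 2 + (-(a + b))) := ⟨_, rfl⟩
  have hE1 : ∀ j, (P : ℤ) ∣ (l * ((lo : ℤ) + j + 1) ^ 2 + (-(a + b))) - E j := by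
    intro j; rw [hE]; exact hred1 _
  have hE2 : ∀ j, 2 * (E j).natAbs < P := by
    intro j; rw [hE]; exact hred2 _
  have hP' : Prime (P : ℤ) := Nat.prime_iff_prime_int.1 hP
  have hinj : ∀ i < 1000, ∀ j < 1000, E i = E j → i = j := by
    intro i hi j hj hij
    have := dvd_sub (hE1 i) (hE1 j)
    rw [hij] at this
    have h3 : (P : ℤ) ∣ l * (((i : ℤ) - j) * (2 * lo + i + j + 2)) := by
      have e : l * (((i : ℤ) - j) * (2 * lo + i + j + 2)) = l * ((lo : ℤ) + i + 1) ^ 2 + (-(a + b)) - E j - (l * ((lo : ℤ) + j + 1) ^ 2 + (-(a + b)) - E j) := by ring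
      rw [e]; exact this
    have h4 := (hP'.dvd_or_dvd h3).resolve_left hl
    rcases hP'.dvd_or_dvd h4 with h5 | h5
    · have := Int.eq_zero_of_abs_lt_dvd h5 (by rw [abs_lt]; omega)
      omega
    · have := Int.le_of_dvd (by positivity) h5
      omega
  have hnd : ((List.range 1000).map E).Nodup := by
    refine List.Nodup.map_on ?_ List.nodup_range
    intro i hi j hj
    exact hinj i (List.mem_range.1 hi) j (List.mem_range.1 hj)
  have hprod : (((List.range 1000).map E).map fun e => val S p1 p2 (Cfg.MM y h) * F ^ e).prod = 1 := by
    have : ((List.range 1000).map E).map (fun e => val S p1 p2 (Cfg.MM y h) * F ^ e) =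
        ((List.range 1000).map fun k => x * (F ^ l) ^ ((lo + k + 1) ^ 2)).map
          (fun z => F ^ a * z * (F ^ a)⁻¹) := by
      rw [List.map_map, List.map_map]
      refine List.map_congr_left fun j hj => ?_
      show val S p1 p2 (Cfg.MM y h) * F ^ (E j) = F ^ a * (x * (F ^ l) ^ ((lo + j + 1) ^ 2)) * (F ^ a)⁻¹
      rw [← zpow_congr hF (hE1 j)]
      unfold Cfg.MM
      rw [hab, ← zpow_natCast (F ^ l), ← zpow_mul, ← zpow_neg]
      simp only [mul_assoc]
      rw [← zpow_add, ← zpow_add]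
      have e : b + (l * ((lo : ℤ) + j + 1) ^ 2 + -(a + b)) = l * (((lo + j + 1) ^ 2 : ℕ) : ℤ) + -a := by
        push_cast
        ring
      rw [e]
    have hc' : ((List.range 1000).map fun k => x * (F ^ l) ^ ((lo + k + 1) ^ 2)).prod = 1 := by
      unfold chainProd at hc; exact hc
    rw [this, prod_conj, hc', mul_one, mul_inv_cancel]
  obtain ⟨k, hk⟩ : ∃ k, ∀ e ∈ (((List.range 1000).map E).rotate k).dropLast, e ≠ 0 := by
    by_cases hz : ∃ k0 < 1000, E k0 = 0
    · obtain ⟨k0, hk0, hz⟩ := hz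
      refine ⟨k0 + 1, ?_⟩
      have hnd' := (List.nodup_rotate (n := k0 + 1)).2 hnd
      have hg := rot_get E (k0 + 1) 999 (by norm_num)
      have hlen : (((List.range 1000).map E).rotate (k0 + 1)).length = 1000 := by simp
      generalize ((List.range 1000).map E).rotate (k0 + 1) = R at *
      rw [show (999 + (k0 + 1)) % 1000 = k0 by omega, hz] at hg
      have hne : R ≠ [] := by intro h; rw [h] at hlen; simp at hlen
      have hlast : R.getLast hne = 0 := by
        rw [List.getLast_eq_getElem]
        have := List.getElem?_eq_some_iff.1 hg
        obtain ⟨q, hq⟩ := this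
        simp only [hlen]
        exact hq
      intro e he he0
      have hsplit := List.dropLast_append_getLast hne
      rw [← hsplit] at hnd'
      have := (List.nodup_append.1 hnd').2.2 e he (R.getLast hne) (by simp)
      exact this (by rw [he0, hlast])
    · push Not at hz
      refine ⟨0, fun e he => ?_⟩
      rw [List.rotate_zero] at he
      have := List.mem_of_mem_dropLast he
      obtain ⟨j, hj, rfl⟩ := List.mem_map.1 this
      exact hz j (List.mem_range.1 hj)
  obtain ⟨es, hes⟩ : ∃ es, es = ((List.range 1000).map E).rotate k := ⟨_, rfl⟩
  rw [← hes] at hk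
  have hY := C.thmY (es := es) (by
    intro e he
    rw [hes, List.mem_rotate] at he
    obtain ⟨j, hj, rfl⟩ := List.mem_map.1 he
    exact hE2 j) hk (by rw [hes]; simp) (by rw [hes]; exact List.nodup_rotate.2 hnd) (by
    rw [val_Lw, hes, List.map_rotate]
    exact List.prod_rotate_eq_one_of_prod_eq_one hprod k)
  obtain ⟨h0, lo', β, hok, es2, C', hC', h7, hpos, hpre, hi⟩ := hY
  obtain ⟨n', hn'⟩ := hC'.symm
  have hCm : C'.map Prod.snd = ((List.range 1000).map fun j => (lo' + j + 1) ^ 2).rotate n' := by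
    rw [← hn', List.map_rotate]
    unfold chainBs
    rw [List.map_map]
    rfl
  obtain ⟨hyb, hl1, hll, hs0⟩ := idx_core hP hb hlo hok.props.2.2.2 hE1 hes hCm h7 hpos hpre
    hi
  refine ⟨hl1, β, -a, hll ▸ hok, ?_⟩
  have hab1 : F ^ (a + b) = 1 := by
    have := zpow_congr hF (m := a + b) (e := 0) (by simpa using (dvd_neg.2 hs0))
    simpa using this
  have hv : val S p1 p2 (invRev h ++ y ++ h) = FF S p1 p2 β := by
    rw [h0, hyb]; rfl
  rw [hv] at hab
  rw [hab]
  have hbb : F ^ b = (F ^ a)⁻¹ := by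
    rw [zpow_add] at hab1
    exact eq_inv_of_mul_eq_one_right hab1
  rw [hbb, zpow_neg]
  group

end mainlemma2

set_option linter.unusedSectionVars false
set_option linter.unusedVariables false

section final
open FreeGroup
variable {S : IndexedStructure} {p1 p2 : ℕ}

theorem red_fw {A : Type} {f : GenSym A} {e : ℤ} {B : List (GenSym A × Bool)} (hB : FreeGroup.IsReduced B)
    (hh : ∀ z ∈ B.head?, z.1 ≠ f) : FreeGroup.IsReduced (fw f e ++ B) := by
  unfold FreeGroup.IsReduced at hB ⊢
  rw [List.isChain_append]
  refine ⟨fw_red f e, hB, ?_⟩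
  intro a ha b hb hab
  have h1 := fw_mem (List.mem_of_getLast? ha)
  exact absurd (by rw [← hab, h1]) (hh b hb)

theorem head_fw {A : Type} {f : GenSym A} {e : ℤ} (he : e ≠ 0) {B : List (GenSym A × Bool)} :
    ∀ z ∈ (fw f e ++ B).head?, z.1 = f := by
  intro z hz
  obtain ⟨n, hn⟩ : ∃ n, e.natAbs = n + 1 := ⟨e.natAbs - 1, by omega⟩
  unfold fw at hz
  rw [hn, List.replicate_succ] at hz
  simp at hz
  rw [← hz]

theorem bd_app {α : Type*} {w A B : List α} {a b : ℕ}
    (hA : ∀ s, s <:+: A → s <:+: w → 24 * s.length ≤ a)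
    (hB : ∀ s, s <:+: B → s <:+: w → 24 * s.length ≤ b) :
    ∀ s, s <:+: A ++ B → s <:+: w → 24 * s.length ≤ a + b := by
  intro s hs hw
  rcases List.infix_append_iff.1 hs with h | h | ⟨t1, t2, h, h1, h2⟩
  · have := hA s h hw; omega
  · have := hB s h hw; omega
  · have e1 := hA t1 h1.isInfix ((h ▸ (List.prefix_append t1 t2).isInfix : t1 <:+: s).trans hw)
    have e2 := hB t2 h2.isInfix ((h ▸ (List.suffix_append t1 t2).isInfix : t2 <:+: s).trans hw)
    rw [h, List.length_append]
    omega

theorem bd_repl {w : List (GenSym S.A × Bool)} (h : NPs S w) (n : ℕ) (z : GenSym S.A × Bool) :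
    ∀ s, s <:+: List.replicate n z → s <:+: w → 24 * s.length ≤ w.length := by
  intro s hs hw
  have : s = List.replicate s.length z :=
    List.eq_replicate_iff.2 ⟨rfl, fun b hb => List.eq_of_mem_replicate (hs.subset hb)⟩
  exact h.run (this ▸ hw)

theorem fin_word (h1 : 10 ^ 10 < p1) (h2 : 10 ^ 10 < p2) {β : GenSym S.A} (hb1 : β ≠ .f1) (hb2 : β ≠ .f2)
    {i j : ℤ} (hi : i ≠ 0) (hj : j ≠ 0) (hi2 : 2 * i.natAbs < p1) (hj2 : 2 * j.natAbs < p2)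
    (hv : val S p1 p2 (fw .f2 (-j) ++ (fw .f1 i ++ (fw β 1 ++ (fw .f1 (-i) ++ (fw .f2 j ++ fw β (-1)))))) = 1) :
    False := by
  classical
  have hr : FreeGroup.IsReduced (fw .f2 (-j) ++ (fw .f1 i ++ (fw β 1 ++ (fw .f1 (-i) ++ (fw .f2 j ++ fw β (-1)))))) := by
    have hz : fw β (-1) = fw β (-1) ++ [] := by simp
    refine red_fw (red_fw (red_fw (red_fw (red_fw (fw_red _ _) ?_) ?_) ?_) ?_) ?_
    · rw [hz]; intro z hz; rw [head_fw (by norm_num) z hz]; exact hb2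
    · intro z hz; rw [head_fw hj z hz]; simp
    · intro z hz; rw [head_fw (by omega) z hz]; exact hb1.symm
    · intro z hz; rw [head_fw (by norm_num) z hz]; exact hb1
    · intro z hz; rw [head_fw hi z hz]; simp
  obtain ⟨s, v, hR, hsv, hs⟩ := dehn' h1 h2 hr (by
    intro h
    have := congrArg List.length h
    simp [fw_len] at this) hv
  have hW := hR.len h1 h2
  rw [List.length_append] at hW
  rcases hR.cases with hN | ⟨f, sg, p, hf, hw⟩
  · have := bd_app (bd_repl hN _ _) (bd_app (bd_repl hN _ _) (bd_app (bd_repl hN _ _)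
      (bd_app (bd_repl hN _ _) (bd_app (bd_repl hN _ _) (bd_repl hN _ _))))) s hs
      (List.prefix_append s v).isInfix
    rw [List.length_append] at this
    omega
  · have hsr : ∀ z ∈ s, (f, sg) = z := by
      intro z hz
      have : z ∈ s ++ v := by simp [hz]
      rw [hw] at this
      exact (List.eq_of_mem_replicate this).symm
    have hc := List.count_eq_length.2 hsr
    have hle := hs.sublist.count_le (f, sg)
    have hl := congrArg List.length hw
    rw [List.length_append, List.length_replicate] at hl
    rw [hc] at hle
    simp only [List.count_append, fw, List.count_replicate, Int.natAbs_neg, beq_iff_eq, Prod.mk.injEq] at hle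
    rcases hf with ⟨hf, hp⟩ | ⟨hf, hp⟩
    · rw [hf] at hle
      simp only [hb1, reduceCtorEq, false_and, if_false, true_and] at hle
      have : ¬ (decide (0 < i) = sg ∧ decide (0 < -i) = sg) := by
        rintro ⟨a, b⟩
        have := a.trans b.symm
        rw [decide_eq_decide] at this
        omega
      split_ifs at hle <;> first | omega | tauto
    · rw [hf] at hle
      simp only [hb2, reduceCtorEq, false_and, if_false, true_and] at hle
      have : ¬ (decide (0 < j) = sg ∧ decide (0 < -j) = sg) := by
        rintro ⟨a, b⟩
        have := a.trans b.symm
        rw [decide_eq_decide] at this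
        omega
      split_ifs at hle <;> first | omega | tauto

theorem fin_lem (h1 : 10 ^ 10 < p1) (h2 : 10 ^ 10 < p2) (hp1 : p1.Prime) (hp2 : p2.Prime)
    {β : GenSym S.A} (hb1 : β ≠ .f1) (hb2 : β ≠ .f2) {i j : ℤ}
    (he : FF S p1 p2 .f1 ^ i * FF S p1 p2 β * (FF S p1 p2 .f1 ^ i)⁻¹ =
      FF S p1 p2 .f2 ^ j * FF S p1 p2 β * (FF S p1 p2 .f2 ^ j)⁻¹) :
    FF S p1 p2 .f1 ^ i * FF S p1 p2 β * (FF S p1 p2 .f1 ^ i)⁻¹ = FF S p1 p2 β := by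
  obtain ⟨i', hi, hi2⟩ := small_rep (hp1.eq_two_or_odd.resolve_left (by omega)) i
  obtain ⟨j', hj, hj2⟩ := small_rep (hp2.eq_two_or_odd.resolve_left (by omega)) j
  rw [zpow_congr (FF_pow (S := S) (p2 := p2) (Or.inl ⟨rfl, rfl⟩)) hi] at he ⊢
  rw [zpow_congr (FF_pow (S := S) (p1 := p1) (Or.inr ⟨rfl, rfl⟩)) hj] at he
  by_cases hi0 : i' = 0
  · simp [hi0]
  by_cases hj0 : j' = 0
  · rw [he]; simp [hj0]
  exfalso
  refine fin_word h1 h2 hb1 hb2 hi0 hj0 hi2 hj2 ?_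
  simp only [val_append, val_fw]
  have e2 : FF S p1 p2 .f1 ^ i' * FF S p1 p2 β * FF S p1 p2 .f1 ^ (-i') =
      FF S p1 p2 .f2 ^ j' * FF S p1 p2 β * FF S p1 p2 .f2 ^ (-j') := by
    rw [zpow_neg, zpow_neg]; exact he
  calc _ = FF S p1 p2 .f2 ^ (-j') * (FF S p1 p2 .f1 ^ i' * FF S p1 p2 β * FF S p1 p2 .f1 ^ (-i')) *
      FF S p1 p2 .f2 ^ j' * FF S p1 p2 β ^ (-1 : ℤ) := by group
    _ = 1 := by rw [e2]; group

theorem notin_F {P : ℕ} {f : GenSym S.A} (hf : (f = .f1 ∧ P = p1) ∨ (f = .f2 ∧ P = p2))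
    {x : GA S p1 p2} (hx : x ^ P ≠ 1) (i : ℤ) : x ≠ FF S p1 p2 f ^ i := by
  intro h
  apply hx
  rw [h, ← zpow_natCast, ← zpow_mul, mul_comm, zpow_mul, zpow_natCast, FF_pow hf, one_zpow]

theorem one_gen (h1 : 10 ^ 10 < p1) (h2 : 10 ^ 10 < p2) (hp1 : p1.Prime) (hp2 : p2.Prime)
    {lo : ℕ} (hlo : lo = 1000 ∨ lo = 2000 ∨ lo = 3000 ∨ lo = 4000)
    {β : GenSym S.A} (hb1 : β ≠ .f1) (hb2 : β ≠ .f2)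
    (o1 : ∀ γ : GenSym S.A, Ok lo γ .f1 → γ = β) (o2 : ∀ γ : GenSym S.A, Ok lo γ .f2 → γ = β)
    {x : GA S p1 p2} (hx1 : x ^ p1 ≠ 1) (hx2 : x ^ p2 ≠ 1)
    (c1 : chainProd lo x (FF S p1 p2 .f1) = 1) (c2 : chainProd lo x (FF S p1 p2 .f2) = 1) :
    x = FF S p1 p2 β := by
  have one : ∀ P : ℕ, 10 ^ 10 < P → ¬ (P : ℤ) ∣ 1 := by
    intro P hP h
    have := Int.le_of_dvd (by norm_num) h
    omega
  obtain ⟨-, β1, i, ok1, e1⟩ := ML h1 h2 (Or.inl ⟨rfl, rfl⟩) hp1 hlo (one _ h1)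
    (notin_F (Or.inl ⟨rfl, rfl⟩) hx1) (by rw [zpow_one]; exact c1)
  obtain ⟨-, β2, j, ok2, e2⟩ := ML h1 h2 (Or.inr ⟨rfl, rfl⟩) hp2 hlo (one _ h2)
    (notin_F (Or.inr ⟨rfl, rfl⟩) hx2) (by rw [zpow_one]; exact c2)
  rw [o1 _ ok1] at e1
  rw [o2 _ ok2] at e2
  rw [e1]
  exact fin_lem h1 h2 hp1 hp2 hb1 hb2 (e1.symm.trans e2)

theorem chain_conj {G : Type*} [Group G] (lo : ℕ) (g x y : G) :
    chainProd lo (g * x * g⁻¹) (g * y * g⁻¹) = g * chainProd lo x y * g⁻¹ := by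
  unfold chainProd
  rw [← prod_conj, List.map_map]
  have e : ∀ k, g * x * g⁻¹ * (g * y * g⁻¹) ^ ((lo + k + 1) ^ 2) = g * (x * y ^ ((lo + k + 1) ^ 2)) * g⁻¹ := by
    intro k
    generalize (lo + k + 1) ^ 2 = n
    rw [conj_pow]
    group
  simp only [e]
  rfl

theorem coprime_one {G : Type*} [Group G] {p q : ℕ} (hp : p.Prime) (hq : q.Prime) (hne : p ≠ q) {t : G}
    (h1 : t ^ p = 1) (h2 : t ^ q = 1) : t = 1 := by
  have := pow_gcd_eq_one.2 ⟨h1, h2⟩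
  rwa [(Nat.coprime_primes hp hq).2 hne, pow_one] at this

theorem zpow_pow_one {G : Type*} [Group G] {F : G} {p : ℕ} (h : F ^ p = 1) (i : ℤ) : (F ^ i) ^ p = 1 := by
  rw [← zpow_natCast, ← zpow_mul, mul_comm, zpow_mul, zpow_natCast, h, one_zpow]

end final

theorem stmt_7 (S : IndexedStructure) (p₁ p₂ : ℕ)
    (hp₁ : p₁.Prime) (hp₂ : p₂.Prime) (hne : p₁ ≠ p₂)
    (hbig₁ : 10 ^ 10 < p₁) (hbig₂ : 10 ^ 10 < p₂)
    (x y z t₁ t₂ : GA S p₁ p₂)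
    (ht₁ : t₁ ^ p₁ = 1) (ht₁' : t₁ ≠ 1)
    (ht₂ : t₂ ^ p₂ = 1) (ht₂' : t₂ ≠ 1)
    (hv₁ : chainProd 4000 t₁ t₂ = 1) (hv₂ : chainProd 4000 t₂ t₁ = 1)
    (hxb₁ : chainProd 1000 x t₁ = 1) (hxb₂ : chainProd 1000 x t₂ = 1)
    (hx₁ : x ^ p₁ ≠ 1) (hx₂ : x ^ p₂ ≠ 1)
    (hyc₁ : chainProd 2000 y t₁ = 1) (hyc₂ : chainProd 2000 y t₂ = 1)
    (hy₁ : y ^ p₁ ≠ 1) (hy₂ : y ^ p₂ ≠ 1)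
    (hzd₁ : chainProd 3000 z t₁ = 1) (hzd₂ : chainProd 3000 z t₂ = 1)
    (hz₁ : z ^ p₁ ≠ 1) (hz₂ : z ^ p₂ ≠ 1) :
    ∃ g : GA S p₁ p₂,
      x = g * gen S p₁ p₂ GenSym.b * g⁻¹ ∧
      y = g * gen S p₁ p₂ GenSym.c * g⁻¹ ∧
      z = g * gen S p₁ p₂ GenSym.d * g⁻¹ ∧
      t₁ = g * gen S p₁ p₂ GenSym.f1 * g⁻¹ ∧
      t₂ = g * gen S p₁ p₂ GenSym.f2 * g⁻¹ ∧
      -- in particular, `(x,y,z,t₁,t₂)` is in the orbit of `(b,c,d,f₁,f₂)` under the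
      -- automorphism group of `G(𝒜)`:
      ∃ φ : GA S p₁ p₂ ≃* GA S p₁ p₂,
        φ (gen S p₁ p₂ GenSym.b) = x ∧ φ (gen S p₁ p₂ GenSym.c) = y ∧
        φ (gen S p₁ p₂ GenSym.d) = z ∧ φ (gen S p₁ p₂ GenSym.f1) = t₁ ∧
        φ (gen S p₁ p₂ GenSym.f2) = t₂ := by
  have hF1 : FF S p₁ p₂ .f1 ^ p₁ = 1 := FF_pow (Or.inl ⟨rfl, rfl⟩)
  have hF2 : FF S p₁ p₂ .f2 ^ p₂ = 1 := FF_pow (Or.inr ⟨rfl, rfl⟩)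
  obtain ⟨g, f, l, hf, hg⟩ := torsion hbig₁ hbig₂ t₂ p₂ hp₂.pos ht₂ ht₂'
  have hg' : t₂ = g * FF S p₁ p₂ f ^ l * g⁻¹ := hg
  clear hg
  have hff : f = .f2 := by
    rcases hf with h | h
    · exfalso
      rw [h] at hg'
      have e1 : (FF S p₁ p₂ .f1 ^ l) ^ p₁ = 1 := zpow_pow_one hF1 l
      refine ht₂' (coprime_one hp₁ hp₂ hne ?_ ht₂)
      rw [hg', conj_pow, e1]; simp
    · exact h
  rw [hff] at hg'
  have hl : ¬ (p₂ : ℤ) ∣ l := by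
    intro h
    apply ht₂'
    rw [hg', zpow_congr hF2 (m := l) (e := 0) (by simpa using h)]
    simp
  have hc1 : chainProd 4000 (g⁻¹ * t₁ * g) (FF S p₁ p₂ .f2 ^ l) = 1 := by
    have := chain_conj 4000 g⁻¹ t₁ t₂
    rw [hv₁, hg', inv_inv] at this
    have e : g⁻¹ * (g * FF S p₁ p₂ .f2 ^ l * g⁻¹) * g = FF S p₁ p₂ .f2 ^ l := by group
    rw [e] at this
    rw [this]; simp
  obtain ⟨hl1, β, i, hok, ht⟩ := ML hbig₁ hbig₂ (Or.inr ⟨rfl, rfl⟩) hp₂ (Or.inr (Or.inr (Or.inr rfl))) hl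
    (by
      intro i hi
      apply ht₁'
      have e2 : t₁ = g * FF S p₁ p₂ .f2 ^ i * g⁻¹ := by rw [← hi]; group
      refine coprime_one hp₁ hp₂ hne ht₁ ?_
      rw [e2, conj_pow, zpow_pow_one hF2]; simp) hc1
  have hβ : β = .f1 := by cases hok; rfl
  rw [hβ] at ht
  rw [zpow_congr hF2 hl1 (e := 1), zpow_one] at hg'
  obtain ⟨k, hk⟩ : ∃ k, k = g * FF S p₁ p₂ .f2 ^ i := ⟨_, rfl⟩
  have k1 : t₁ = k * FF S p₁ p₂ .f1 * k⁻¹ := by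
    have : t₁ = g * (g⁻¹ * t₁ * g) * g⁻¹ := by group
    rw [this, ht, hk]; group
  have k2 : t₂ = k * FF S p₁ p₂ .f2 * k⁻¹ := by
    rw [hg', hk]; group
  have j1 : k⁻¹ * t₁ * k⁻¹⁻¹ = FF S p₁ p₂ .f1 := by rw [k1]; group
  have j2 : k⁻¹ * t₂ * k⁻¹⁻¹ = FF S p₁ p₂ .f2 := by rw [k2]; group
  have key : ∀ (lo : ℕ) (β : GenSym S.A) (x : GA S p₁ p₂),
      (lo = 1000 ∨ lo = 2000 ∨ lo = 3000 ∨ lo = 4000) → β ≠ .f1 → β ≠ .f2 →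
      (∀ γ : GenSym S.A, Ok lo γ .f1 → γ = β) → (∀ γ : GenSym S.A, Ok lo γ .f2 → γ = β) →
      x ^ p₁ ≠ 1 → x ^ p₂ ≠ 1 → chainProd lo x t₁ = 1 → chainProd lo x t₂ = 1 →
      x = k * gen S p₁ p₂ β * k⁻¹ := by
    intro lo β x hlo hb1 hb2 o1 o2 hx1 hx2 c1 c2
    have d1 := chain_conj lo k⁻¹ x t₁
    have d2 := chain_conj lo k⁻¹ x t₂
    rw [j1, c1, mul_one, mul_inv_cancel] at d1
    rw [j2, c2, mul_one, mul_inv_cancel] at d2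
    have cc : ∀ n : ℕ, x ^ n ≠ 1 → (k⁻¹ * x * k⁻¹⁻¹) ^ n ≠ 1 := by
      intro n hn h
      rw [conj_pow, inv_inv] at h
      apply hn
      have : x ^ n = k * (k⁻¹ * x ^ n * k) * k⁻¹ := by group
      rw [this, h]; simp
    have := one_gen hbig₁ hbig₂ hp₁ hp₂ hlo hb1 hb2 o1 o2 (cc _ hx1) (cc _ hx2) d1 d2
    have e : gen S p₁ p₂ β = FF S p₁ p₂ β := rfl
    rw [e, ← this]; group
  have kx := key 1000 .b x (by simp) (by simp) (by simp) (by intro γ h; cases h; rfl)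
    (by intro γ h; cases h; rfl) hx₁ hx₂ hxb₁ hxb₂
  have ky := key 2000 .c y (by simp) (by simp) (by simp) (by intro γ h; cases h; rfl)
    (by intro γ h; cases h; rfl) hy₁ hy₂ hyc₁ hyc₂
  have kz := key 3000 .d z (by simp) (by simp) (by simp) (by intro γ h; cases h; rfl)
    (by intro γ h; cases h; rfl) hz₁ hz₂ hzd₁ hzd₂
  have k1' : t₁ = k * gen S p₁ p₂ .f1 * k⁻¹ := k1
  have k2' : t₂ = k * gen S p₁ p₂ .f2 * k⁻¹ := k2
  exact ⟨k, kx, ky, kz, k1', k2', MulAut.conj k, kx.symm, ky.symm, kz.symm, k1'.symm, k2'.symm⟩
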